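/- Let A be a positive odd squarefree integer. Then the limit C_{Σ_A} = lim_{T→∞} ∏_{primes p ≤ T} (1 + f_A(p)/p)(1 − 1/p) exists, and for every ε with 0 < ε < 1, as X → ∞, the number of totally real C₄-quartic subfields K of ℂ such that Δ_K ≤ X, the 2-adic valuation of Δ_K equals 6, and for every odd prime p one has v_p(Δ_K) = 2 if and only if p divides A, equals (C_{Σ_A}/(2⁹A²)^{1/3})·X^{1/3} + O(X^{1/3}/(log X)^{1−ε}). -/

import Mathlib

open Filter Asymptotics

noncomputable section

/-- The (absolute) discriminant of a subfield of `ℂ`, defined to be `0` when the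
field is not finite-dimensional over `ℚ`. -/
def quartDisc (K : IntermediateField ℚ ℂ) : ℤ := by
  classical
  exact if h : FiniteDimensional ℚ K then
    haveI : CharZero K := charZero_of_injective_algebraMap (algebraMap ℚ K).injective
    haveI : NumberField K := ⟨⟩
    NumberField.discr K
  else 0

/-- A `C₄`-quartic field: a subfield of `ℂ` of degree 4 over `ℚ`, Galois over `ℚ`, with
cyclic Galois group of order 4. -/
def IsC4Quartic (K : IntermediateField ℚ ℂ) : Prop :=
  Module.finrank ℚ K = 4 ∧ IsGalois ℚ K ∧
    Nonempty ((K ≃ₐ[ℚ] K) ≃* Multiplicative (ZMod 4))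

/-- `K` is totally real: every embedding of `K` into `ℂ` has image contained in `ℝ`. -/
def IsTotallyRealSubfield (K : IntermediateField ℚ ℂ) : Prop :=
  ∀ (σ : K →+* ℂ) (x : K), (σ x).im = 0

/-- `f_A(p) = 2` if `p ≡ 1 (mod 4)` and `p ∤ A`, and `0` otherwise. -/
def fA (A : ℤ) (p : ℕ) : ℝ := by
  classical
  exact if p % 4 = 1 ∧ ¬((p : ℤ) ∣ A) then 2 else 0

structure C4Rel {K : Type*} [Field K] (D b c q : ℚ) (δ β β' : K) : Prop where
  hD : b ^ 2 + c ^ 2 = D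
  nsq : ¬ IsSquare D
  hq : q ≠ 0
  d2 : δ ^ 2 = (D : K)
  b2 : β ^ 2 = (q : K) * (D + b * δ)
  b2' : β' ^ 2 = (q : K) * (D - b * δ)
  bb : β * β' = (q : K) * c * δ
  db : δ * β = b * β + c * β'
  db' : δ * β' = c * β - b * β'

namespace C4Rel

section basic
variable {K : Type*} [Field K] [CharZero K] {D b c q : ℚ} {δ β β' : K}

theorem c_ne_zero (hD : b ^ 2 + c ^ 2 = D) (nsq : ¬ IsSquare D) : c ≠ 0 := by
  rintro rfl
  exact nsq ⟨b, by rw [← hD]; ring⟩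

theorem of_two (hD : b ^ 2 + c ^ 2 = D) (nsq : ¬ IsSquare D) (hq : q ≠ 0)
    (d2 : δ ^ 2 = (D : K)) (b2 : β ^ 2 = (q : K) * (D + b * δ)) :
    C4Rel D b c q δ β ((δ - b) * β / c) := by
  have hc : (c : K) ≠ 0 := by exact_mod_cast c_ne_zero hD nsq
  have hDK : (b : K) ^ 2 + (c : K) ^ 2 = (D : K) := by exact_mod_cast congrArg (Rat.cast (K := K)) hD
  refine ⟨hD, nsq, hq, d2, b2, ?_, ?_, ?_, ?_⟩
  · rw [div_pow, mul_pow, b2, div_eq_iff (pow_ne_zero _ hc)]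
    have : (c : K) ^ 2 = D - (b : K) ^ 2 := by rw [← hDK]; ring
    rw [this]
    linear_combination (q : K) * (D - 2 * b ^ 2 + b * δ) * d2
  · have : β * ((δ - b) * β / c) = (δ - b) * β ^ 2 / c := by ring
    rw [this, b2, div_eq_iff hc]
    linear_combination (q : K) * b * d2 - (q : K) * δ * hDK
  · field_simp; ring
  · field_simp
    linear_combination β * d2 - β * hDK

theorem quad_indep (nsq : ¬ IsSquare D) (d2 : δ ^ 2 = (D : K)) {r s : ℚ}
    (h : (r : K) + s * δ = 0) : r = 0 ∧ s = 0 := by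
  have h2 : (r : K) ^ 2 = s ^ 2 * D := by
    rw [← d2]; linear_combination (r - s * δ) * h
  have h3 : r ^ 2 = s ^ 2 * D := by exact_mod_cast h2
  by_cases hs : s = 0
  · subst hs; simpa using h3
  · exfalso
    exact nsq ⟨r / s, by field_simp; linarith⟩

theorem indep (h : C4Rel D b c q δ β β') {r s t w : ℚ}
    (e : (r : K) + s * δ + t * β + w * β' = 0) : r = 0 ∧ s = 0 ∧ t = 0 ∧ w = 0 := by
  have e1 : (r + s * δ) ^ 2 = (t * β + w * β') ^ 2 := by
    linear_combination (r + s * δ - t * β - w * β') * e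
  have e2 : ((r ^ 2 + s ^ 2 * D - q * D * (t ^ 2 + w ^ 2) : ℚ) : K) +
      ((2 * r * s - q * (b * (t ^ 2 - w ^ 2) + 2 * c * t * w) : ℚ) : K) * δ = 0 := by
    push_cast
    linear_combination e1 - s ^ 2 * h.d2 + t ^ 2 * h.b2 + w ^ 2 * h.b2' + 2 * t * w * h.bb
  obtain ⟨f1, f2⟩ := quad_indep h.nsq h.d2 e2
  have hD := h.hD
  have f3 : (r ^ 2 - D * s ^ 2) ^ 2 =
      D * (q * (c * (t ^ 2 - w ^ 2) - 2 * b * t * w)) ^ 2 := by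
    have g1 : r ^ 2 + s ^ 2 * D = q * D * (t ^ 2 + w ^ 2) := by linarith
    have g2 : 2 * r * s = q * (b * (t ^ 2 - w ^ 2) + 2 * c * t * w) := by linarith
    have : (r ^ 2 - D * s ^ 2) ^ 2 = (r ^ 2 + s ^ 2 * D) ^ 2 - D * (2 * r * s) ^ 2 := by ring
    rw [this, g1, g2, ← hD]; ring
  have hrs : r ^ 2 - D * s ^ 2 = 0 := by
    by_contra hne
    have hne2 : q * (c * (t ^ 2 - w ^ 2) - 2 * b * t * w) ≠ 0 := by
      intro h0; rw [h0] at f3; apply hne; simpa using f3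
    exact h.nsq ⟨(r ^ 2 - D * s ^ 2) / (q * (c * (t ^ 2 - w ^ 2) - 2 * b * t * w)), by
      rw [div_mul_div_comm, eq_div_iff (mul_ne_zero hne2 hne2)]; linarith⟩
  have hs : s = 0 := by
    by_contra hs
    exact h.nsq ⟨r / s, by field_simp; linarith⟩
  subst hs
  have hr : r = 0 := by simpa using hrs
  subst hr
  have hD0 : D ≠ 0 := by rintro rfl; exact h.nsq ⟨0, by simp⟩
  have : q * D * (t ^ 2 + w ^ 2) = 0 := by linarith
  have h5 : t ^ 2 + w ^ 2 = 0 := by simpa [h.hq, hD0] using this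
  refine ⟨rfl, rfl, ?_, ?_⟩ <;> nlinarith [sq_nonneg t, sq_nonneg w]

/-- the Hilbert 90 change of representation -/
theorem change (h : C4Rel D b c q δ β β') {b₁ c₁ : ℚ} (h1 : b₁ ^ 2 + c₁ ^ 2 = D) :
    (β * ((D + b * b₁ + c * c₁ : ℚ) + (b + b₁) * δ) / (D + b * δ)) ^ 2 =
      ((q * (2 * (D + b * b₁ + c * c₁)) / D : ℚ) : K) * (D + b₁ * δ) := by
  have hD0 : D ≠ 0 := by rintro rfl; exact h.nsq ⟨0, by simp⟩
  have hDK0 : (D : K) ≠ 0 := by exact_mod_cast hD0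
  have hα : (D : K) + b * δ ≠ 0 := fun h0 => hD0 (quad_indep h.nsq h.d2 h0).1
  have hDK : (b : K) ^ 2 + (c : K) ^ 2 = (D : K) := by
    exact_mod_cast congrArg (Rat.cast (K := K)) h.hD
  have hDK1 : (b₁ : K) ^ 2 + (c₁ : K) ^ 2 = (D : K) := by
    exact_mod_cast congrArg (Rat.cast (K := K)) h1
  have d2 := h.d2
  rw [div_pow, mul_pow, h.b2, div_eq_iff (pow_ne_zero _ hα)]
  push_cast
  have key : (D : K) * ((D + b * b₁ + c * c₁) + (b + b₁) * δ) ^ 2 =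
      2 * (D + b * b₁ + c * c₁) * (D + b₁ * δ) * (D + b * δ) := by
    have hc2 : (c : K) ^ 2 = D - (b : K) ^ 2 := by rw [← hDK]; ring
    have hc12 : (c₁ : K) ^ 2 = D - (b₁ : K) ^ 2 := by rw [← hDK1]; ring
    have hcc : ((c : K) * c₁) ^ 2 = (D - (b : K) ^ 2) * (D - (b₁ : K) ^ 2) := by
      rw [mul_pow, hc2, hc12]
    linear_combination (D * (b + b₁) ^ 2 - 2 * b * b₁ * (D + b * b₁ + c * c₁)) * d2 + D * hcc
  field_simp
  linear_combination (q : K) * key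

end basic
end C4Rel

namespace C4Rel
section nf
variable {K : Type*} [Field K] [NumberField K] {D b c q : ℚ} {δ β β' : K}

theorem linInd (h : C4Rel D b c q δ β β') : LinearIndependent ℚ ![(1:K), δ, β, β'] := by
  rw [Fintype.linearIndependent_iff]
  intro g hg
  simp only [Fin.sum_univ_four, Rat.smul_def] at hg
  simp at hg
  obtain ⟨h0, h1, h2, h3⟩ := h.indep hg
  intro i; fin_cases i <;> assumption

theorem trace_eq (h : C4Rel D b c q δ β β')
    (hspan : ∀ x : K, ∃ r s t w : ℚ, x = r + s * δ + t * β + w * β')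
    (τ : K ≃+* K) (t1 : τ δ = -δ) (t2 : τ β = β') (t3 : τ β' = -β) (r s t w : ℚ) :
    Algebra.trace ℚ K (r + s * δ + t * β + w * β') = 4 * r := by
  let τ' : K ≃ₐ[ℚ] K := AlgEquiv.ofRingEquiv (f := τ) (fun _ => by simp)
  have hfin : Module.finrank ℚ K = 4 := by
    have : ⊤ ≤ Submodule.span ℚ (Set.range ![(1:K), δ, β, β']) := by
      intro x _
      obtain ⟨r, s, t, w, rfl⟩ := hspan x
      rw [Submodule.mem_span_range_iff_exists_fun]
      refine ⟨![r, s, t, w], ?_⟩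
      simp [Fin.sum_univ_four, Rat.smul_def]
    have := Module.finrank_eq_card_basis (Module.Basis.mk h.linInd this)
    simpa using this
  have hδ : Algebra.trace ℚ K δ = 0 := by
    have := Algebra.trace_eq_of_algEquiv τ' δ
    have e : τ' δ = -δ := t1
    rw [e, map_neg] at this; linarith
  have hβ : Algebra.trace ℚ K β = 0 := by
    have := Algebra.trace_eq_of_algEquiv τ' (τ' β)
    rw [Algebra.trace_eq_of_algEquiv τ' β] at this
    have e : τ' (τ' β) = -β := by change τ (τ β) = -β; rw [t2, t3]
    rw [e, map_neg] at this; linarith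
  have hβ' : Algebra.trace ℚ K β' = 0 := by
    have := Algebra.trace_eq_of_algEquiv τ' β'
    have e : τ' β' = -β := t3
    rw [e, map_neg, hβ] at this; linarith
  have h1 : Algebra.trace ℚ K (r : K) = 4 * r := by
    have := Algebra.trace_algebraMap (S := K) (r : ℚ)
    simpa [hfin, nsmul_eq_mul] using this
  have e : (r : K) + s * δ + t * β + w * β' = (r : K) + s • δ + t • β + w • β' := by
    simp [Rat.smul_def]
  rw [e]
  simp only [map_add, map_smul, hδ, hβ, hβ', h1, smul_zero, add_zero]

theorem discr_std (h : C4Rel D b c q δ β β')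
    (hspan : ∀ x : K, ∃ r s t w : ℚ, x = r + s * δ + t * β + w * β')
    (τ : K ≃+* K) (t1 : τ δ = -δ) (t2 : τ β = β') (t3 : τ β' = -β) :
    Algebra.discr ℚ ![(1:K), δ, β, β'] = 256 * q ^ 2 * D ^ 3 := by
  have tr := h.trace_eq hspan τ t1 t2 t3
  have tr' : ∀ (x : K) (r s t w : ℚ), x = r + s * δ + t * β + w * β' →
      Algebra.trace ℚ K x = 4 * r := by
    rintro x r s t w rfl; exact tr r s t w
  have hm : Algebra.traceMatrix ℚ ![(1:K), δ, β, β'] =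
      Matrix.diagonal ![4, 4 * D, 4 * (q * D), 4 * (q * D)] := by
    ext i j
    rw [Algebra.traceMatrix_apply, Algebra.traceForm_apply]
    fin_cases i <;> fin_cases j <;> simp [Matrix.diagonal]
    · simpa using tr' 1 1 0 0 0 (by simp)
    · simpa using tr' δ 0 1 0 0 (by simp)
    · simpa using tr' β 0 0 1 0 (by simp)
    · simpa using tr' β' 0 0 0 1 (by simp)
    · simpa using tr' δ 0 1 0 0 (by simp)
    · exact tr' _ D 0 0 0 (by simp [← h.d2]; ring)
    · simpa using tr' _ 0 0 b c (by rw [h.db]; simp)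
    · simpa using tr' _ 0 0 c (-b) (by rw [h.db']; simp; ring)
    · simpa using tr' β 0 0 1 0 (by simp)
    · simpa using tr' _ 0 0 b c (by rw [mul_comm, h.db]; simp)
    · exact tr' _ (q * D) (q * b) 0 0 (by rw [← sq, h.b2]; push_cast; ring)
    · simpa using tr' _ 0 (q * c) 0 0 (by rw [h.bb]; push_cast; ring)
    · simpa using tr' β' 0 0 0 1 (by simp)
    · simpa using tr' _ 0 0 c (-b) (by rw [mul_comm, h.db']; simp; ring)
    · simpa using tr' _ 0 (q * c) 0 0 (by rw [mul_comm, h.bb]; push_cast; ring)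
    · exact tr' _ (q * D) (-(q * b)) 0 0 (by rw [← sq, h.b2']; push_cast; ring)
  rw [Algebra.discr_def, hm, Matrix.det_diagonal]
  simp [Fin.prod_univ_four]; ring

/-- index formula -/
theorem index_dvd {e : Fin 4 → K} (hfin : Module.finrank ℚ K = 4)
    (he : ∀ i, IsIntegral ℤ (e i)) :
    ∃ n : ℤ, Algebra.discr ℚ e = (n : ℚ) ^ 2 * (NumberField.discr K : ℚ) := by
  classical
  have hc : Fintype.card (Module.Free.ChooseBasisIndex ℤ (NumberField.RingOfIntegers K)) = Fintype.card (Fin 4) := by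
    rw [← Module.finrank_eq_card_chooseBasisIndex, NumberField.RingOfIntegers.rank, hfin]; simp
  let eq := Fintype.equivOfCardEq hc
  let B := (NumberField.integralBasis K).reindex eq
  have hB : Algebra.discr ℚ B = (NumberField.discr K : ℚ) := by
    rw [NumberField.coe_discr]
    simp only [B, Module.Basis.coe_reindex, Algebra.discr_reindex]
  have hBint : IsIntegral ℤ (B.toMatrix e).det := by
    refine IsIntegral.det fun i j => ?_
    rw [Module.Basis.toMatrix_apply]
    have := NumberField.integralBasis_repr_apply K ⟨e j, he j⟩ (eq.symm i)
    simp only [B, Module.Basis.repr_reindex_apply]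
    change (NumberField.integralBasis K).repr (e j) _ = _ at this
    rw [this]
    exact isIntegral_algebraMap
  obtain ⟨n, hn⟩ := IsIntegrallyClosed.isIntegral_iff.1 hBint
  refine ⟨n, ?_⟩
  rw [← hB]
  conv_lhs => rw [← B.toMatrix_map_vecMul e]
  rw [Algebra.discr_of_matrix_vecMul, ← hn]
  simp

end nf
end C4Rel

namespace C4Int

theorem dvd_of_sum_diff {p T W : ℤ} (hp : Prime p) (h2 : ¬ p ∣ 2) (h1 : p ∣ T ^ 2 - W ^ 2)
    (h3 : p ∣ T ^ 2 + W ^ 2) : p ∣ T ∧ p ∣ W := by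
  have a : p ∣ 2 * T ^ 2 := by have := dvd_add h1 h3; ring_nf at this ⊢; exact this
  have b : p ∣ 2 * W ^ 2 := by have := dvd_sub h3 h1; ring_nf at this ⊢; exact this
  exact ⟨hp.dvd_of_dvd_pow ((hp.dvd_or_dvd a).resolve_left h2),
    hp.dvd_of_dvd_pow ((hp.dvd_or_dvd b).resolve_left h2)⟩

theorem coprime_of_not_dvd {p a : ℤ} (hp : Prime p) (h : ¬ p ∣ a) : IsCoprime p a :=
  (hp.irreducible.coprime_iff_not_dvd).2 h

theorem sq_dvd_of_pow4 {p a : ℤ} (h : p ^ 4 ∣ a ^ 2) : p ^ 2 ∣ a := by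
  have : (p ^ 2) ^ 2 ∣ a ^ 2 := by rw [← pow_mul]; exact h
  exact (Int.pow_dvd_pow_iff two_ne_zero).1 this

theorem step_odd {p D b c q T W : ℤ} (hp : Prime p) (h2 : ¬ p ∣ 2) (hD : b ^ 2 + c ^ 2 = D)
    (sD : Squarefree D) (sq' : Squarefree q) (cop : IsCoprime q D)
    (h1 : p ^ 4 ∣ 16 * (q ^ 2 * D * (c * (T ^ 2 - W ^ 2) - 2 * b * T * W) ^ 2))
    (h3 : p ^ 4 ∣ 64 * (q ^ 2 * D * (b * (T ^ 2 - W ^ 2) + 2 * c * T * W) ^ 2))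
    (h4 : p ^ 2 ∣ 8 * (q * D * (T ^ 2 + W ^ 2))) : p ∣ T ∧ p ∣ W := by
  have c2 : IsCoprime p 2 := coprime_of_not_dvd hp h2
  have c8 : IsCoprime p 8 := by have := c2.pow_right (n := 3); norm_num at this; exact this
  have c16 : IsCoprime p 16 := by have := c2.pow_right (n := 4); norm_num at this; exact this
  have c64 : IsCoprime p 64 := by have := c2.pow_right (n := 6); norm_num at this; exact this
  replace h1 := (c16.pow_left (m := 4)).dvd_of_dvd_mul_left h1
  replace h3 := (c64.pow_left (m := 4)).dvd_of_dvd_mul_left h3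
  replace h4 := (c8.pow_left (m := 2)).dvd_of_dvd_mul_left h4
  set I := c * (T ^ 2 - W ^ 2) - 2 * b * T * W with hI
  set R := b * (T ^ 2 - W ^ 2) + 2 * c * T * W with hR
  have key : b * R + c * I = D * (T ^ 2 - W ^ 2) := by rw [hI, hR, ← hD]; ring
  by_cases pq : p ∣ q
  · have pD : ¬ p ∣ D := by
      intro pD
      exact hp.not_isUnit (cop.isUnit_of_dvd' pq pD)
    obtain ⟨q1, rfl⟩ := pq
    have pq1 : ¬ p ∣ q1 := by
      rintro ⟨q2, rfl⟩
      exact hp.not_isUnit (sq' p ⟨q2, by ring⟩)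
    have cD := coprime_of_not_dvd hp pD
    have cq := coprime_of_not_dvd hp pq1
    have aux : ∀ J : ℤ, p ^ 4 ∣ (p * q1) ^ 2 * D * J ^ 2 → p ∣ J := by
      intro J hJ
      have : p ^ 2 * p ^ 2 ∣ p ^ 2 * (q1 ^ 2 * D * J ^ 2) := by ring_nf at hJ ⊢; exact hJ
      have h5 := (mul_dvd_mul_iff_left (pow_ne_zero 2 hp.ne_zero)).1 this
      have h6 : p ^ 2 ∣ J ^ 2 := by
        refine (IsCoprime.pow_left (m := 2) ?_).dvd_of_dvd_mul_left h5
        exact (cq.pow_right).mul_right cD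
      exact (Int.pow_dvd_pow_iff two_ne_zero).1 h6
    have hI' := aux _ h1
    have hR' := aux _ h3
    have h7 : p ∣ D * (T ^ 2 - W ^ 2) := by
      rw [← key]; exact dvd_add (hR'.mul_left _) (hI'.mul_left _)
    have h8 : p ∣ T ^ 2 - W ^ 2 := (hp.dvd_or_dvd h7).resolve_left pD
    have h9 : p ∣ T ^ 2 + W ^ 2 := by
      have : p * p ∣ p * (q1 * D * (T ^ 2 + W ^ 2)) := by ring_nf at h4 ⊢; exact h4
      have h5 := (mul_dvd_mul_iff_left hp.ne_zero).1 this
      exact (cq.mul_right cD).dvd_of_dvd_mul_left h5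
    exact dvd_of_sum_diff hp h2 h8 h9
  · have cq := coprime_of_not_dvd hp pq
    have h1' : p ^ 4 ∣ D * I ^ 2 := by
      rw [mul_assoc] at h1
      exact ((cq.pow_right (n := 2)).pow_left (m := 4)).dvd_of_dvd_mul_left h1
    have h3' : p ^ 4 ∣ D * R ^ 2 := by
      rw [mul_assoc] at h3
      exact ((cq.pow_right (n := 2)).pow_left (m := 4)).dvd_of_dvd_mul_left h3
    have h4' : p ^ 2 ∣ D * (T ^ 2 + W ^ 2) := by
      rw [mul_assoc] at h4
      exact (cq.pow_left (m := 2)).dvd_of_dvd_mul_left h4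
    by_cases pD : p ∣ D
    · obtain ⟨D1, hD1⟩ := pD
      have pD1 : ¬ p ∣ D1 := by
        rintro ⟨q2, rfl⟩
        exact hp.not_isUnit (sD p ⟨q2, by rw [hD1]; ring⟩)
      have cD := coprime_of_not_dvd hp pD1
      have aux : ∀ J : ℤ, p ^ 4 ∣ D * J ^ 2 → p ^ 2 ∣ J := by
        intro J hJ
        have : p * p ^ 3 ∣ p * (D1 * J ^ 2) := by rw [hD1] at hJ; ring_nf at hJ ⊢; exact hJ
        have h5 := (mul_dvd_mul_iff_left hp.ne_zero).1 this
        have h6 : p ^ 3 ∣ J ^ 2 := (cD.pow_left (m := 3)).dvd_of_dvd_mul_left h5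
        have h7 : p ∣ J := hp.dvd_of_dvd_pow (dvd_trans (dvd_pow_self p (by norm_num)) h6)
        obtain ⟨j, rfl⟩ := h7
        have : p ^ 2 * p ∣ p ^ 2 * j ^ 2 := by ring_nf at h6 ⊢; exact h6
        have h8 := (mul_dvd_mul_iff_left (pow_ne_zero 2 hp.ne_zero)).1 this
        obtain ⟨k, rfl⟩ := hp.dvd_of_dvd_pow h8
        exact ⟨k, by ring⟩
      have hI' := aux _ h1'
      have hR' := aux _ h3'
      have h7 : p ^ 2 ∣ D * (T ^ 2 - W ^ 2) := by
        rw [← key]; exact dvd_add (hR'.mul_left _) (hI'.mul_left _)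
      have aux2 : ∀ J : ℤ, p ^ 2 ∣ D * J → p ∣ J := by
        intro J hJ
        have : p * p ∣ p * (D1 * J) := by rw [hD1] at hJ; ring_nf at hJ ⊢; exact hJ
        exact cD.dvd_of_dvd_mul_left ((mul_dvd_mul_iff_left hp.ne_zero).1 this)
      exact dvd_of_sum_diff hp h2 (aux2 _ h7) (aux2 _ h4')
    · have cD := coprime_of_not_dvd hp pD
      have hI' := sq_dvd_of_pow4 ((cD.pow_left (m := 4)).dvd_of_dvd_mul_left h1')
      have hR' := sq_dvd_of_pow4 ((cD.pow_left (m := 4)).dvd_of_dvd_mul_left h3')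
      have h7 : p ^ 2 ∣ D * (T ^ 2 - W ^ 2) := by
        rw [← key]; exact dvd_add (hR'.mul_left _) (hI'.mul_left _)
      have h8 := (cD.pow_left (m := 2)).dvd_of_dvd_mul_left h7
      have h9 := (cD.pow_left (m := 2)).dvd_of_dvd_mul_left h4'
      exact dvd_of_sum_diff hp h2 (dvd_trans (dvd_pow_self p (by norm_num)) h8)
        (dvd_trans (dvd_pow_self p (by norm_num)) h9)

/-- `(u+v√D)/p`-type statement: quadratic part. -/
theorem step_quad {p D κ a0 a1 : ℤ} (hp : Prime p) (sD : Squarefree D) (hκ : D = 4 * κ + 1)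
    (h1 : p ∣ 2 * a0 + a1) (h2 : p ^ 2 ∣ a0 ^ 2 + a0 * a1 - κ * a1 ^ 2) : p ∣ a0 ∧ p ∣ a1 := by
  have h3 : p ^ 2 ∣ D * a1 ^ 2 := by
    have e : D * a1 ^ 2 = (2 * a0 + a1) ^ 2 - 4 * (a0 ^ 2 + a0 * a1 - κ * a1 ^ 2) := by
      rw [hκ]; ring
    rw [e]
    exact dvd_sub (pow_dvd_pow_of_dvd h1 2) (h2.mul_left _)
  have ha1 : p ∣ a1 := by
    by_cases pD : p ∣ D
    · obtain ⟨D1, hD1⟩ := pD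
      have pD1 : ¬ p ∣ D1 := by
        rintro ⟨q2, rfl⟩
        exact hp.not_isUnit (sD p ⟨q2, by rw [hD1]; ring⟩)
      have : p * p ∣ p * (D1 * a1 ^ 2) := by rw [hD1] at h3; ring_nf at h3 ⊢; exact h3
      have := (mul_dvd_mul_iff_left hp.ne_zero).1 this
      exact hp.dvd_of_dvd_pow ((hp.dvd_or_dvd this).resolve_left pD1)
    · have : p ∣ D * a1 ^ 2 := dvd_trans (dvd_pow_self p two_ne_zero) h3
      exact hp.dvd_of_dvd_pow ((hp.dvd_or_dvd this).resolve_left pD)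
  refine ⟨?_, ha1⟩
  have h4 : p ∣ a0 ^ 2 + a0 * a1 - κ * a1 ^ 2 := dvd_trans (dvd_pow_self p two_ne_zero) h2
  have h5 : p ∣ a0 ^ 2 := by
    have e : a0 ^ 2 = (a0 ^ 2 + a0 * a1 - κ * a1 ^ 2) - a1 * (a0 - κ * a1) := by ring
    rw [e]; exact dvd_sub h4 (ha1.mul_right _)
  exact hp.dvd_of_dvd_pow h5

theorem step_two {D b c q κ a0 a1 T W m n : ℤ} (hD : D = 4 * κ + 1) (hb : Odd b) (hc : Even c)
    (hq : Odd q)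
    (h1 : a0 ^ 2 + a1 ^ 2 * κ - q * ((T ^ 2 + W ^ 2) * D -
      (b * (T ^ 2 - W ^ 2) + 2 * c * T * W)) = 4 * m)
    (h2 : 2 * a0 * a1 + a1 ^ 2 - 2 * q * (b * (T ^ 2 - W ^ 2) + 2 * c * T * W) = 4 * n) :
    2 ∣ a0 ∧ 2 ∣ a1 ∧ 2 ∣ T ∧ 2 ∣ W := by
  obtain ⟨b, rfl⟩ := hb
  obtain ⟨c, rfl⟩ := hc
  obtain ⟨q, rfl⟩ := hq
  have ha1 : Even a1 := by
    by_contra hodd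
    rw [Int.not_even_iff_odd] at hodd
    obtain ⟨k, rfl⟩ := hodd
    have : (2 : ℤ) ∣ 1 := by
      refine ⟨2 * n - (a0 * (2 * k + 1) + 2 * k ^ 2 + 2 * k - (2 * q + 1) *
        ((2 * b + 1) * (T ^ 2 - W ^ 2) + 2 * (c + c) * T * W)), ?_⟩
      linarith
    omega
  obtain ⟨k, rfl⟩ := ha1
  have hTW : Even (T - W) := by
    by_contra hodd
    rw [Int.not_even_iff_odd] at hodd
    obtain ⟨j, hj⟩ := hodd
    obtain rfl : T = W + 2 * j + 1 := by linarith
    have : (2 : ℤ) ∣ 1 := by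
      have e : (2 * q + 1) * ((2 * b + 1) * ((W + 2 * j + 1) ^ 2 - W ^ 2)
        + 2 * (c + c) * (W + 2 * j + 1) * W) = 2 * (a0 * k + k ^ 2 - n) := by linarith
      have e2 : (2 * q + 1) * ((2 * b + 1) * ((W + 2 * j + 1) ^ 2 - W ^ 2)
        + 2 * (c + c) * (W + 2 * j + 1) * W) = 1 + 2 * (q * ((2 * b + 1) * ((W + 2 * j + 1) ^ 2 - W ^ 2)
        + 2 * (c + c) * (W + 2 * j + 1) * W) + b * ((W + 2 * j + 1) ^ 2 - W ^ 2) +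
          (2 * j ^ 2 + 2 * j + 2 * W * j + W) + (c + c) * (W + 2 * j + 1) * W) := by ring
      omega
    omega
  obtain ⟨j, hj⟩ := hTW
  obtain rfl : T = W + 2 * j := by linarith
  obtain ⟨l, rfl | rfl⟩ : ∃ l, W = 2 * l ∨ W = 2 * l + 1 := ⟨W / 2, by omega⟩
  · have : Even a0 := by
      by_contra hodd
      rw [Int.not_even_iff_odd] at hodd
      obtain ⟨i, rfl⟩ := hodd
      have : (4 : ℤ) ∣ 1 := by
        refine ⟨m - (i ^ 2 + i + k ^ 2 * κ - (2 * q + 1) * (((l + j) ^ 2 + l ^ 2) * D -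
          ((2 * b + 1) * ((l + j) ^ 2 - l ^ 2) + 2 * (c + c) * (l + j) * l))), ?_⟩
        linarith
      omega
    obtain ⟨i, rfl⟩ := this
    exact ⟨⟨i, by ring⟩, ⟨k, by ring⟩, ⟨l + j, by ring⟩, ⟨l, by ring⟩⟩
  · exfalso
    have e : a0 ^ 2 = 2 + 4 * (m - k ^ 2 * κ + q + (2 * q + 1) * (2 * κ + (2 * l ^ 2 + 2 * l + 2 * l * j + j + j ^ 2) * D -
       ((2 * b + 1) * (2 * l * j + j + j ^ 2) + c * (2 * l + 1 + 2 * j) * (2 * l + 1)))) := by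
      have : a0 ^ 2 = 4 * m - (k + k) ^ 2 * κ + (2 * q + 1) * (((2 * l + 1 + 2 * j) ^ 2 + (2 * l + 1) ^ 2) * D -
        ((2 * b + 1) * ((2 * l + 1 + 2 * j) ^ 2 - (2 * l + 1) ^ 2) + 2 * (c + c) * (2 * l + 1 + 2 * j) * (2 * l + 1))) := by linarith
      rw [this, hD]; ring
    rcases Int.even_or_odd' a0 with ⟨i, rfl | rfl⟩ <;> ring_nf at e <;> omega

end C4Int

namespace C4Rel
section nf
variable {K : Type*} [Field K] [NumberField K]

theorem rat_int {r : ℚ} (h : IsIntegral ℤ (r : K)) : ∃ n : ℤ, r = n := by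
  have h' : IsIntegral ℤ (algebraMap ℚ K r) := by simpa using h
  have := (isIntegral_algebraMap_iff (algebraMap ℚ K).injective).1 h'
  obtain ⟨n, hn⟩ := IsIntegrallyClosed.isIntegral_iff.1 this
  exact ⟨n, by simpa using hn.symm⟩

theorem int_map (τ : K ≃+* K) {x : K} (h : IsIntegral ℤ x) : IsIntegral ℤ (τ x) :=
  map_isIntegral_int (τ : K →+* K) h

theorem int_of_sq {x : K} (h : IsIntegral ℤ (x ^ 2)) : IsIntegral ℤ x :=
  IsIntegral.of_pow two_pos h

variable {D b c q : ℚ} {δ β β' : K}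

theorem kpart (h : C4Rel D b c q δ β β') (τ : K ≃+* K) (t1 : τ δ = -δ) {u v : ℚ}
    (hi : IsIntegral ℤ ((u : K) + v * δ)) :
    (∃ n : ℤ, 2 * u = n) ∧ (∃ n : ℤ, u ^ 2 - D * v ^ 2 = n) := by
  have hi' := int_map τ hi
  have e : τ ((u : K) + v * δ) = u - v * δ := by simp [t1]; ring
  rw [e] at hi'
  refine ⟨rat_int (K := K) ?_, rat_int (K := K) ?_⟩
  · convert! hi.add hi' using 1; push_cast; ring
  · convert! hi.mul hi' using 1; push_cast; rw [← h.d2]; ring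

theorem bpart (h : C4Rel D b c q δ β β') (τ : K ≃+* K) (t1 : τ δ = -δ) (t2 : τ β = β')
    (t3 : τ β' = -β) {t w : ℚ} (hi : IsIntegral ℤ ((t : K) * β + w * β')) :
    (∃ n : ℤ, q ^ 2 * D * (c * (t ^ 2 - w ^ 2) - 2 * b * t * w) ^ 2 = n) ∧
    (∃ n : ℤ, 4 * (q ^ 2 * D * (b * (t ^ 2 - w ^ 2) + 2 * c * t * w) ^ 2) = n) ∧
    (∃ n : ℤ, 2 * (q * D * (t ^ 2 + w ^ 2)) = n) := by
  have hi' := int_map τ hi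
  have e : τ ((t : K) * β + w * β') = t * β' - w * β := by simp [t2, t3]; ring
  rw [e] at hi'
  have s1 : ((t : K) * β + w * β') ^ 2 =
      q * ((t ^ 2 + w ^ 2) * D + (b * (t ^ 2 - w ^ 2) + 2 * c * t * w) * δ) := by
    linear_combination (t : K) ^ 2 * h.b2 + w ^ 2 * h.b2' + 2 * t * w * h.bb
  have s2 : ((t : K) * β' - w * β) ^ 2 =
      q * ((t ^ 2 + w ^ 2) * D - (b * (t ^ 2 - w ^ 2) + 2 * c * t * w) * δ) := by
    linear_combination (t : K) ^ 2 * h.b2' + w ^ 2 * h.b2 - 2 * t * w * h.bb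
  have s3 : ((t : K) * β + w * β') * ((t : K) * β' - w * β) =
      q * (c * (t ^ 2 - w ^ 2) - 2 * b * t * w) * δ := by
    linear_combination - (t : K) * w * h.b2 + t * w * h.b2' + (t ^ 2 - w ^ 2) * h.bb
  refine ⟨rat_int (K := K) ?_, rat_int (K := K) ?_, rat_int (K := K) ?_⟩
  · convert! (hi.mul hi').pow 2 using 1; rw [s3]; push_cast; rw [← h.d2]; ring
  · convert! ((hi.pow 2).sub (hi'.pow 2)).pow 2 using 1; rw [s1, s2]; push_cast; rw [← h.d2]; ring
  · convert! (hi.pow 2).add (hi'.pow 2) using 1; rw [s1, s2]; push_cast; ring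

end nf

section main
variable {K : Type*} [Field K] [NumberField K] {D b c q κ : ℤ} {δ β β' : K}

theorem pstep (h : C4Rel (D : ℚ) b c q δ β β') (sD : Squarefree D) (sq' : Squarefree q)
    (cop : IsCoprime q D) (hκ : D = 4 * κ + 1) (hb : Odd b) (hc : Even c) (hq : Odd q)
    (τ : K ≃+* K) (t1 : τ δ = -δ) (t2 : τ β = β') (t3 : τ β' = -β)
    {p : ℕ} (hp : p.Prime) {x : K} (hx : IsIntegral ℤ x) {a0 a1 T W : ℤ}
    (e : (p : K) * x = a0 + a1 * ((1 + δ) / 2) + T * β + W * β') :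
    ∃ a0 a1 T W : ℤ, x = a0 + a1 * ((1 + δ) / 2) + T * β + W * β' := by
  have hp' : Prime (p : ℤ) := Nat.prime_iff_prime_int.1 hp
  have hpK : (p : K) ≠ 0 := by exact_mod_cast hp.ne_zero
  have hpQ : (p : ℚ) ≠ 0 := by exact_mod_cast hp.ne_zero
  have hDz : b ^ 2 + c ^ 2 = D := by exact_mod_cast h.hD
  have hx2 := int_map τ (int_map τ hx)
  have e2 : (p : K) * τ (τ x) = a0 + a1 * ((1 + δ) / 2) - T * β - W * β' := by
    have := congrArg τ (congrArg τ e)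
    have τ2 : τ 2 = 2 := map_ofNat τ 2
    simp [t1, t2, t3, map_div₀, τ2] at this
    rw [this]; ring
  -- it suffices to divide all coefficients by p
  suffices H : (p : ℤ) ∣ a0 ∧ (p : ℤ) ∣ a1 ∧ (p : ℤ) ∣ T ∧ (p : ℤ) ∣ W by
    obtain ⟨⟨a0, rfl⟩, ⟨a1, rfl⟩, ⟨T, rfl⟩, ⟨W, rfl⟩⟩ := H
    refine ⟨a0, a1, T, W, mul_left_cancel₀ hpK ?_⟩
    rw [e]; push_cast; ring
  rcases hp.eq_two_or_odd' with rfl | hodd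
  · -- p = 2
    have hprod := hx.mul hx2
    have hy2 : ((T : K) * β + W * β') ^ 2 =
      q * ((T ^ 2 + W ^ 2) * D + (b * (T ^ 2 - W ^ 2) + 2 * c * T * W) * δ) := by
      have h1 := h.b2; have h2 := h.b2'; have h3 := h.bb
      push_cast at h1 h2 h3
      linear_combination (T : K) ^ 2 * h1 + W ^ 2 * h2 + 2 * T * W * h3
    have hd2 : δ ^ 2 = (D : K) := by simpa using h.d2
    have hk : (D : K) = 4 * κ + 1 := by exact_mod_cast congrArg (Int.cast (R := K)) hκ
    set M : ℤ := a0 ^ 2 + a1 ^ 2 * κ - q * ((T ^ 2 + W ^ 2) * D -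
      (b * (T ^ 2 - W ^ 2) + 2 * c * T * W)) with hM
    set N : ℤ := 2 * a0 * a1 + a1 ^ 2 - 2 * q * (b * (T ^ 2 - W ^ 2) + 2 * c * T * W) with hN
    have e3 : x * τ (τ x) = (((2 * M + N) / 8 : ℚ) : K) + ((N / 8 : ℚ) : K) * δ := by
      have : (4 : K) * (x * τ (τ x)) = M + N * ((1 + δ) / 2) := by
        have e4 : (4 : K) * (x * τ (τ x)) = (a0 + a1 * ((1 + δ) / 2)) ^ 2 - (T * β + W * β') ^ 2 := by
          push_cast at e e2
          linear_combination (2 * τ (τ x)) * e + (a0 + a1 * ((1 + δ) / 2) + T * β + W * β') * e2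
        rw [e4, hy2, hM, hN]; push_cast
        linear_combination ((a1 : K) ^ 2 / 4) * hd2 + ((a1 : K) ^ 2 / 4) * hk
      push_cast
      linear_combination this / 4
    rw [e3] at hprod
    obtain ⟨⟨m, hm⟩, ⟨n, hn⟩⟩ := h.kpart τ t1 hprod
    have hm' : 2 * M + N = 4 * m := by
      have : (2 * M + N : ℚ) = 4 * m := by linarith
      exact_mod_cast this
    have hn' : (2 * M + N) ^ 2 - D * N ^ 2 = 64 * n := by
      have : ((2 * M + N) ^ 2 - D * N ^ 2 : ℚ) = 64 * n := by rw [← hn]; ring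
      exact_mod_cast this
    have hDm : ∃ n', D * N ^ 2 = 16 * n' := ⟨m ^ 2 - 4 * n, by rw [hm'] at hn'; linarith⟩
    have hN4 : (4 : ℤ) ∣ N := by
      obtain ⟨n', hn'⟩ := hDm
      have h16 : (2 : ℤ) ^ 4 ∣ D * N ^ 2 := ⟨n', by rw [hn']; norm_num⟩
      have hcop : IsCoprime (2 : ℤ) D := ⟨-2 * κ, 1, by rw [hκ]; ring⟩
      have := C4Int.sq_dvd_of_pow4 ((hcop.pow_left (m := 4)).dvd_of_dvd_mul_left h16)
      norm_num at this; exact this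
    obtain ⟨n1, hn1⟩ := hN4
    have hM4 : ∃ m1, M = 4 * m1 := by
      obtain ⟨m1, hm1⟩ : ∃ m1, M = 2 * m1 := ⟨m - n1, by linarith⟩
      have hmm : m = m1 + n1 := by linarith
      have : (m1 + n1) ^ 2 - D * n1 ^ 2 = 4 * n := by
        rw [hm', hn1, hmm] at hn'; linarith
      rw [hκ] at this
      have h4 : (2 : ℤ) ∣ m1 ^ 2 := ⟨2 * n + 2 * κ * n1 ^ 2 - m1 * n1, by linarith⟩
      obtain ⟨m2, rfl⟩ := Int.prime_two.dvd_of_dvd_pow h4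
      exact ⟨m2, by rw [hm1]; ring⟩
    obtain ⟨m1, hm1⟩ := hM4
    exact_mod_cast C4Int.step_two hκ hb hc hq hm1 hn1
  · have hp2 : ¬ (p : ℤ) ∣ 2 := by
      intro h2
      have : p ∣ 2 := by exact_mod_cast h2
      have := (Nat.prime_dvd_prime_iff_eq hp Nat.prime_two).1 this
      subst this; exact absurd hodd (by decide)
    have hy : IsIntegral ℤ (((2 * T / p : ℚ) : K) * β + ((2 * W / p : ℚ) : K) * β') := by
      convert! hx.sub hx2 using 1
      apply mul_left_cancel₀ hpK
      rw [mul_sub, e, e2]; push_cast; field_simp; ring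
    obtain ⟨⟨n1, hn1⟩, ⟨n2, hn2⟩, ⟨n3, hn3⟩⟩ := h.bpart τ t1 t2 t3 hy
    have hTW : (p : ℤ) ∣ T ∧ (p : ℤ) ∣ W := by
      refine C4Int.step_odd hp' hp2 hDz sD sq' cop ⟨n1, ?_⟩ ⟨n2, ?_⟩ ⟨n3, ?_⟩
      · have : (16 * (q ^ 2 * D * (c * (T ^ 2 - W ^ 2) - 2 * b * T * W) ^ 2) : ℚ) = p ^ 4 * n1 := by
          rw [← hn1]; field_simp; ring
        exact_mod_cast this
      · have : (64 * (q ^ 2 * D * (b * (T ^ 2 - W ^ 2) + 2 * c * T * W) ^ 2) : ℚ) = p ^ 4 * n2 := by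
          rw [← hn2]; field_simp; ring
        exact_mod_cast this
      · have : (8 * (q * D * (T ^ 2 + W ^ 2)) : ℚ) = p ^ 2 * n3 := by
          rw [← hn3]; field_simp; ring
        exact_mod_cast this
    suffices H : (p : ℤ) ∣ a0 ∧ (p : ℤ) ∣ a1 from ⟨H.1, H.2, hTW⟩
    have hβ2 : IsIntegral ℤ δ := int_of_sq (by rw [h.d2]; simpa using isIntegral_algebraMap (R := ℤ) (A := K) (x := D))
    have hβ : IsIntegral ℤ β := int_of_sq (by
      rw [h.b2]; push_cast
      exact (isIntegral_algebraMap (R := ℤ) (x := q)).mul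
        ((isIntegral_algebraMap (R := ℤ) (x := D)).add
          ((isIntegral_algebraMap (R := ℤ) (x := b)).mul hβ2)))
    have hβ' : IsIntegral ℤ β' := by rw [← t2]; exact int_map τ hβ
    obtain ⟨⟨T, rfl⟩, ⟨W, rfl⟩⟩ := hTW
    have hz : IsIntegral ℤ ((((2 * a0 + a1) / (2 * p) : ℚ) : K) + ((a1 / (2 * p) : ℚ) : K) * δ) := by
      convert! (hx.sub ((isIntegral_algebraMap (R := ℤ) (x := T)).mul hβ)).sub
        ((isIntegral_algebraMap (R := ℤ) (x := W)).mul hβ') using 1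
      apply mul_left_cancel₀ hpK
      rw [mul_sub, mul_sub, e]; push_cast; simp; field_simp; ring
    obtain ⟨⟨m, hm⟩, ⟨n, hn⟩⟩ := h.kpart τ t1 hz
    refine C4Int.step_quad hp' sD hκ ⟨m, ?_⟩ ⟨n, ?_⟩
    · have : (2 * a0 + a1 : ℚ) = p * m := by rw [← hm]; field_simp
      exact_mod_cast this
    · have : (a0 ^ 2 + a0 * a1 - κ * a1 ^ 2 : ℚ) = p ^ 2 * n := by
        rw [← hn, hκ]; push_cast; field_simp; ring
      exact_mod_cast this

end main
end C4Rel

namespace C4Rel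
section main
open scoped Matrix
variable {K : Type*} [Field K] [NumberField K] {D b c q κ : ℤ} {δ β β' : K}

theorem finrank4 {D b c q : ℚ} (h : C4Rel D b c q δ β β')
    (hspan : ∀ x : K, ∃ r s t w : ℚ, x = r + s * δ + t * β + w * β') :
    Module.finrank ℚ K = 4 := by
  have : ⊤ ≤ Submodule.span ℚ (Set.range ![(1:K), δ, β, β']) := by
    intro x _
    obtain ⟨r, s, t, w, rfl⟩ := hspan x
    rw [Submodule.mem_span_range_iff_exists_fun]
    refine ⟨![r, s, t, w], ?_⟩
    simp [Fin.sum_univ_four, Rat.smul_def]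
  have := Module.finrank_eq_card_basis (Module.Basis.mk h.linInd this)
  simpa using this

theorem int_elts (h : C4Rel (D : ℚ) b c q δ β β')
    (τ : K ≃+* K) (t2 : τ β = β') :
    IsIntegral ℤ δ ∧ IsIntegral ℤ β ∧ IsIntegral ℤ β' := by
  have hβ2 : IsIntegral ℤ δ := int_of_sq (by rw [h.d2]; simpa using isIntegral_algebraMap (R := ℤ) (A := K) (x := D))
  have hβ : IsIntegral ℤ β := int_of_sq (by
      rw [h.b2]; push_cast
      exact (isIntegral_algebraMap (R := ℤ) (x := q)).mul
        ((isIntegral_algebraMap (R := ℤ) (x := D)).add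
          ((isIntegral_algebraMap (R := ℤ) (x := b)).mul hβ2)))
  have hβ' : IsIntegral ℤ β' := by rw [← t2]; exact int_map τ hβ
  exact ⟨hβ2, hβ, hβ'⟩

theorem int_omega (h : C4Rel (D : ℚ) b c q δ β β') (hκ : D = 4 * κ + 1) :
    IsIntegral ℤ ((1 + δ) / 2) := by
  have hd2 : δ ^ 2 = (D : K) := by simpa using h.d2
  have hk : (D : K) = 4 * κ + 1 := by exact_mod_cast congrArg (Int.cast (R := K)) hκ
  refine ⟨Polynomial.X ^ 2 - Polynomial.X - Polynomial.C κ, ?_, ?_⟩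
  · monicity!
  · simp only [Polynomial.eval₂_sub, Polynomial.eval₂_pow, Polynomial.eval₂_X, Polynomial.eval₂_C,
      algebraMap_int_eq, Int.coe_castRingHom]
    linear_combination hd2 / 4 + hk / 4

/-- all integral elements lie in the order -/
theorem all_int (h : C4Rel (D : ℚ) b c q δ β β') (sD : Squarefree D) (sq' : Squarefree q)
    (cop : IsCoprime q D) (hκ : D = 4 * κ + 1) (hb : Odd b) (hc : Even c) (hq : Odd q)
    (hspan : ∀ x : K, ∃ r s t w : ℚ, x = r + s * δ + t * β + w * β')
    (τ : K ≃+* K) (t1 : τ δ = -δ) (t2 : τ β = β') (t3 : τ β' = -β) {x : K} (hx : IsIntegral ℤ x) :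
    ∃ a0 a1 T W : ℤ, x = a0 + a1 * ((1 + δ) / 2) + T * β + W * β' := by
  have key : ∀ n : ℕ, n ≠ 0 → ∀ x : K, IsIntegral ℤ x →
      (∃ a0 a1 T W : ℤ, (n : K) * x = a0 + a1 * ((1 + δ) / 2) + T * β + W * β') →
      ∃ a0 a1 T W : ℤ, x = a0 + a1 * ((1 + δ) / 2) + T * β + W * β' := by
    intro n
    induction n using Nat.recOnMul with
    | zero => intro h0; exact absurd rfl h0
    | one => intro _ x _ hh; simpa using hh
    | prime p hp =>
      rintro _ x hx ⟨a0, a1, T, W, e⟩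
      exact h.pstep sD sq' cop hκ hb hc hq τ t1 t2 t3 hp hx e
    | mul m n hm hn =>
      rintro h0 x hx ⟨a0, a1, T, W, e⟩
      have hm0 : m ≠ 0 := by rintro rfl; simp at h0
      have hn0 : n ≠ 0 := by rintro rfl; simp at h0
      refine hn hn0 x hx (hm hm0 _ ?_ ⟨a0, a1, T, W, ?_⟩)
      · exact (by simpa using isIntegral_algebraMap (R := ℤ) (A := K) (x := (n : ℤ)) : IsIntegral ℤ (n : K)).mul hx
      · rw [← e]; push_cast; ring
  obtain ⟨r, s, t, w, rfl⟩ := hspan x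
  refine key (r.den * s.den * t.den * w.den) (by simp) _ hx ?_
  refine ⟨r.num * s.den * t.den * w.den - r.den * s.num * t.den * w.den,
    2 * (r.den * s.num * t.den * w.den), r.den * s.den * t.num * w.den,
    r.den * s.den * t.den * w.num, ?_⟩
  have hr : (r.den : K) * r = r.num := by
    have := Rat.den_mul_eq_num r; exact_mod_cast congrArg (Rat.cast (K := K)) this
  have hs : (s.den : K) * s = s.num := by
    have := Rat.den_mul_eq_num s; exact_mod_cast congrArg (Rat.cast (K := K)) this
  have ht : (t.den : K) * t = t.num := by
    have := Rat.den_mul_eq_num t; exact_mod_cast congrArg (Rat.cast (K := K)) this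
  have hw : (w.den : K) * w = w.num := by
    have := Rat.den_mul_eq_num w; exact_mod_cast congrArg (Rat.cast (K := K)) this
  push_cast
  rw [← hr, ← hs, ← ht, ← hw]
  ring

theorem discr_mat {D b c q : ℚ} (h : C4Rel D b c q δ β β')
    (hspan : ∀ x : K, ∃ r s t w : ℚ, x = r + s * δ + t * β + w * β')
    (τ : K ≃+* K) (t1 : τ δ = -δ) (t2 : τ β = β') (t3 : τ β' = -β) (P : Matrix (Fin 4) (Fin 4) ℚ) :
    Algebra.discr ℚ (P.map (algebraMap ℚ K) *ᵥ ![(1:K), δ, β, β']) =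
      P.det ^ 2 * (256 * q ^ 2 * D ^ 3) := by
  rw [Algebra.discr_of_matrix_mulVec, h.discr_std hspan τ t1 t2 t3]

theorem discr_eq (h : C4Rel (D : ℚ) b c q δ β β') (sD : Squarefree D) (sq' : Squarefree q)
    (cop : IsCoprime q D) (hκ : D = 4 * κ + 1) (hb : Odd b) (hc : Even c) (hq : Odd q)
    (hspan : ∀ x : K, ∃ r s t w : ℚ, x = r + s * δ + t * β + w * β')
    (τ : K ≃+* K) (t1 : τ δ = -δ) (t2 : τ β = β') (t3 : τ β' = -β) :
    NumberField.discr K = 64 * q ^ 2 * D ^ 3 := by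
  obtain ⟨i1, i2, i3⟩ := h.int_elts τ t2
  have i4 := h.int_omega hκ
  have hfin := h.finrank4 hspan
  have hd : Algebra.discr ℚ ![(1 : K), (1 + δ) / 2, β, β'] = 64 * q ^ 2 * D ^ 3 := by
    have := h.discr_mat hspan τ t1 t2 t3 !![1, 0, 0, 0; 1/2, 1/2, 0, 0; 0, 0, 1, 0; 0, 0, 0, 1]
    have e : (!![1, 0, 0, 0; 1/2, 1/2, 0, 0; 0, 0, 1, 0; 0, 0, 0, 1] : Matrix (Fin 4) (Fin 4) ℚ).map (algebraMap ℚ K) *ᵥ ![(1:K), δ, β, β'] = ![(1 : K), (1 + δ) / 2, β, β'] := by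
      ext i; fin_cases i <;> simp [Matrix.mulVec, dotProduct, Fin.sum_univ_four]
      ring
    have e2 : (!![1, 0, 0, 0; 1/2, 1/2, 0, 0; 0, 0, 1, 0; 0, 0, 0, 1] : Matrix (Fin 4) (Fin 4) ℚ).det = 1/2 := by
      simp [Matrix.det_succ_row_zero, Fin.sum_univ_succ, Fin.succAbove]
    rw [e, e2] at this
    rw [this]; ring
  -- basis
  have hli : LinearIndependent ℚ ![(1 : K), (1 + δ) / 2, β, β'] := by
    by_contra hh
    have := Algebra.discr_zero_of_not_linearIndependent ℚ hh
    rw [hd] at this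
    have hq0 : (q : ℚ) ≠ 0 := h.hq
    have hD0 : (D : ℚ) ≠ 0 := by intro h0; exact h.nsq (by rw [h0]; exact ⟨0, by simp⟩)
    simp at this
    rcases this with h1 | h1
    · exact hq0 (by exact_mod_cast h1)
    · exact hD0 (by exact_mod_cast h1)
  obtain ⟨n, hn⟩ := index_dvd (e := ![(1 : K), (1 + δ) / 2, β, β']) hfin (by
    intro i; fin_cases i
    · exact isIntegral_one
    · exact i4
    · exact i2
    · exact i3)
  let E : Module.Basis (Fin 4) ℚ K := basisOfLinearIndependentOfCardEqFinrank hli (by simp [hfin])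
  have hE : ⇑E = ![(1 : K), (1 + δ) / 2, β, β'] := by simp [E]
  have := Algebra.discr_eq_discr_of_toMatrix_coeff_isIntegral (K := K) (b := NumberField.integralBasis K) (b' := E) ?_ ?_
  · rw [← NumberField.coe_discr, hE, hd] at this
    exact_mod_cast this
  · intro i j
    rw [Module.Basis.toMatrix_apply]
    have hEj : IsIntegral ℤ (E j) := by
      rw [hE]; fin_cases j
      · exact isIntegral_one
      · exact i4
      · exact i2
      · exact i3
    have := NumberField.integralBasis_repr_apply K ⟨E j, hEj⟩ i
    change (NumberField.integralBasis K).repr (E j) _ = _ at this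
    rw [this]
    exact isIntegral_algebraMap
  · intro i j
    rw [Module.Basis.toMatrix_apply]
    have hBj : IsIntegral ℤ (NumberField.integralBasis K j) := by
      rw [NumberField.integralBasis_apply]
      exact NumberField.RingOfIntegers.isIntegral_coe _
    obtain ⟨a0, a1, T, W, e⟩ := h.all_int sD sq' cop hκ hb hc hq hspan τ t1 t2 t3 hBj
    have e' : NumberField.integralBasis K j = ∑ i, (![(a0 : ℚ), a1, T, W] i) • E i := by
      rw [e, hE]; simp [Fin.sum_univ_four, Rat.smul_def]
    rw [e', Module.Basis.repr_sum_self]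
    fin_cases i
    · exact isIntegral_algebraMap (R := ℤ) (x := a0)
    · exact isIntegral_algebraMap (R := ℤ) (x := a1)
    · exact isIntegral_algebraMap (R := ℤ) (x := T)
    · exact isIntegral_algebraMap (R := ℤ) (x := W)

theorem val_of_sq {m n Δ : ℤ} (hm : m ≠ 0) (h : m = n ^ 2 * Δ) :
    padicValInt 2 m = 2 * padicValInt 2 n + padicValInt 2 Δ := by
  have hn : n ≠ 0 := by rintro rfl; simp at h; exact hm h
  have hΔ : Δ ≠ 0 := by rintro rfl; simp at h; exact hm h
  rw [h, padicValInt.mul (pow_ne_zero _ hn) hΔ, sq, padicValInt.mul hn hn]; ring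

theorem padic_odd {a : ℤ} (ha : Odd a) : padicValInt 2 a = 0 := by
  apply padicValInt.eq_zero_of_not_dvd
  intro h; have : Even a := even_iff_two_dvd.2 (by exact_mod_cast h)
  exact (Int.not_even_iff_odd.2 ha) this

/-- D even is impossible -/
theorem ne_six_of_even (h : C4Rel (D : ℚ) b c q δ β β') (sD : Squarefree D) (hev : Even D)
    (hspan : ∀ x : K, ∃ r s t w : ℚ, x = r + s * δ + t * β + w * β')
    (τ : K ≃+* K) (t1 : τ δ = -δ) (t2 : τ β = β') (t3 : τ β' = -β) :
    padicValInt 2 (NumberField.discr K) ≠ 6 := by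
  obtain ⟨i1, i2, i3⟩ := h.int_elts τ t2
  have hfin := h.finrank4 hspan
  have hd := h.discr_std hspan τ t1 t2 t3
  obtain ⟨n, hn⟩ := index_dvd (e := ![(1 : K), δ, β, β']) hfin (by
    intro i; fin_cases i
    · exact isIntegral_one
    · exact i1
    · exact i2
    · exact i3)
  rw [hd] at hn
  obtain ⟨d, rfl⟩ := even_iff_two_dvd.1 hev
  have hdodd : Odd d := by
    rw [← Int.not_even_iff_odd]
    intro he
    obtain ⟨k, rfl⟩ := even_iff_two_dvd.1 he
    have := sD 2 ⟨k, by ring⟩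
    exact absurd this (by decide)
  have hq0 : q ≠ 0 := by have := h.hq; exact_mod_cast this
  have hd0 : d ≠ 0 := by rintro rfl; simp at hdodd
  have hn' : 2 ^ 11 * q ^ 2 * d ^ 3 = n ^ 2 * NumberField.discr K := by
    have : ((2 ^ 11 * q ^ 2 * d ^ 3 : ℤ) : ℚ) = ((n ^ 2 * NumberField.discr K : ℤ) : ℚ) := by
      push_cast; rw [← hn]; push_cast; ring
    exact_mod_cast this
  have hv := val_of_sq (by positivity) hn'
  have e : padicValInt 2 (2 ^ 11 * q ^ 2 * d ^ 3) = 11 + 2 * padicValInt 2 q := by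
    rw [padicValInt.mul (by positivity) (by positivity), padicValInt.mul (by positivity) (by positivity),
      padic_odd (hdodd.pow), sq, padicValInt.mul hq0 hq0]
    have : padicValInt 2 (2 ^ 11) = 11 := by
      have := padicValInt.self (p := 2) (by norm_num)
      have h2 : ((2:ℤ) ^ 11) = ((2 ^ 11 : ℕ) : ℤ) := by norm_num
      rw [h2, padicValInt.of_nat, padicValNat.prime_pow]
    rw [this]; ring
  omega

theorem ne_six_of_beven (h : C4Rel (D : ℚ) b c q δ β β') (hκ : D = 4 * κ + 1) (hb : Even b)
    (hq : Odd q)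
    (hspan : ∀ x : K, ∃ r s t w : ℚ, x = r + s * δ + t * β + w * β')
    (τ : K ≃+* K) (t1 : τ δ = -δ) (t2 : τ β = β') (t3 : τ β' = -β) :
    padicValInt 2 (NumberField.discr K) ≠ 6 := by
  obtain ⟨i1, i2, i3⟩ := h.int_elts τ t2
  have i4 := h.int_omega hκ
  have hfin := h.finrank4 hspan
  have hDz : b ^ 2 + c ^ 2 = D := by exact_mod_cast h.hD
  have hDo : Odd D := ⟨2 * κ, by rw [hκ]; ring⟩
  have hc : Odd c := by
    have : Odd (c ^ 2) := by
      have : c ^ 2 = D - b ^ 2 := by linarith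
      rw [this]; exact hDo.sub_even (hb.pow_of_ne_zero two_ne_zero)
    exact (Int.odd_pow' two_ne_zero).1 this
  obtain ⟨c', rfl⟩ := hc
  have i5 : IsIntegral ℤ ((β + β') / 2) := by
    apply int_of_sq
    have e : ((β + β') / 2) ^ 2 = q * ((2 * κ - c' : ℤ) + (2 * c' + 1 : ℤ) * ((1 + δ) / 2)) := by
      have h1 := h.b2; have h2 := h.b2'; have h3 := h.bb
      have hk : (D : K) = 4 * κ + 1 := by exact_mod_cast congrArg (Int.cast (R := K)) hκ
      push_cast at h1 h2 h3 ⊢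
      linear_combination h1 / 4 + h2 / 4 + h3 / 2 + q / 2 * hk
    rw [e]
    exact (isIntegral_algebraMap (R := ℤ) (x := q)).mul
        ((isIntegral_algebraMap (R := ℤ) (x := (2 * κ - c' : ℤ))).add
          ((isIntegral_algebraMap (R := ℤ) (x := (2 * c' + 1 : ℤ))).mul i4))
  have hd : Algebra.discr ℚ ![(1 : K), (1 + δ) / 2, β, (β + β') / 2] = 16 * q ^ 2 * D ^ 3 := by
    have := h.discr_mat hspan τ t1 t2 t3 !![1, 0, 0, 0; 1/2, 1/2, 0, 0; 0, 0, 1, 0; 0, 0, 1/2, 1/2]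
    have e : (!![1, 0, 0, 0; 1/2, 1/2, 0, 0; 0, 0, 1, 0; 0, 0, 1/2, 1/2] : Matrix (Fin 4) (Fin 4) ℚ).map (algebraMap ℚ K) *ᵥ ![(1:K), δ, β, β'] = ![(1 : K), (1 + δ) / 2, β, (β + β') / 2] := by
      ext i; fin_cases i <;> simp [Matrix.mulVec, dotProduct, Fin.sum_univ_four] <;> ring
    have e2 : (!![1, 0, 0, 0; 1/2, 1/2, 0, 0; 0, 0, 1, 0; 0, 0, 1/2, 1/2] : Matrix (Fin 4) (Fin 4) ℚ).det = 1/4 := by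
      simp [Matrix.det_succ_row_zero, Fin.sum_univ_succ, Fin.succAbove]
      norm_num
    rw [e, e2] at this
    rw [this]; ring
  obtain ⟨n, hn⟩ := index_dvd (e := ![(1 : K), (1 + δ) / 2, β, (β + β') / 2]) hfin (by
    intro i; fin_cases i
    · exact isIntegral_one
    · exact i4
    · exact i2
    · exact i5)
  rw [hd] at hn
  have hq0 : q ≠ 0 := by have := h.hq; exact_mod_cast this
  have hd0 : D ≠ 0 := by rintro rfl; simp at hDo
  have hn' : 2 ^ 4 * q ^ 2 * D ^ 3 = n ^ 2 * NumberField.discr K := by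
    have : ((2 ^ 4 * q ^ 2 * D ^ 3 : ℤ) : ℚ) = ((n ^ 2 * NumberField.discr K : ℤ) : ℚ) := by
      push_cast; rw [← hn]
    exact_mod_cast this
  have hv := val_of_sq (by positivity) hn'
  have e : padicValInt 2 (2 ^ 4 * q ^ 2 * D ^ 3) = 4 := by
    rw [padicValInt.mul (by positivity) (by positivity), padicValInt.mul (by positivity) (by positivity),
      padic_odd (hDo.pow), padic_odd (hq.pow)]
    have h2 : ((2:ℤ) ^ 4) = ((2 ^ 4 : ℕ) : ℤ) := by norm_num
    rw [h2, padicValInt.of_nat, padicValNat.prime_pow]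
  omega

end main
end C4Rel

namespace C4Rel
section aut
variable {K : Type*} [Field K] [NumberField K] {D b c q : ℚ} {δ β β' : K}

theorem hspan_of (h : C4Rel D b c q δ β β') (hfin : Module.finrank ℚ K = 4) :
    ∀ x : K, ∃ r s t w : ℚ, x = r + s * δ + t * β + w * β' := by
  intro x
  let E : Module.Basis (Fin 4) ℚ K := basisOfLinearIndependentOfCardEqFinrank h.linInd (by simp [hfin])
  have hE : ⇑E = ![(1 : K), δ, β, β'] := by simp [E]
  refine ⟨E.repr x 0, E.repr x 1, E.repr x 2, E.repr x 3, ?_⟩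
  have := E.sum_repr x
  rw [hE] at this
  simpa [Fin.sum_univ_four, Rat.smul_def] using this.symm

theorem exists_tau (h : C4Rel D b c q δ β β') (hfin : Module.finrank ℚ K = 4) :
    ∃ τ : K ≃ₐ[ℚ] K, τ δ = -δ ∧ τ β = β' ∧ τ β' = -β := by
  let E : Module.Basis (Fin 4) ℚ K := basisOfLinearIndependentOfCardEqFinrank h.linInd (by simp [hfin])
  have hE : ⇑E = ![(1 : K), δ, β, β'] := by simp [E]
  let T : K →ₗ[ℚ] K := E.constr ℚ ![(1 : K), -δ, β', -β]
  have T0 : T 1 = 1 := by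
    have := E.constr_basis ℚ ![(1 : K), -δ, β', -β] 0
    rw [hE] at this; exact this
  have T1 : T δ = -δ := by
    have := E.constr_basis ℚ ![(1 : K), -δ, β', -β] 1
    rw [hE] at this; exact this
  have T2 : T β = β' := by
    have := E.constr_basis ℚ ![(1 : K), -δ, β', -β] 2
    rw [hE] at this; exact this
  have T3 : T β' = -β := by
    have := E.constr_basis ℚ ![(1 : K), -δ, β', -β] 3
    rw [hE] at this; exact this
  have TT : ∀ r s t w : ℚ, T (r + s * δ + t * β + w * β') = r - s * δ + t * β' - w * β := by
    intro r s t w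
    have : (r + s * δ + t * β + w * β' : K) = r • (1:K) + s • δ + t • β + w • β' := by
      simp [Rat.smul_def]
    rw [this]
    simp only [map_add, map_smul, T0, T1, T2, T3]
    simp [Rat.smul_def]; ring
  have Tm : ∀ x y, T (x * y) = T x * T y := by
    intro x y
    obtain ⟨r, s, t, w, rfl⟩ := h.hspan_of hfin x
    obtain ⟨r', s', t', w', rfl⟩ := h.hspan_of hfin y
    have e1 := h.d2; have e2 := h.b2; have e3 := h.b2'; have e4 := h.bb; have e5 := h.db
    have e6 := h.db'
    have : (r + s * δ + t * β + w * β' : K) * (r' + s' * δ + t' * β + w' * β')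
      = ((r * r' + s * s' * D + t * t' * q * D + w * w' * q * D : ℚ) : K)
       + ((r * s' + s * r' + t * t' * q * b - w * w' * q * b + (t * w' + w * t') * q * c : ℚ) : K) * δ
       + ((r * t' + t * r' + (s * t' + t * s') * b + (s * w' + w * s') * c : ℚ) : K) * β
       + ((r * w' + w * r' + (s * t' + t * s') * c - (s * w' + w * s') * b : ℚ) : K) * β' := by
      push_cast
      linear_combination s * s' * e1 + t * t' * e2 + w * w' * e3 + (t * w' + w * t') * e4
        + (s * t' + t * s') * e5 + (s * w' + w * s') * e6
    rw [this, TT, TT, TT]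
    push_cast
    linear_combination (-s * s' : K) * e1 - w * w' * e2 - t * t' * e3 + (t * w' + w * t') * e4
        - (s * w' + w * s') * e5 + (s * t' + t * s') * e6
  let τ : K →ₐ[ℚ] K := AlgHom.ofLinearMap T T0 Tm
  have hb : Function.Bijective τ := by
    refine ⟨τ.toRingHom.injective, ?_⟩
    exact (LinearMap.injective_iff_surjective (f := τ.toLinearMap)).1 τ.toRingHom.injective
  exact ⟨AlgEquiv.ofBijective τ hb, T1, T2, T3⟩

theorem beta_ne (h : C4Rel D b c q δ β β') : β ≠ 0 := by
  rintro rfl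
  have e := h.bb
  have hd := h.d2
  rw [zero_mul] at e
  have hc := c_ne_zero h.hD h.nsq
  have hd0 : δ ≠ 0 := by
    rintro rfl
    apply h.nsq
    have : (D : K) = 0 := by rw [← hd]; ring
    have : D = 0 := by exact_mod_cast this
    exact ⟨0, by simp [this]⟩
  have : (q : K) * c * δ ≠ 0 := by
    have := h.hq
    exact mul_ne_zero (mul_ne_zero (by exact_mod_cast this) (by exact_mod_cast hc)) hd0
  exact this e.symm

theorem galois_cyclic (h : C4Rel D b c q δ β β') (hfin : Module.finrank ℚ K = 4) :
    IsGalois ℚ K ∧ Nonempty ((K ≃ₐ[ℚ] K) ≃* Multiplicative (ZMod 4)) := by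
  obtain ⟨τ, t1, t2, t3⟩ := h.exists_tau hfin
  have hβ := h.beta_ne
  have h4 : orderOf τ = 4 := by
    refine orderOf_eq_prime_pow (p := 2) (n := 1) ?_ ?_
    · intro hh
      have := congrArg (fun f : K ≃ₐ[ℚ] K => f β) hh
      simp [pow_succ, AlgEquiv.mul_apply, t2, t3] at this
      apply hβ
      exact self_eq_neg.1 this.symm
    · ext x
      obtain ⟨r, s, t, w, rfl⟩ := h.hspan_of hfin x
      simp [pow_succ, AlgEquiv.mul_apply, t1, t2, t3]
  have hle : Fintype.card (K ≃ₐ[ℚ] K) ≤ 4 := by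
    rw [← hfin]; exact AlgEquiv.card_le
  have hge : 4 ≤ Fintype.card (K ≃ₐ[ℚ] K) := by
    rw [← h4]; exact orderOf_le_card_univ
  have hcard : Nat.card (K ≃ₐ[ℚ] K) = 4 := by
    rw [Nat.card_eq_fintype_card]; omega
  refine ⟨IsGalois.of_card_aut_eq_finrank ℚ K (by rw [hcard, hfin]), ?_⟩
  have : IsCyclic (K ≃ₐ[ℚ] K) := isCyclic_of_orderOf_eq_card τ (by rw [h4, hcard])
  exact ⟨mulEquivOfCyclicCardEq (by rw [hcard]; simp)⟩

end aut
end C4Rel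

/-- `K` is the cyclic quartic field attached to `(D,b,c,q)`. -/
def Rel4 (K : IntermediateField ℚ ℂ) (D b c q : ℚ) : Prop :=
  Module.finrank ℚ K = 4 ∧ ∃ δ β β' : K, C4Rel D b c q δ β β'

namespace Rel4
variable {K K₂ : IntermediateField ℚ ℂ} {D b c q : ℚ}

theorem nf (hfin : Module.finrank ℚ K = 4) : NumberField K :=
  { to_charZero := charZero_of_injective_algebraMap (algebraMap ℚ K).injective
    to_finiteDimensional := Module.finite_of_finrank_pos (by omega) }

theorem quartDisc_eq [NumberField K] : quartDisc K = NumberField.discr K := by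
  unfold quartDisc
  rw [dif_pos (inferInstance : FiniteDimensional ℚ K)]

theorem le (h : Rel4 K D b c q) (h2 : Rel4 K₂ D b c q) : K₂ ≤ K := by
  obtain ⟨f, δ, β, β', h⟩ := h
  obtain ⟨f₂, δ₂, β₂, β₂', h₂⟩ := h2
  have := nf f; have := nf f₂
  have c0 : (c : ℂ) ≠ 0 := by exact_mod_cast C4Rel.c_ne_zero h.hD h.nsq
  have a1 : ((δ : ℂ)) ^ 2 = D := by have := congrArg (Subtype.val) h.d2; simpa using this
  have a2 : ((δ₂ : ℂ)) ^ 2 = D := by have := congrArg (Subtype.val) h₂.d2; simpa using this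
  have b1 : ((β : ℂ)) ^ 2 = q * (D + b * δ) := by have := congrArg (Subtype.val) h.b2; simpa using this
  have b1' : ((β' : ℂ)) ^ 2 = q * (D - b * δ) := by have := congrArg (Subtype.val) h.b2'; simpa using this
  have b2 : ((β₂ : ℂ)) ^ 2 = q * (D + b * δ₂) := by have := congrArg (Subtype.val) h₂.b2; simpa using this
  have db : (δ₂ : ℂ) * β₂ = b * β₂ + c * β₂' := by have := congrArg (Subtype.val) h₂.db; simpa using this
  have hδ : (δ₂ : ℂ) ∈ K ∧ (β₂ : ℂ) ∈ K := by
    rcases sq_eq_sq_iff_eq_or_eq_neg.1 (a2.trans a1.symm) with e | e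
    · refine ⟨by rw [e]; exact δ.2, ?_⟩
      have : (β₂ : ℂ) ^ 2 = (β : ℂ) ^ 2 := by rw [b2, b1, e]
      rcases sq_eq_sq_iff_eq_or_eq_neg.1 this with e | e
      · rw [e]; exact β.2
      · rw [e]; exact K.neg_mem β.2
    · refine ⟨by rw [e]; exact K.neg_mem δ.2, ?_⟩
      have : (β₂ : ℂ) ^ 2 = (β' : ℂ) ^ 2 := by rw [b2, b1', e]; ring
      rcases sq_eq_sq_iff_eq_or_eq_neg.1 this with e | e
      · rw [e]; exact β'.2
      · rw [e]; exact K.neg_mem β'.2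
  have rm : ∀ r : ℚ, (r : ℂ) ∈ K := fun r => by simpa using K.algebraMap_mem r
  have hβ' : (β₂' : ℂ) ∈ K := by
    have : (β₂' : ℂ) = (δ₂ * β₂ - b * β₂) / c := by rw [db]; field_simp; ring
    rw [this]
    exact K.div_mem (K.sub_mem (K.mul_mem hδ.1 hδ.2) (K.mul_mem (rm _) hδ.2)) (rm _)
  intro x hx
  obtain ⟨r, s, t, w, e⟩ := h₂.hspan_of f₂ ⟨x, hx⟩
  have e' : x = r + s * δ₂ + t * β₂ + w * β₂' := by have := congrArg (Subtype.val) e; simpa using this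
  rw [e']
  exact K.add_mem (K.add_mem (K.add_mem (rm _) (K.mul_mem (rm _) hδ.1)) (K.mul_mem (rm _) hδ.2))
    (K.mul_mem (rm _) hβ')

theorem uniq (h : Rel4 K D b c q) (h2 : Rel4 K₂ D b c q) : K₂ = K :=
  le_antisymm (h.le h2) (h2.le h)

theorem isC4 (h : Rel4 K D b c q) : IsC4Quartic K := by
  obtain ⟨f, δ, β, β', h⟩ := h
  have := nf f
  obtain ⟨g1, g2⟩ := h.galois_cyclic f
  exact ⟨f, g1, g2⟩

theorem im_zero {z : ℂ} {r : ℝ} (hr : 0 ≤ r) (h : z ^ 2 = r) : z.im = 0 := by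
  have h2 : z ^ 2 = ((Real.sqrt r : ℝ) : ℂ) ^ 2 := by
    rw [h, ← Complex.ofReal_pow, Real.sq_sqrt hr]
  rcases sq_eq_sq_iff_eq_or_eq_neg.1 h2 with e | e <;> simp [e]

theorem pos_aux {D b c : ℚ} (hD : b ^ 2 + c ^ 2 = D) (nsq : ¬ IsSquare D) {d : ℝ} (hd : d ^ 2 = D) :
    0 < (D : ℝ) + b * d := by
  have c0 := C4Rel.c_ne_zero hD nsq
  have hDr : (b : ℝ) ^ 2 + (c : ℝ) ^ 2 = D := by exact_mod_cast congrArg (Rat.cast (K := ℝ)) hD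
  have c0' : 0 < (c : ℝ) ^ 2 := by have : (c : ℝ) ≠ 0 := by exact_mod_cast c0
                                   positivity
  have : (0 : ℝ) ≤ (b + d) ^ 2 := sq_nonneg _
  nlinarith

theorem totReal (h : Rel4 K D b c q) (hq : 0 < q) : IsTotallyRealSubfield K := by
  obtain ⟨f, δ, β, β', h⟩ := h
  have := nf f
  intro σ x
  have hD0 : (0 : ℝ) ≤ D := by
    have : (0 : ℚ) ≤ D := by rw [← h.hD]; positivity
    exact_mod_cast this
  have d2 : (σ δ) ^ 2 = ((D : ℝ) : ℂ) := by rw [← map_pow, h.d2]; simp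
  have e1 := im_zero hD0 d2
  have e2 : σ δ = ((σ δ).re : ℂ) := Complex.ext rfl (by simp [e1])
  have d3 : (σ δ).re ^ 2 = (D : ℝ) := by rw [e2] at d2; exact_mod_cast d2
  have d3' : (-(σ δ).re) ^ 2 = (D : ℝ) := by rw [neg_sq, d3]
  have qr : (0 : ℝ) < q := by exact_mod_cast hq
  have b2 : (σ β) ^ 2 = (((q : ℝ) * (D + b * (σ δ).re) : ℝ) : ℂ) := by
    rw [← map_pow, h.b2]; push_cast; rw [← e2]; simp
  have b2' : (σ β') ^ 2 = (((q : ℝ) * (D + b * (-(σ δ).re)) : ℝ) : ℂ) := by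
    rw [← map_pow, h.b2']; push_cast; rw [← e2]; simp; ring_nf; simp
  have e3 := im_zero (mul_pos qr (pos_aux h.hD h.nsq d3)).le b2
  have e4 := im_zero (mul_pos qr (pos_aux h.hD h.nsq d3')).le b2'
  obtain ⟨r, s, t, w, rfl⟩ := h.hspan_of f x
  have ratim : ∀ r : ℚ, (r : ℂ).im = 0 := fun r => Complex.ratCast_im r
  simp only [map_add, map_mul, map_ratCast, Complex.add_im, Complex.mul_im, e1, e3, e4, ratim]
  ring

theorem q_pos (h : Rel4 K D b c q) (hr : IsTotallyRealSubfield K) : 0 < q := by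
  obtain ⟨f, δ, β, β', h⟩ := h
  have := nf f
  have e1 : ((δ : ℂ)).im = 0 := hr (K.val : K →+* ℂ) δ
  have e3 : ((β : ℂ)).im = 0 := hr (K.val : K →+* ℂ) β
  have a1 : ((δ : ℂ)) ^ 2 = D := by have := congrArg (Subtype.val) h.d2; simpa using this
  have b1 : ((β : ℂ)) ^ 2 = q * (D + b * δ) := by have := congrArg (Subtype.val) h.b2; simpa using this
  have e2 : (δ : ℂ) = ((δ : ℂ).re : ℂ) := Complex.ext rfl (by simp [e1])
  have e4 : (β : ℂ) = ((β : ℂ).re : ℂ) := Complex.ext rfl (by simp [e3])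
  rw [e2] at a1 b1
  rw [e4] at b1
  have a2 : (δ : ℂ).re ^ 2 = (D : ℝ) := by exact_mod_cast a1
  have b2 : (β : ℂ).re ^ 2 = (q : ℝ) * (D + b * (δ : ℂ).re) := by exact_mod_cast b1
  have hp := pos_aux h.hD h.nsq a2
  have : 0 ≤ (q : ℝ) := by
    by_contra hh
    push Not at hh
    have := mul_neg_of_neg_of_pos hh hp
    rw [← b2] at this
    nlinarith [sq_nonneg (β : ℂ).re]
  have : 0 ≤ q := by exact_mod_cast this
  exact lt_of_le_of_ne this (Ne.symm h.hq)

theorem exists_field (hD : b ^ 2 + c ^ 2 = D) (nsq : ¬ IsSquare D) (hq : q ≠ 0) :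
    ∃ K : IntermediateField ℚ ℂ, Rel4 K D b c q := by
  obtain ⟨δ, hδ⟩ := IsAlgClosed.exists_pow_nat_eq (D : ℂ) (n := 2) (by norm_num)
  obtain ⟨β, hβ⟩ := IsAlgClosed.exists_pow_nat_eq ((q : ℂ) * (D + b * δ)) (n := 2) (by norm_num)
  have h := C4Rel.of_two hD nsq hq hδ hβ
  set β' := (δ - b) * β / c with hβ'
  let S : Subalgebra ℚ ℂ :=
    { carrier := {x | ∃ r s t w : ℚ, x = r + s * δ + t * β + w * β'}
      mul_mem' := by
        rintro _ _ ⟨r, s, t, w, rfl⟩ ⟨r', s', t', w', rfl⟩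
        refine ⟨r * r' + s * s' * D + t * t' * q * D + w * w' * q * D,
          r * s' + s * r' + t * t' * q * b - w * w' * q * b + (t * w' + w * t') * q * c,
          r * t' + t * r' + (s * t' + t * s') * b + (s * w' + w * s') * c,
          r * w' + w * r' + (s * t' + t * s') * c - (s * w' + w * s') * b, ?_⟩
        push_cast
        linear_combination s * s' * h.d2 + t * t' * h.b2 + w * w' * h.b2' + (t * w' + w * t') * h.bb
          + (s * t' + t * s') * h.db + (s * w' + w * s') * h.db'
      add_mem' := by
        rintro _ _ ⟨r, s, t, w, rfl⟩ ⟨r', s', t', w', rfl⟩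
        exact ⟨r + r', s + s', t + t', w + w', by push_cast; ring⟩
      algebraMap_mem' := fun r => ⟨r, 0, 0, 0, by simp⟩ }
  have algδ : IsIntegral ℚ δ := IsIntegral.of_pow (n := 2) (by norm_num) (by
    rw [hδ]; exact isIntegral_algebraMap (R := ℚ) (A := ℂ) (x := D))
  have algβ : IsIntegral ℚ β := IsIntegral.of_pow (n := 2) (by norm_num) (by
    rw [hβ]; exact (isIntegral_algebraMap (R := ℚ) (A := ℂ) (x := q)).mul
      ((isIntegral_algebraMap (R := ℚ) (A := ℂ) (x := D)).add
        ((isIntegral_algebraMap (R := ℚ) (A := ℂ) (x := b)).mul algδ)))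
  have algβ' : IsIntegral ℚ β' := IsIntegral.of_pow (n := 2) (by norm_num) (by
    rw [h.b2']; exact (isIntegral_algebraMap (R := ℚ) (A := ℂ) (x := q)).mul
      ((isIntegral_algebraMap (R := ℚ) (A := ℂ) (x := D)).sub
        ((isIntegral_algebraMap (R := ℚ) (A := ℂ) (x := b)).mul algδ)))
  have algS : ∀ x ∈ S, IsAlgebraic ℚ x := by
    rintro _ ⟨r, s, t, w, rfl⟩
    have ra : ∀ r : ℚ, IsIntegral ℚ (r : ℂ) := fun r => isIntegral_algebraMap (R := ℚ) (A := ℂ) (x := r)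
    exact ((((ra r).add ((ra s).mul algδ)).add ((ra t).mul algβ)).add ((ra w).mul algβ')).isAlgebraic
  let K : IntermediateField ℚ ℂ := S.toIntermediateField (fun x hx =>
    S.inv_mem_of_algebraic (x := ⟨x, hx⟩) (algS x hx))
  have mem : ∀ x, x ∈ K ↔ ∃ r s t w : ℚ, x = r + s * δ + t * β + w * β' := fun x => Iff.rfl
  let δK : K := ⟨δ, (mem _).2 ⟨0, 1, 0, 0, by simp⟩⟩
  let βK : K := ⟨β, (mem _).2 ⟨0, 0, 1, 0, by simp⟩⟩
  let βK' : K := ⟨β', (mem _).2 ⟨0, 0, 0, 1, by simp⟩⟩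
  have hs : ∀ x : K, ∃ r s t w : ℚ, x = r + s * δK + t * βK + w * βK' := by
    rintro ⟨x, hx⟩
    obtain ⟨r, s, t, w, e⟩ := (mem _).1 hx
    refine ⟨r, s, t, w, Subtype.ext ?_⟩
    simp [δK, βK, βK', e]
  have hK : C4Rel D b c q δK βK βK' := by
    refine ⟨hD, nsq, hq, ?_, ?_, ?_, ?_, ?_, ?_⟩ <;> apply Subtype.ext <;> simp [δK, βK, βK']
    · exact h.d2
    · exact h.b2
    · exact h.b2'
    · exact h.bb
    · exact h.db
    · exact h.db'
  have : FiniteDimensional ℚ K := by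
    have : (⊤ : Submodule ℚ K) = Submodule.span ℚ (Set.range ![(1:K), δK, βK, βK']) := by
      symm
      rw [eq_top_iff]
      intro x _
      obtain ⟨r, s, t, w, rfl⟩ := hs x
      rw [Submodule.mem_span_range_iff_exists_fun]
      refine ⟨![r, s, t, w], ?_⟩
      simp [Fin.sum_univ_four, Rat.smul_def]
    exact ⟨this ▸ Submodule.fg_span (Set.finite_range _)⟩
  have : NumberField K :=
    { to_charZero := charZero_of_injective_algebraMap (algebraMap ℚ K).injective
      to_finiteDimensional := inferInstance }
  exact ⟨K, hK.finrank4 hs, δK, βK, βK', hK⟩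

end Rel4

namespace Rel4
variable {K K₂ : IntermediateField ℚ ℂ} {D b c q : ℚ}

theorem of_two' (f : Module.finrank ℚ K = 4) (hD : b ^ 2 + c ^ 2 = D) (nsq : ¬ IsSquare D) (hq : q ≠ 0)
    {δ β : K} (d2 : δ ^ 2 = (D : K)) (b2 : β ^ 2 = (q : K) * (D + b * δ)) : Rel4 K D b c q := by
  have := nf f
  exact ⟨f, δ, β, _, C4Rel.of_two hD nsq hq d2 b2⟩

theorem change (h : Rel4 K D b c q) {b₁ c₁ q₁ s : ℚ} (h1 : b₁ ^ 2 + c₁ ^ 2 = D) (hs : s ≠ 0)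
    (hq : q₁ ≠ 0) (e : q₁ * s ^ 2 = q * (2 * (D + b * b₁ + c * c₁)) * D) : Rel4 K D b₁ c₁ q₁ := by
  obtain ⟨f, δ, β, β', h⟩ := h
  have := nf f
  have hc := h.change h1
  have hD0 : D ≠ 0 := fun h0 => h.nsq (h0 ▸ ⟨0, by simp⟩)
  have sK : (s : K) ≠ 0 := by exact_mod_cast hs
  set γ := (β*((D+b*b₁+c*c₁ : ℚ)+(b+b₁)*δ)/(D+b*δ)) with hγ
  refine of_two' f h1 h.nsq hq (δ := δ) (β := γ * (D / s : ℚ)) h.d2 ?_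
  rw [mul_pow, hc]
  have : (q*(2*(D+b*b₁+c*c₁))/D) * (D/s)^2 = q₁ := by field_simp; linarith
  rw [← this]; push_cast; ring

theorem change' (h : Rel4 K D b c q) {b₁ c₁ q₁ s : ℚ} (h1 : b₁ ^ 2 + c₁ ^ 2 = D) (hs : s ≠ 0)
    (hq : q₁ ≠ 0) (e : q₁ * s ^ 2 = q * (2 * (D + b * b₁ + c * c₁))) : Rel4 K D b₁ c₁ q₁ := by
  have h2 : Rel4 K D b c (q * D) := by
    obtain ⟨f, δ, β, β', h⟩ := h
    have := nf f
    have hD0 : D ≠ 0 := fun h0 => h.nsq (h0 ▸ ⟨0, by simp⟩)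
    refine of_two' f h.hD h.nsq (mul_ne_zero h.hq hD0) (δ := δ) (β := β * δ) h.d2 ?_
    rw [mul_pow, h.b2, h.d2]; push_cast; ring
  obtain ⟨-, δ, β, β', hh⟩ := h
  have hD0 : D ≠ 0 := fun h0 => hh.nsq (h0 ▸ ⟨0, by simp⟩)
  refine h2.change h1 (s := s * D) (mul_ne_zero hs hD0) hq ?_
  rw [mul_pow, ← mul_assoc, e]; ring

theorem scale (h : Rel4 K D b c q) {q₁ s : ℚ} (hq : q₁ ≠ 0) (e : q₁ * s ^ 2 = q) :
    Rel4 K D b c q₁ := by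
  obtain ⟨f, δ, β, β', h⟩ := h
  have := nf f
  have hs : s ≠ 0 := by rintro rfl; exact h.hq (by rw [← e]; ring)
  have sK : (s : K) ≠ 0 := by exact_mod_cast hs
  refine of_two' f h.hD h.nsq hq (δ := δ) (β := β / s) h.d2 ?_
  rw [div_pow, h.b2, ← e]; push_cast; field_simp

theorem scaleD (h : Rel4 K D b c q) {D₁ s : ℚ} (e : D₁ * s ^ 2 = D) :
    Rel4 K D₁ (b / s) (c / s) q := by
  obtain ⟨f, δ, β, β', h⟩ := h
  have := nf f
  have hD0 : D ≠ 0 := fun h0 => h.nsq (h0 ▸ ⟨0, by simp⟩)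
  have hs : s ≠ 0 := by rintro rfl; exact hD0 (by rw [← e]; ring)
  have sK : (s : K) ≠ 0 := by exact_mod_cast hs
  refine of_two' f ?_ ?_ h.hq (δ := δ / s) (β := β / s) ?_ ?_
  · have := h.hD; field_simp; rw [← e] at this; linarith
  · rintro ⟨r, hr⟩; exact h.nsq ⟨r * s, by rw [← e, hr]; ring⟩
  · rw [div_pow, h.d2, ← e]; push_cast; field_simp
  · rw [div_pow, h.b2, ← e]; push_cast; field_simp

theorem negb (h : Rel4 K D b c q) : Rel4 K D (-b) c q := by
  obtain ⟨f, δ, β, β', h⟩ := h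
  have := nf f
  refine of_two' f (by rw [neg_sq, h.hD]) h.nsq h.hq (δ := -δ) (β := β) (by rw [neg_sq, h.d2]) ?_
  rw [h.b2]; push_cast; ring

theorem negc (h : Rel4 K D b c q) : Rel4 K D b (-c) q := by
  obtain ⟨f, δ, β, β', h⟩ := h
  exact of_two' f (by rw [neg_sq, h.hD]) h.nsq h.hq (δ := δ) (β := β) h.d2 h.b2

theorem of_isC4 (hK : IsC4Quartic K) : ∃ D b c q : ℚ, Rel4 K D b c q := by
  obtain ⟨f, hG, ⟨e⟩⟩ := hK
  have := nf f
  set σ := e.symm (Multiplicative.ofAdd 1) with hσ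
  have hgen : ∀ g : K ≃ₐ[ℚ] K, ∃ n : ℕ, g = σ ^ n := by
    intro g
    refine ⟨(Multiplicative.toAdd (e g)).val, ?_⟩
    apply e.injective
    rw [map_pow, hσ, MulEquiv.apply_symm_apply, ← ofAdd_nsmul]
    simp
  have h4 : σ ^ 4 = 1 := by
    apply e.injective
    rw [map_pow, hσ, MulEquiv.apply_symm_apply, e.map_one, ← ofAdd_nsmul]
    rfl
  have h2 : σ ^ 2 ≠ 1 := by
    intro h
    have := congrArg e h
    rw [map_pow, hσ, MulEquiv.apply_symm_apply, e.map_one, ← ofAdd_nsmul] at this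
    exact absurd this (by decide)
  have hfix : ∀ x : K, σ x = x → ∃ r : ℚ, x = r := by
    intro x hx
    have hx2 : ∀ n : ℕ, (σ ^ n) x = x := by
      intro n; induction n with
      | zero => simp
      | succ n ih => rw [pow_succ, AlgEquiv.mul_apply, hx, ih]
    have : x ∈ (⊥ : IntermediateField ℚ K) := by
      rw [IsGalois.mem_bot_iff_fixed]
      intro g; obtain ⟨n, rfl⟩ := hgen g; exact hx2 n
    rw [IntermediateField.mem_bot] at this
    obtain ⟨r, hr⟩ := this
    exact ⟨r, by rw [← hr]; simp⟩
  obtain ⟨x, hx⟩ : ∃ x, (σ ^ 2) x ≠ x := by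
    by_contra hh; push Not at hh; exact h2 (AlgEquiv.ext hh)
  have h4' : ∀ y, σ (σ (σ (σ y))) = y := fun y => by
    have := congrArg (fun g : K ≃ₐ[ℚ] K => g y) h4
    simpa [pow_succ, AlgEquiv.mul_apply] using this
  have hx' : σ (σ x) ≠ x := by simpa [pow_succ, AlgEquiv.mul_apply] using hx
  set β := x - σ (σ x) with hβ
  have hβ0 : β ≠ 0 := sub_ne_zero.2 hx'.symm
  set β' := σ β with hβ'
  have hβ'0 : β' ≠ 0 := by rw [hβ']; simpa using hβ0
  have hb' : σ β' = -β := by rw [hβ', hβ]; simp [h4']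
  set η := β * β' with hη
  have hη0 : η ≠ 0 := mul_ne_zero hβ0 hβ'0
  have ση : σ η = -η := by rw [hη, map_mul, hb', ← hβ']; ring
  have s2 : σ 2 = 2 := by simpa using map_natCast σ 2
  obtain ⟨P, hP⟩ := hfix ((β ^ 2 + β' ^ 2) / 2) (by
    simp only [map_div₀, map_add, map_pow, hb', ← hβ', s2]; ring)
  obtain ⟨ρ, hρ⟩ := hfix ((β ^ 2 - β' ^ 2) / (2 * η)) (by
    simp only [map_div₀, map_sub, map_mul, map_pow, hb', ← hβ', ση, s2]
    field_simp; ring)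
  obtain ⟨E, hE⟩ := hfix (η ^ 2) (by simp [ση])
  have e1 : β ^ 2 = P + ρ * η := by rw [← hP, ← hρ]; field_simp; ring
  have e2 : β' ^ 2 = P - ρ * η := by rw [← hP, ← hρ]; field_simp; ring
  have e3 : (E : K) * (1 + ρ ^ 2) = P ^ 2 := by
    have : η ^ 2 = (P + ρ * η) * (P - ρ * η) := by rw [← e1, ← e2, hη]; ring
    rw [← hE]; linear_combination this
  have e4 : E * (1 + ρ ^ 2) = P ^ 2 := by exact_mod_cast e3
  have nsq : ¬ IsSquare E := by
    rintro ⟨r, hr⟩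
    have : η ^ 2 = (r : K) ^ 2 := by rw [hE, hr]; push_cast; ring
    have hη2 : σ η = η := by
      rcases sq_eq_sq_iff_eq_or_eq_neg.1 this with h | h <;> rw [h] <;> simp
    rw [ση] at hη2
    exact hη0 (self_eq_neg.1 hη2.symm)
  have hE0 : E ≠ 0 := fun h0 => nsq (h0 ▸ ⟨0, by simp⟩)
  have hP0 : P ≠ 0 := by
    rintro rfl
    have : (1 + ρ ^ 2) ≠ 0 := by positivity
    rcases mul_eq_zero.1 (e4.trans (by norm_num)) with h | h
    · exact hE0 h
    · exact this h
  refine ⟨E, E * ρ / P, E / P, P / E, of_two' f ?_ nsq (div_ne_zero hP0 hE0) (δ := η) (β := β) hE ?_⟩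
  · field_simp; linear_combination e4
  · rw [e1]
    have : (E : K) ≠ 0 := by exact_mod_cast hE0
    have : (P : K) ≠ 0 := by exact_mod_cast hP0
    push_cast; field_simp

theorem rat_sqf (x : ℚ) (hx : 0 < x) : ∃ (n : ℕ) (s : ℚ), Squarefree n ∧ 0 < n ∧ (n : ℚ) * s ^ 2 = x := by
  obtain ⟨a, m, h, hsq⟩ := Nat.sq_mul_squarefree (x.num.natAbs * x.den)
  refine ⟨a, m / x.den, hsq, Nat.pos_of_ne_zero hsq.ne_zero, ?_⟩
  have hn : ((x.num.natAbs : ℕ) : ℚ) = x.num := by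
    have : ((x.num.natAbs : ℤ)) = x.num := Int.natAbs_of_nonneg (Rat.num_pos.2 hx).le
    rw [← Int.cast_natCast, this]
  have h' : (m : ℚ) ^ 2 * a = x.num * x.den := by rw [← hn]; exact_mod_cast h
  have hd : (x.den : ℚ) ≠ 0 := by exact_mod_cast x.den_ne_zero
  rw [div_pow]
  have hx3 : x = x.num / x.den := (Rat.num_div_den x).symm
  conv_rhs => rw [hx3]
  field_simp
  linear_combination h'

theorem sum_sq_int {D : ℕ} (hD : 0 < D) {b c : ℚ} (h : b ^ 2 + c ^ 2 = D) :
    ∃ B C : ℕ, B ^ 2 + C ^ 2 = D := by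
  have key : ∃ u v : ℕ, D * (b.den * c.den) ^ 2 = u ^ 2 + v ^ 2 := by
    refine ⟨b.num.natAbs * c.den, c.num.natAbs * b.den, ?_⟩
    have hb : (b.den : ℚ) ≠ 0 := by exact_mod_cast b.den_ne_zero
    have hc : (c.den : ℚ) ≠ 0 := by exact_mod_cast c.den_ne_zero
    have : (D * (b.den * c.den) ^ 2 : ℤ) = (b.num * c.den) ^ 2 + (c.num * b.den) ^ 2 := by
      have : (D * (b.den * c.den) ^ 2 : ℚ) = (b.num * c.den) ^ 2 + (c.num * b.den) ^ 2 := by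
        rw [← h]
        rw [← Rat.den_mul_eq_num b, ← Rat.den_mul_eq_num c]; ring
      exact_mod_cast this
    zify
    rw [this, mul_pow, mul_pow, mul_pow, mul_pow, sq_abs, sq_abs]
  have k2 := Nat.eq_sq_add_sq_iff.1 key
  have : ∃ x y, D = x ^ 2 + y ^ 2 := by
    rw [Nat.eq_sq_add_sq_iff]
    intro q hq hq3
    have hp : q.Prime := Nat.prime_of_mem_primeFactors hq
    have := Fact.mk hp
    have hN : (b.den * c.den) ≠ 0 := mul_ne_zero b.den_ne_zero c.den_ne_zero
    have := k2 (q := q) (by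
      rw [Nat.mem_primeFactors] at hq ⊢
      exact ⟨hp, hq.2.1.mul_right _, mul_ne_zero hD.ne' (pow_ne_zero _ hN)⟩) hq3
    rw [padicValNat.mul hD.ne' (pow_ne_zero _ hN), padicValNat.pow] at this
    rw [Nat.even_add] at this
    exact this.2 (even_two_mul _)
  obtain ⟨x, y, e⟩ := this
  exact ⟨x, y, e.symm⟩

theorem classify (hK : IsC4Quartic K) (hr : IsTotallyRealSubfield K) :
    ∃ (D q : ℕ) (b c : ℤ), 1 < D ∧ Squarefree D ∧ 0 < q ∧ Squarefree q ∧ b ^ 2 + c ^ 2 = D ∧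
      Rel4 K D b c q := by
  obtain ⟨E, b, c, q, h⟩ := of_isC4 hK
  have hE0 : 0 < E := by
    obtain ⟨-, δ, β, β', h⟩ := h
    have hD0 : E ≠ 0 := fun h0 => h.nsq (h0 ▸ ⟨0, by simp⟩)
    have : 0 ≤ E := by rw [← h.hD]; positivity
    exact lt_of_le_of_ne this hD0.symm
  obtain ⟨D, s, hDs, hD0, e⟩ := rat_sqf E hE0
  have h := h.scaleD e
  obtain ⟨b, hb⟩ : ∃ b', b' = b / s := ⟨_, rfl⟩
  obtain ⟨c, hc⟩ : ∃ c', c' = c / s := ⟨_, rfl⟩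
  rw [← hb, ← hc] at h
  have hh := h
  obtain ⟨-, δ, β, β', h0⟩ := hh
  obtain ⟨B, C, hBC⟩ := sum_sq_int hD0 h0.hD
  have hBCq : (B : ℚ) ^ 2 + (C : ℚ) ^ 2 = D := by exact_mod_cast hBC
  have hD1 : 1 < D := by
    by_contra hh
    have : D = 1 := by omega
    exact h0.nsq ⟨1, by simp [this]⟩
  have hDq : (D : ℚ) ≠ 0 := by positivity
  have hC0 := C4Rel.c_ne_zero hBCq h0.nsq
  have hc0 := C4Rel.c_ne_zero h0.hD h0.nsq
  have key : ∃ (C' : ℤ) (q' : ℚ), (B : ℤ) ^ 2 + C' ^ 2 = D ∧ Rel4 K D (B : ℤ) C' q' := by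
    by_cases hG : D + b * B + c * C = 0
    · refine ⟨-C, (q * (2 * (D + b * B + c * (-C))) * D), by push_cast; rw [neg_sq]; exact_mod_cast hBC, ?_⟩
      refine h.change (s := 1) (by push_cast; rw [neg_sq]; exact hBCq) one_ne_zero ?_ (by push_cast; ring)
      have : (D : ℚ) + b * B + c * (-C) ≠ 0 := by
        intro h1
        have : c * C = 0 := by linarith
        exact mul_ne_zero hc0 hC0 this
      exact mul_ne_zero (mul_ne_zero h0.hq (mul_ne_zero two_ne_zero this)) hDq
    · refine ⟨C, (q * (2 * (D + b * B + c * C)) * D), by exact_mod_cast hBC, ?_⟩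
      refine h.change (s := 1) (by push_cast; exact hBCq) one_ne_zero ?_ (by push_cast; ring)
      exact mul_ne_zero (mul_ne_zero h0.hq (mul_ne_zero two_ne_zero hG)) hDq
  obtain ⟨C', q', e1, h1⟩ := key
  obtain ⟨n, t, hn, hn0, e2⟩ := rat_sqf q' (h1.q_pos hr)
  refine ⟨D, n, B, C', hD1, hDs, hn0, hn, e1, ?_⟩
  exact h1.scale (by positivity) e2

/-- remove a factor `2` of `q` by swapping -/
theorem swap2 {D : ℕ} {b c : ℤ} {q : ℚ} (h : Rel4 K D b c (2 * q)) (hq : q ≠ 0) (hD : Odd D) :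
    Rel4 K D c b q := by
  have h0 := h
  obtain ⟨-, δ, β, β', h0⟩ := h0
  have hh : b ^ 2 + c ^ 2 = D := by exact_mod_cast h0.hD
  have hbc : b + c ≠ 0 := by
    intro h1
    have : c = -b := by omega
    subst this
    have hD' : Odd (D : ℤ) := by exact_mod_cast hD
    rw [← hh] at hD'
    have : Even (b ^ 2 + (-b) ^ 2) := ⟨b ^ 2, by ring⟩
    exact (Int.not_even_iff_odd.2 hD') this
  have hbc' : (b : ℚ) + c ≠ 0 := by exact_mod_cast hbc
  refine h.change' (s := 2 * (b + c)) (by rw [add_comm]; exact h0.hD) (mul_ne_zero two_ne_zero hbc') hq ?_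
  rw [← h0.hD]; ring

theorem drop_prime {D : ℕ} {b c : ℤ} {a : ℚ} {p : ℕ} (hp : p.Prime) (hpD : p ∣ D) (hDs : Squarefree D)
    (ho : Odd D) (h : Rel4 K D b c (a * p)) :
    ∃ b' c' : ℤ, Rel4 K D b' c' a ∧ b' ≡ b [ZMOD 2] := by
  have h0 := h
  obtain ⟨-, δ, β, β', h0⟩ := h0
  have ha : a ≠ 0 := left_ne_zero_of_mul h0.hq
  have hh : b ^ 2 + c ^ 2 = D := by exact_mod_cast h0.hD
  have := Fact.mk hp
  have hD0 : D ≠ 0 := hDs.ne_zero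
  obtain ⟨x, y, hxy⟩ : ∃ x y : ℕ, x ^ 2 + y ^ 2 = p := by
    apply Nat.Prime.sq_add_sq
    intro h3
    have hex : ∃ x y : ℕ, D = x ^ 2 + y ^ 2 := ⟨b.natAbs, c.natAbs, by zify; simp [sq_abs, hh]⟩
    have := Nat.eq_sq_add_sq_iff.1 hex (q := p) (Nat.mem_primeFactors.2 ⟨hp, hpD, hD0⟩) h3
    have h1 : padicValNat p D = 1 := by
      have h2 : padicValNat p D ≤ 1 := by
        rw [← Nat.factorization_def _ hp]; exact (Nat.squarefree_iff_factorization_le_one hD0).1 hDs p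
      have h3 : 1 ≤ padicValNat p D := one_le_padicValNat_of_dvd hD0 hpD
      omega
    rw [h1] at this
    exact absurd this (by decide)
  have hpz : Prime (p : ℤ) := Nat.prime_iff_prime_int.1 hp
  have hxyz : (x : ℤ) ^ 2 + (y : ℤ) ^ 2 = p := by exact_mod_cast hxy
  obtain ⟨d, hd⟩ : (p : ℤ) ∣ D := by exact_mod_cast hpD
  have hx0 : x ≠ 0 := by
    rintro rfl
    have : p = y ^ 2 := by rw [← hxy]; ring
    exact (Nat.Prime.not_prime_pow (le_refl 2)) (this ▸ hp)
  have key : ∃ y' : ℤ, y' ^ 2 = y ^ 2 ∧ (p : ℤ) ∣ b * x + c * y' := by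
    have : (p : ℤ) ∣ (b * x + c * y) * (b * x + c * (-y)) := by
      refine ⟨b ^ 2 - d * y ^ 2, ?_⟩
      linear_combination (-y ^ 2 : ℤ) * hh - b ^ 2 * (-hxyz) - y ^ 2 * hd
    rcases hpz.dvd_or_dvd this with h | h
    · exact ⟨y, rfl, h⟩
    · exact ⟨-y, by ring, h⟩
  obtain ⟨y', hy', u, hu⟩ := key
  rw [← hy'] at hxyz
  have hv : (p : ℤ) ∣ c * x - b * y' := by
    apply hpz.dvd_of_dvd_pow (n := 2)
    refine ⟨D - p * u ^ 2, ?_⟩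
    linear_combination ((x : ℤ) ^ 2 + y' ^ 2) * hh + (D : ℤ) * hxyz - (b * x + c * y' + p * u) * hu
  obtain ⟨v, hv⟩ := hv
  have hp0 : (p : ℤ) ≠ 0 := hpz.ne_zero
  have hb : b = x * u - y' * v := by
    apply mul_left_cancel₀ hp0
    linear_combination x * hu - y' * hv - b * hxyz
  have hc : c = y' * u + x * v := by
    apply mul_left_cancel₀ hp0
    linear_combination y' * hu + x * hv - c * hxyz
  have hd' : d = u ^ 2 + v ^ 2 := by
    apply mul_left_cancel₀ hp0
    rw [← hd, ← hh, hb, hc, ← hxyz]; ring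
  refine ⟨x * u + y' * v, x * v - y' * u, ?_, ?_⟩
  · have hDq : (D : ℚ) = p * (u ^ 2 + v ^ 2) := by rw [hd'] at hd; exact_mod_cast hd
    have hpq : (p : ℚ) = x ^ 2 + y' ^ 2 := by exact_mod_cast hxyz.symm
    refine h.change (s := 2 * x * D) ?_ ?_ ha ?_
    · push_cast; rw [hDq, hpq]; ring
    · have : (x : ℚ) ≠ 0 := by exact_mod_cast hx0
      have : (D : ℚ) ≠ 0 := by exact_mod_cast hD0
      positivity
    · rw [hb, hc]; push_cast
      rw [hDq, hpq]; ring
  · rw [hb, Int.modEq_iff_dvd]; exact ⟨- (y' * v), by ring⟩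

theorem drop_factor {D : ℕ} (hDs : Squarefree D) (ho : Odd D) (d : ℕ) :
    d ∣ D → ∀ (a : ℚ) (b c : ℤ), Rel4 K D b c (a * d) →
      ∃ b' c' : ℤ, Rel4 K D b' c' a ∧ b' ≡ b [ZMOD 2] := by
  induction d using Nat.recOnMul with
  | zero => intro h; simp at h; subst h; simp at hDs
  | one => intro _ a b c h; exact ⟨b, c, by simpa using h, rfl⟩
  | prime p hp => intro h a b c hr; exact drop_prime hp h hDs ho hr
  | mul m n hm hn =>
    intro h a b c hr
    obtain ⟨b', c', h1, h2⟩ := hn (dvd_of_mul_left_dvd h) (a * m) b c (by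
      push_cast at hr; rwa [mul_assoc])
    obtain ⟨b'', c'', h3, h4⟩ := hm (dvd_of_mul_right_dvd h) a b' c' h1
    exact ⟨b'', c'', h3, h4.trans h2⟩

end Rel4

namespace Rel4
variable {K K₂ : IntermediateField ℚ ℂ}

theorem toTau {D b c q : ℚ} (h : Rel4 K D b c q) : ∃ (_ : NumberField K) (δ β β' : K) (τ : K ≃+* K),
    C4Rel D b c q δ β β' ∧ (∀ x : K, ∃ r s t w : ℚ, x = r + s * δ + t * β + w * β') ∧
    τ δ = -δ ∧ τ β = β' ∧ τ β' = -β := by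
  obtain ⟨f, δ, β, β', h⟩ := h
  have := nf f
  obtain ⟨τ, t1, t2, t3⟩ := h.exists_tau f
  exact ⟨this, δ, β, β', τ.toRingEquiv, h, h.hspan_of f, t1, t2, t3⟩

theorem hD_int {D : ℕ} {b c : ℤ} {q : ℚ} (h : Rel4 K D b c q) : b ^ 2 + c ^ 2 = D := by
  obtain ⟨f, δ, β, β', h⟩ := h
  exact_mod_cast h.hD

theorem hD4 {D : ℕ} {b c : ℤ} (h : b ^ 2 + c ^ 2 = D) (hD : Odd D) : ∃ κ : ℤ, (D : ℤ) = 4 * κ + 1 := by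
  have hD' : Odd (D : ℤ) := by exact_mod_cast hD
  rw [← h] at hD' ⊢
  rcases Int.even_or_odd' b with ⟨x, rfl | rfl⟩ <;> rcases Int.even_or_odd' c with ⟨y, rfl | rfl⟩
  · exact absurd hD' (by rw [Int.not_odd_iff_even]; exact ⟨2 * (x ^ 2 + y ^ 2), by ring⟩)
  · exact ⟨x ^ 2 + y ^ 2 + y, by ring⟩
  · exact ⟨x ^ 2 + y ^ 2 + x, by ring⟩
  · exact absurd hD' (by rw [Int.not_odd_iff_even]; exact ⟨2 * (x ^ 2 + y ^ 2 + x + y) + 1, by ring⟩)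

theorem even_c {D : ℕ} {b c : ℤ} (h : b ^ 2 + c ^ 2 = D) (hD : Odd D) (hb : Odd b) : Even c := by
  have hD' : Odd (D : ℤ) := by exact_mod_cast hD
  have : Even (c ^ 2) := by
    have : c ^ 2 = D - b ^ 2 := by linarith
    rw [this]; exact hD'.sub_odd hb.pow
  exact (Int.even_pow.1 this).1

theorem disc {D q : ℕ} {b c : ℤ} (h : Rel4 K D b c q) (hDs : Squarefree D) (hD : Odd D)
    (hqs : Squarefree q) (hq : Odd q) (cop : q.Coprime D) (hb : Odd b) :
    quartDisc K = 64 * q ^ 2 * D ^ 3 := by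
  have h1 := h.hD_int
  obtain ⟨κ, hκ⟩ := hD4 h1 hD
  obtain ⟨_, δ, β, β', τ, h, hs, t1, t2, t3⟩ := h.toTau
  rw [quartDisc_eq]
  exact C4Rel.discr_eq (D := D) (q := q) (b := b) (c := c) (by exact_mod_cast h)
    (Int.squarefree_natCast.2 hDs) (Int.squarefree_natCast.2 hqs)
    (Nat.isCoprime_iff_coprime.2 cop) hκ hb (even_c h1 hD hb) (by exact_mod_cast hq) hs τ t1 t2 t3

theorem val_eq {D a p : ℕ} (hp : p.Prime) (hp2 : p ≠ 2) (hDs : Squarefree D) (has : Squarefree a)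
    (cop : a.Coprime D) : padicValInt p (64 * a ^ 2 * D ^ 3) = 2 ↔ p ∣ a := by
  have := Fact.mk hp
  have h1 : (64 * a ^ 2 * D ^ 3 : ℤ) = ((64 * a ^ 2 * D ^ 3 : ℕ) : ℤ) := by push_cast; ring
  have a0 := has.ne_zero
  have D0 := hDs.ne_zero
  rw [h1, padicValInt.of_nat, padicValNat.mul (by positivity) (by positivity),
    padicValNat.mul (by positivity) (by positivity), padicValNat.pow, padicValNat.pow]
  have h64 : padicValNat p 64 = 0 := by
    apply padicValNat.eq_zero_of_not_dvd
    intro h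
    have : p ∣ 2 ^ 6 := by simpa using h
    exact hp2 ((Nat.prime_dvd_prime_iff_eq hp Nat.prime_two).1 (hp.dvd_of_dvd_pow this))
  have va : padicValNat p a ≤ 1 := by
    rw [← Nat.factorization_def _ hp]; exact (Nat.squarefree_iff_factorization_le_one a0).1 has p
  have vD : padicValNat p D ≤ 1 := by
    rw [← Nat.factorization_def _ hp]; exact (Nat.squarefree_iff_factorization_le_one D0).1 hDs p
  have da : p ∣ a ↔ padicValNat p a ≠ 0 := dvd_iff_padicValNat_ne_zero a0
  have dD : p ∣ D ↔ padicValNat p D ≠ 0 := dvd_iff_padicValNat_ne_zero D0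
  have hcop : ¬ (p ∣ a ∧ p ∣ D) := fun ⟨x, y⟩ => Nat.not_coprime_of_dvd_of_dvd hp.one_lt x y cop
  rw [h64]
  constructor
  · intro h; rw [da]; omega
  · intro h
    have : ¬ p ∣ D := fun y => hcop ⟨h, y⟩
    rw [dD] at this; rw [da] at h; omega

theorem val_two {D a : ℕ} (hD : Odd D) (ha : Odd a) : padicValInt 2 (64 * a ^ 2 * D ^ 3) = 6 := by
  have h1 : (64 * a ^ 2 * D ^ 3 : ℤ) = ((2 ^ 6 * (a ^ 2 * D ^ 3) : ℕ) : ℤ) := by push_cast; ring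
  have a0 : a ≠ 0 := by rintro rfl; simp at ha
  have D0 : D ≠ 0 := by rintro rfl; simp at hD
  rw [h1, padicValInt.of_nat, padicValNat.mul (by positivity) (by positivity), padicValNat.prime_pow,
    padicValNat.eq_zero_of_not_dvd]
  intro h
  exact (Nat.not_even_iff_odd.2 (ha.pow.mul hD.pow)) (even_iff_two_dvd.2 h)

/-- main characterization -/
theorem char_fwd {a : ℕ} (ha : Odd a) (has : Squarefree a) (hK : IsC4Quartic K)
    (hr : IsTotallyRealSubfield K) (h6 : padicValInt 2 (quartDisc K) = 6)
    (hv : ∀ p : ℕ, p.Prime → p ≠ 2 → (padicValInt p (quartDisc K) = 2 ↔ (p : ℤ) ∣ (a : ℤ))) :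
    ∃ (D : ℕ) (b c : ℤ), 1 < D ∧ Squarefree D ∧ Odd D ∧ a.Coprime D ∧ Odd b ∧ Rel4 K D b c a := by
  obtain ⟨D, q, b, c, hD1, hDs, hq0, hqs, hbc, h⟩ := classify hK hr
  have hDo : Odd D := by
    rw [← Nat.not_even_iff_odd]
    intro hev
    obtain ⟨_, δ, β, β', τ, h, hs, t1, t2, t3⟩ := h.toTau
    rw [quartDisc_eq] at h6
    exact C4Rel.ne_six_of_even (D := D) (q := q) (b := b) (c := c) (by exact_mod_cast h)
      (Int.squarefree_natCast.2 hDs) (by exact_mod_cast hev) hs τ t1 t2 t3 h6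
  obtain ⟨q, b, c, hqo, hqs, h⟩ : ∃ (q : ℕ) (b c : ℤ), Odd q ∧ Squarefree q ∧ Rel4 K D b c q := by
    by_cases hq : Odd q
    · exact ⟨q, b, c, hq, hqs, h⟩
    · rw [Nat.not_odd_iff_even] at hq
      obtain ⟨q', rfl⟩ := even_iff_two_dvd.1 hq
      refine ⟨q', c, b, ?_, hqs.of_mul_right, ?_⟩
      · rw [← Nat.not_even_iff_odd]
        intro he
        obtain ⟨k, rfl⟩ := even_iff_two_dvd.1 he
        have := hqs 2 ⟨k, by ring⟩
        exact absurd this (by decide)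
      · refine swap2 (by push_cast at h; exact h) ?_ hDo
        have : q' ≠ 0 := by rintro rfl; simp at hq0
        exact_mod_cast this
  obtain ⟨κ, hκ⟩ := hD4 h.hD_int hDo
  have hbo : Odd b := by
    rw [← Int.not_even_iff_odd]
    intro hev
    obtain ⟨_, δ, β, β', τ, h, hs, t1, t2, t3⟩ := h.toTau
    rw [quartDisc_eq] at h6
    exact C4Rel.ne_six_of_beven (D := D) (q := q) (b := b) (c := c) (by exact_mod_cast h)
      hκ hev (by exact_mod_cast hqo) hs τ t1 t2 t3 h6
  obtain ⟨q₁, hq₁⟩ := Nat.gcd_dvd_left q D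
  have hq₁' : q = q₁ * q.gcd D := by rw [mul_comm]; exact hq₁
  obtain ⟨b', c', h', hbb⟩ := drop_factor hDs hDo (q.gcd D) (Nat.gcd_dvd_right q D) q₁ b c (by
    have : (q : ℚ) = q₁ * (q.gcd D : ℕ) := by exact_mod_cast hq₁'
    rw [← this]; exact h)
  have hbo' : Odd b' := by
    rw [Int.odd_iff] at hbo ⊢; rw [← hbo]; exact hbb
  have hq₁s : Squarefree q₁ := hqs.squarefree_of_dvd ⟨_, hq₁'⟩
  have hq₁o : Odd q₁ := by
    rw [hq₁', Nat.odd_mul] at hqo; exact hqo.1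
  have hcop : q₁.Coprime D := by
    apply Nat.coprime_of_dvd
    intro p hp h1 h2
    have h3 : p ∣ q.gcd D := Nat.dvd_gcd (h1.trans ⟨_, hq₁'⟩) h2
    have h4 := hqs p (by rw [hq₁']; exact mul_dvd_mul h1 h3)
    exact hp.one_lt.ne' (Nat.isUnit_iff.1 h4)
  have hd := h'.disc hDs hDo hq₁s hq₁o hcop hbo'
  have : q₁ = a := by
    rw [Nat.Squarefree.ext_iff hq₁s has]
    intro p hp
    by_cases hp2 : p = 2
    · subst hp2
      have e1 : ¬ 2 ∣ q₁ := fun h => (Nat.not_even_iff_odd.2 hq₁o) (even_iff_two_dvd.2 h)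
      have e2 : ¬ 2 ∣ a := fun h => (Nat.not_even_iff_odd.2 ha) (even_iff_two_dvd.2 h)
      tauto
    · rw [← val_eq hp hp2 hDs hq₁s hcop, ← hd, hv p hp hp2, Int.natCast_dvd_natCast]
  subst this
  exact ⟨D, b', c', hD1, hDs, hDo, hcop, hbo', h'⟩

theorem char_bwd {a D : ℕ} {b c : ℤ} (ha : Odd a) (has : Squarefree a) (hDs : Squarefree D) (hD : Odd D)
    (cop : a.Coprime D) (hb : Odd b) (h : Rel4 K D b c a) :
    IsC4Quartic K ∧ IsTotallyRealSubfield K ∧ quartDisc K = 64 * a ^ 2 * D ^ 3 ∧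
    padicValInt 2 (quartDisc K) = 6 ∧
    ∀ p : ℕ, p.Prime → p ≠ 2 → (padicValInt p (quartDisc K) = 2 ↔ (p : ℤ) ∣ (a : ℤ)) := by
  have hd := h.disc hDs hD has ha cop hb
  refine ⟨h.isC4, h.totReal ?_, hd, by rw [hd]; exact val_two hD ha, ?_⟩
  · have := has.ne_zero; positivity
  · intro p hp hp2
    rw [hd, val_eq hp hp2 hDs has cop, Int.natCast_dvd_natCast]

end Rel4

namespace Rel4
variable {K K₂ : IntermediateField ℚ ℂ}

/-- fields attached to `D` and `a` -/
def FS (a D : ℕ) : Set (IntermediateField ℚ ℂ) := {K | ∃ b c : ℤ, Odd b ∧ Rel4 K D b c a}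

theorem prime_mod_of_sum {D p : ℕ} {b c : ℤ} (hh : b ^ 2 + c ^ 2 = D) (hDs : Squarefree D) (ho : Odd D)
    (hp : p.Prime) (hpD : p ∣ D) : p % 4 = 1 := by
  have := Fact.mk hp
  have hD0 : D ≠ 0 := hDs.ne_zero
  have h3 : p % 4 ≠ 3 := by
    intro h3
    have hex : ∃ x y : ℕ, D = x ^ 2 + y ^ 2 := ⟨b.natAbs, c.natAbs, by zify; simp [sq_abs, hh]⟩
    have := Nat.eq_sq_add_sq_iff.1 hex (q := p) (Nat.mem_primeFactors.2 ⟨hp, hpD, hD0⟩) h3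
    have h1 : padicValNat p D = 1 := by
      have h2 : padicValNat p D ≤ 1 := by
        rw [← Nat.factorization_def _ hp]; exact (Nat.squarefree_iff_factorization_le_one hD0).1 hDs p
      have h3 : 1 ≤ padicValNat p D := one_le_padicValNat_of_dvd hD0 hpD
      omega
    rw [h1] at this
    exact absurd this (by decide)
  have : Odd p := ho.of_dvd_nat hpD
  rw [Nat.odd_iff] at this
  omega

theorem exists_rep {D : ℕ} (ho : Odd D) (hD0 : D ≠ 0) (h1 : ∀ p : ℕ, p.Prime → p ∣ D → p % 4 = 1) :
    ∃ b c : ℤ, Odd b ∧ b ^ 2 + c ^ 2 = D := by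
  obtain ⟨x, y, h⟩ : ∃ x y : ℕ, D = x ^ 2 + y ^ 2 := by
    rw [Nat.eq_sq_add_sq_iff]
    intro q hq h3
    rw [Nat.mem_primeFactors] at hq
    have := h1 q hq.1 hq.2.1
    omega
  by_cases hx : Odd x
  · exact ⟨x, y, by exact_mod_cast hx, by exact_mod_cast h.symm⟩
  · have hy : Odd y := by
      by_contra hy
      rw [Nat.not_odd_iff_even] at hx hy
      have : Even D := by
        rw [h]; exact (hx.pow_of_ne_zero two_ne_zero).add (hy.pow_of_ne_zero two_ne_zero)
      exact (Nat.not_even_iff_odd.2 ho) this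
    exact ⟨y, x, by exact_mod_cast hy, by rw [add_comm]; exact_mod_cast h.symm⟩

theorem sqf_eq_of_mul_sq {d d' : ℕ} (hd : Squarefree d) (hd' : Squarefree d') {n : ℕ}
    (h : d * d' = n ^ 2) : d = d' := by
  have aux : ∀ {d d' : ℕ}, Squarefree d → d * d' = n ^ 2 → ∀ p : ℕ, p.Prime → p ∣ d → p ∣ d' := by
    intro d d' hd h p hp hpd
    have h1 : p ∣ n := hp.dvd_of_dvd_pow (h ▸ hpd.mul_right d')
    have h2 : p * p ∣ d * d' := by rw [h, sq]; exact mul_dvd_mul h1 h1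
    obtain ⟨e, rfl⟩ := hpd
    have h3 : p ∣ e * d' := by
      rw [mul_assoc] at h2; exact (Nat.mul_dvd_mul_iff_left hp.pos).1 h2
    rcases (hp.dvd_mul).1 h3 with h4 | h4
    · exfalso
      have := hd p (mul_dvd_mul_left p h4)
      exact hp.one_lt.ne' (Nat.isUnit_iff.1 this)
    · exact h4
  rw [Nat.Squarefree.ext_iff hd hd']
  exact fun p hp => ⟨aux hd h p hp, aux hd' (by rw [mul_comm]; exact h) p hp⟩

theorem rat_sq_nat {m : ℕ} {r : ℚ} (h : (m : ℚ) = r ^ 2) : ∃ n : ℕ, m = n ^ 2 := by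
  have : IsSquare (m : ℚ) := ⟨r, by rw [h]; ring⟩
  rw [Rat.isSquare_natCast_iff] at this
  obtain ⟨n, hn⟩ := this
  exact ⟨n, by rw [hn]; ring⟩

theorem twist_inj {D d d' p₀ : ℕ} {b c : ℤ} {a : ℚ} (hDs : Squarefree D)
    (hp : p₀.Prime) (hpD : p₀ ∣ D) (hd : Squarefree d) (hd' : Squarefree d') (hpd : ¬ p₀ ∣ d)
    (hpd' : ¬ p₀ ∣ d') (h : Rel4 K D b c (a * d)) (h' : Rel4 K D b c (a * d')) : d = d' := by
  obtain ⟨_, δ, β, β', τ, h, hs, t1, t2, t3⟩ := h.toTau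
  obtain ⟨f, δ₂, β₂, β₂', h₂⟩ := h'
  have ha : a ≠ 0 := left_ne_zero_of_mul h.hq
  have key : ∃ γ : K, γ ^ 2 = ((a * d' : ℚ) : K) * ((D : ℚ) + (b : ℚ) * δ) := by
    rcases sq_eq_sq_iff_eq_or_eq_neg.1 (h₂.d2.trans h.d2.symm) with e | e
    · exact ⟨β₂, by rw [← e]; exact h₂.b2⟩
    · exact ⟨β₂', by rw [h₂.b2', e]; ring⟩
  obtain ⟨γ, hγ⟩ := key
  have h0 : (((D : ℚ) : K) + ((b : ℚ) : K) * δ) ≠ 0 := by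
    intro h0
    obtain ⟨h1, -⟩ := C4Rel.quad_indep h.nsq h.d2 h0
    exact h.nsq ⟨0, by rw [h1]; simp⟩
  have aK : (a : K) ≠ 0 := by exact_mod_cast ha
  obtain ⟨x, hx⟩ : ∃ x, x = β * γ / (a * ((D : ℚ) + (b : ℚ) * δ)) := ⟨_, rfl⟩
  have hx2 : x ^ 2 = ((d * d' : ℕ) : K) := by
    rw [hx, div_pow, mul_pow, hγ, h.b2]
    have := pow_ne_zero 2 (mul_ne_zero aK h0)
    rw [div_eq_iff this]
    push_cast; ring
  have hτ : τ x ^ 2 = x ^ 2 := by rw [← map_pow, hx2]; simp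
  obtain ⟨r, s, t, w, e⟩ := hs x
  have eτ : τ x = r - s * δ + t * β' - w * β := by
    rw [e]; simp [t1, t2, t3]; ring
  rcases sq_eq_sq_iff_eq_or_eq_neg.1 hτ with h1 | h1
  · have : ((0 : ℚ) : K) + ((2 * s : ℚ) : K) * δ + ((t + w : ℚ) : K) * β + ((w - t : ℚ) : K) * β' = 0 := by
      rw [eτ, e] at h1; push_cast; linear_combination -h1
    obtain ⟨-, h2, h3, h4⟩ := h.indep this
    have hs0 : s = 0 := by linarith
    have ht0 : t = 0 := by linarith
    have hw0 : w = 0 := by linarith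
    subst hs0 ht0 hw0
    have : (((d * d' : ℕ) : ℚ) : K) = ((r ^ 2 : ℚ) : K) := by
      push_cast; rw [e] at hx2; push_cast at hx2; rw [← hx2]; ring
    obtain ⟨n, hn⟩ := rat_sq_nat (Rat.cast_injective this)
    exact sqf_eq_of_mul_sq hd hd' hn
  · exfalso
    have : ((2 * r : ℚ) : K) + ((0 : ℚ) : K) * δ + ((t - w : ℚ) : K) * β + ((w + t : ℚ) : K) * β' = 0 := by
      rw [eτ, e] at h1; push_cast; linear_combination h1
    obtain ⟨h2, -, h3, h4⟩ := h.indep this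
    have hs0 : r = 0 := by linarith
    have ht0 : t = 0 := by linarith
    have hw0 : w = 0 := by linarith
    subst hs0 ht0 hw0
    have e3 : (((d * d' : ℕ) : ℚ) : K) = ((s ^ 2 * D : ℚ) : K) := by
      have := h.d2
      push_cast at this ⊢; rw [e] at hx2; push_cast at hx2; rw [← hx2, ← this]; ring
    have e4 : ((d * d' * D : ℕ) : ℚ) = (s * D) ^ 2 := by
      have := Rat.cast_injective e3
      push_cast at this ⊢; rw [this]; ring
    obtain ⟨n, hn⟩ := rat_sq_nat e4
    have g1 : p₀ ∣ n := hp.dvd_of_dvd_pow (hn ▸ hpD.mul_left _)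
    have g2 : p₀ * p₀ ∣ d * d' * D := by rw [hn, sq]; exact mul_dvd_mul g1 g1
    obtain ⟨D', rfl⟩ := hpD
    have g3 : p₀ ∣ d * d' * D' := by
      have : d * d' * (p₀ * D') = p₀ * (d * d' * D') := by ring
      rw [this] at g2
      exact (Nat.mul_dvd_mul_iff_left hp.pos).1 g2
    rcases (hp.dvd_mul).1 g3 with g | g
    · rcases (hp.dvd_mul).1 g with g | g
      · exact hpd g
      · exact hpd' g
    · have := hDs p₀ (mul_dvd_mul_left _ g)
      exact hp.one_lt.ne' (Nat.isUnit_iff.1 this)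

theorem rep_inj {D : ℕ} {b c b' c' : ℤ} (hDs : Squarefree D) (hD : Odd D) (hb : Odd b) (hb0 : 0 < b)
    (h : b ^ 2 + c ^ 2 = D) (hb' : Odd b') (hb0' : 0 < b') (h' : b' ^ 2 + c' ^ 2 = D)
    (hp : ∀ p : ℕ, p.Prime → p ∣ D → (p : ℤ) ∣ b * c' - b' * c) : b = b' ∧ c = c' := by
  have hdvd : (D : ℤ) ∣ b * c' - b' * c := by
    rw [← Int.natAbs_dvd_natAbs, Int.natAbs_natCast]
    rw [← Nat.prod_primeFactors_of_squarefree hDs]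
    refine Finset.prod_primes_dvd _ (fun p hp' => (Nat.prime_of_mem_primeFactors hp').prime) ?_
    intro p hp'
    have := hp p (Nat.prime_of_mem_primeFactors hp') (Nat.dvd_of_mem_primeFactors hp')
    exact Int.natCast_dvd.1 this
  have hD0 : (0 : ℤ) < D := by rw [← h]; positivity
  have e : (b * c' - b' * c) ^ 2 + (b * b' + c * c') ^ 2 = (D : ℤ) ^ 2 := by
    calc _ = (b ^ 2 + c ^ 2) * (b' ^ 2 + c' ^ 2) := by ring
      _ = _ := by rw [h, h']; ring
  have hne : b * b' + c * c' ≠ 0 := by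
    have h1 := even_c h hD hb
    have h2 : Odd (b * b' + c * c') := (hb.mul hb').add_even (h1.mul_right c')
    intro h0; rw [h0] at h2; exact absurd h2 (by decide)
  obtain ⟨k, hk⟩ := hdvd
  have hk0 : k = 0 := by
    by_contra hk0
    have : 1 ≤ k ^ 2 := by have := sq_pos_of_ne_zero hk0; omega
    rw [hk] at e
    have : 0 < (b * b' + c * c') ^ 2 := by positivity
    nlinarith [sq_nonneg (D : ℤ)]
  rw [hk0, mul_zero] at hk
  have e1 : b ^ 2 * (D - b' ^ 2) = b' ^ 2 * (D - b ^ 2) := by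
    rw [← h] ; nth_rewrite 1 [h]; rw [← h']; 
    linear_combination (b * c' + b' * c) * hk
  have e2 : b ^ 2 = b' ^ 2 := by
    apply mul_left_cancel₀ hD0.ne'; linarith
  have e3 : b = b' := by
    rcases sq_eq_sq_iff_eq_or_eq_neg.1 e2 with e | e <;> omega
  refine ⟨e3, ?_⟩
  subst e3
  apply mul_left_cancel₀ hb0.ne'
  linarith

theorem negz {D : ℕ} {b c : ℤ} {a : ℚ} (h : Rel4 K D b c a) : Rel4 K D (-b : ℤ) c a := by
  have := h.negb; push_cast; exact this

theorem negcz {D : ℕ} {b c : ℤ} {a : ℚ} (h : Rel4 K D b c a) : Rel4 K D b (-c : ℤ) a := by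
  have := h.negc; push_cast; exact this

theorem FS_empty {a D p : ℕ} (hDs : Squarefree D) (hD : Odd D) (hp : p.Prime) (hpD : p ∣ D)
    (h4 : p % 4 ≠ 1) : FS a D = ∅ := by
  ext K
  simp only [FS, Set.mem_setOf_eq, Set.mem_empty_iff_false, iff_false]
  rintro ⟨b, c, hb, h⟩
  exact h4 (prime_mod_of_sum h.hD_int hDs hD hp hpD)

theorem not_dvd_c {D p : ℕ} {b c : ℤ} (hDs : Squarefree D) (h : b ^ 2 + c ^ 2 = D) (hp : p.Prime)
    (hpD : p ∣ D) : ¬ (p : ℤ) ∣ c := by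
  intro hc
  have hpz : Prime (p : ℤ) := Nat.prime_iff_prime_int.1 hp
  have hb : (p : ℤ) ∣ b := by
    apply hpz.dvd_of_dvd_pow (n := 2)
    have : b ^ 2 = D - c ^ 2 := by linarith
    rw [this]
    exact dvd_sub (by exact_mod_cast hpD) (dvd_pow hc two_ne_zero)
  have h2 : (p : ℤ) * p ∣ D := by
    rw [← h, sq, sq]; exact dvd_add (mul_dvd_mul hb hb) (mul_dvd_mul hc hc)
  have := hDs p (by exact_mod_cast h2)
  exact hp.one_lt.ne' (Nat.isUnit_iff.1 this)

theorem dich {D p : ℕ} {b c b₀ c₀ : ℤ} (h : b ^ 2 + c ^ 2 = D) (h₀ : b₀ ^ 2 + c₀ ^ 2 = D)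
    (hp : p.Prime) (hpD : p ∣ D) : (p : ℤ) ∣ b * c₀ - b₀ * c ∨ (p : ℤ) ∣ b * c₀ + b₀ * c := by
  have hpz : Prime (p : ℤ) := Nat.prime_iff_prime_int.1 hp
  apply hpz.dvd_or_dvd
  obtain ⟨k, hk⟩ : (p : ℤ) ∣ D := by exact_mod_cast hpD
  refine ⟨k * (b ^ 2 - b₀ ^ 2), ?_⟩
  linear_combination b ^ 2 * h₀ - b₀ ^ 2 * h + (b ^ 2 - b₀ ^ 2) * hk

theorem card_FS {a D : ℕ} (ha : a ≠ 0) (hD1 : 1 < D) (hDs : Squarefree D) (hD : Odd D)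
    (h1 : ∀ p : ℕ, p.Prime → p ∣ D → p % 4 = 1) :
    (FS a D).Finite ∧ 2 * (FS a D).ncard = 2 ^ D.primeFactors.card := by
  classical
  obtain ⟨b₀, c₀, hb₀, h₀⟩ := exists_rep hD hDs.ne_zero h1
  set p₀ := D.minFac with hp₀
  have hp0 : p₀.Prime := Nat.minFac_prime hD1.ne'
  have hpD : p₀ ∣ D := Nat.minFac_dvd D
  have hmem : p₀ ∈ D.primeFactors := Nat.mem_primeFactors.2 ⟨hp0, hpD, hDs.ne_zero⟩
  set S := (D.primeFactors.erase p₀).powerset with hS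
  have hcS : S.card = 2 ^ (D.primeFactors.card - 1) := by
    rw [hS, Finset.card_powerset, Finset.card_erase_of_mem hmem]
  have hcpos : 0 < D.primeFactors.card := Finset.card_pos.2 ⟨_, hmem⟩
  have hpow : 2 * 2 ^ (D.primeFactors.card - 1) = 2 ^ D.primeFactors.card := by
    rw [← pow_succ']; congr 1; omega
  -- upper bound
  have hex : ∀ K ∈ FS a D, ∃ b c : ℤ, Odd b ∧ 0 < b ∧ (p₀ : ℤ) ∣ b * c₀ - b₀ * c ∧ Rel4 K D b c a := by
    rintro K ⟨b, c, hb, h⟩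
    obtain ⟨b, hb, hb0, h⟩ : ∃ b : ℤ, Odd b ∧ 0 < b ∧ Rel4 K D b c a := by
      rcases lt_trichotomy b 0 with h0 | h0 | h0
      · exact ⟨-b, hb.neg, by omega, h.negz⟩
      · subst h0; simp at hb
      · exact ⟨b, hb, h0, h⟩
    rcases dich h.hD_int h₀ hp0 hpD with e | e
    · exact ⟨b, c, hb, hb0, e, h⟩
    · exact ⟨b, -c, hb, hb0, by rw [mul_neg, sub_neg_eq_add]; exact e, h.negcz⟩
  choose! B C hBo hB0 hBp hBr using hex
  let φ : IntermediateField ℚ ℂ → Finset ℕ := fun K =>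
    (D.primeFactors.erase p₀).filter (fun p => (p : ℤ) ∣ B K * c₀ - b₀ * C K)
  have hφS : ∀ K ∈ FS a D, φ K ∈ (S : Set (Finset ℕ)) := by
    intro K _
    simp only [hS, Finset.coe_powerset, Set.mem_preimage, Set.mem_powerset_iff, Finset.coe_subset, φ]
    exact Finset.filter_subset _ _
  have hφi : Set.InjOn φ (FS a D) := by
    intro K hK K' hK' e
    have r := (hBr K hK).hD_int
    have r' := (hBr K' hK').hD_int
    obtain ⟨e1, e2⟩ := rep_inj hDs hD (hBo K hK) (hB0 K hK) r (hBo K' hK') (hB0 K' hK') r' (by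
      intro p hp hpD
      have hpz : Prime (p : ℤ) := Nat.prime_iff_prime_int.1 hp
      have hc := not_dvd_c hDs h₀ hp hpD
      have hiff : (p : ℤ) ∣ B K * c₀ - b₀ * C K ↔ (p : ℤ) ∣ B K' * c₀ - b₀ * C K' := by
        by_cases hpp : p = p₀
        · rw [hpp]; exact ⟨fun _ => hBp K' hK', fun _ => hBp K hK⟩
        · have := congrArg (fun s => p ∈ s) e
          simp only [φ, Finset.mem_filter, Finset.mem_erase, Nat.mem_primeFactors] at this
          have hh : p ≠ p₀ ∧ Nat.Prime p ∧ p ∣ D ∧ D ≠ 0 := ⟨hpp, hp, hpD, hDs.ne_zero⟩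
          simpa [hh] using this
      have : (p : ℤ) ∣ c₀ * (B K * C K' - B K' * C K) := by
        by_cases hd : (p : ℤ) ∣ B K * c₀ - b₀ * C K
        · have hd' := hiff.1 hd
          have : c₀ * (B K * C K' - B K' * C K) = C K' * (B K * c₀ - b₀ * C K)
            - C K * (B K' * c₀ - b₀ * C K') := by ring
          rw [this]; exact dvd_sub (hd.mul_left _) (hd'.mul_left _)
        · have hd' := fun h => hd (hiff.2 h)
          have g := (dich r h₀ hp hpD).resolve_left hd
          have g' := (dich r' h₀ hp hpD).resolve_left hd'
          have : c₀ * (B K * C K' - B K' * C K) = C K' * (B K * c₀ + b₀ * C K)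
            - C K * (B K' * c₀ + b₀ * C K') := by ring
          rw [this]; exact dvd_sub (g.mul_left _) (g'.mul_left _)
      exact (hpz.dvd_or_dvd this).resolve_left hc)
    have q1 := hBr K hK
    have q2 := hBr K' hK'
    rw [← e1, ← e2] at q2
    exact q2.uniq q1
  have hfin : (FS a D).Finite := Set.Finite.of_injOn hφS hφi S.finite_toSet
  have hle : (FS a D).ncard ≤ 2 ^ (D.primeFactors.card - 1) := by
    rw [← hcS, ← Set.ncard_coe_finset]
    exact Set.ncard_le_ncard_of_injOn φ hφS hφi S.finite_toSet
  -- lower bound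
  have nsq : ¬ IsSquare ((D : ℕ) : ℚ) := by
    rw [Rat.isSquare_natCast_iff]
    rintro ⟨n, hn⟩
    have := hDs n ⟨1, by rw [hn]; ring⟩
    rw [Nat.isUnit_iff] at this
    subst this; omega
  have hsub : ∀ s ∈ S, ∀ p ∈ s, p ≠ p₀ ∧ p.Prime ∧ p ∣ D := by
    intro s hs p hp
    have := Finset.mem_powerset.1 hs hp
    rw [Finset.mem_erase, Nat.mem_primeFactors] at this
    exact ⟨this.1, this.2.1, this.2.2.1⟩
  have hdD : ∀ s ∈ S, (∏ p ∈ s, p) ∣ D := by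
    intro s hs
    exact Finset.prod_primes_dvd _ (fun p hp => (hsub s hs p hp).2.1.prime)
      (fun p hp => (hsub s hs p hp).2.2)
  have hKs : ∀ s ∈ S, ∃ K : IntermediateField ℚ ℂ, Rel4 K D b₀ c₀ (a * (∏ p ∈ s, p : ℕ)) ∧ K ∈ FS a D := by
    intro s hs
    have hd0 : (∏ p ∈ s, p) ≠ 0 := fun h0 => by
      have := hdD s hs; rw [h0] at this; exact hDs.ne_zero (Nat.eq_zero_of_zero_dvd this)
    obtain ⟨K, hK⟩ := exists_field (D := D) (b := b₀) (c := c₀) (q := a * (∏ p ∈ s, p : ℕ))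
      (by exact_mod_cast h₀) nsq (mul_ne_zero (by exact_mod_cast ha) (by exact_mod_cast hd0))
    refine ⟨K, hK, ?_⟩
    obtain ⟨b', c', h', hbb⟩ := drop_factor hDs hD _ (hdD s hs) a b₀ c₀ hK
    refine ⟨b', c', ?_, h'⟩
    rw [Int.odd_iff] at hb₀ ⊢; rw [← hb₀]; exact hbb
  choose! κ hκ hκF using hKs
  have hκi : Set.InjOn κ (S : Set (Finset ℕ)) := by
    intro s hs s' hs' e
    have hs1 : s ∈ S := hs
    have hs1' : s' ∈ S := hs'
    have r := hκ s hs1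
    have r' := hκ s' hs1'
    rw [e] at r
    have np : ∀ s ∈ S, ¬ p₀ ∣ ∏ p ∈ s, p := by
      intro s hs hh
      obtain ⟨p, hp, hpp⟩ := (Prime.dvd_finset_prod_iff hp0.prime _).1 hh
      obtain ⟨g1, g2, g3⟩ := hsub s hs p hp
      exact g1 ((Nat.prime_dvd_prime_iff_eq hp0 g2).1 hpp).symm
    have := twist_inj hDs hp0 hpD (hDs.squarefree_of_dvd (hdD s hs1)) (hDs.squarefree_of_dvd (hdD s' hs1'))
      (np s hs1) (np s' hs1') r r'
    have := congrArg Nat.primeFactors this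
    rwa [Nat.primeFactors_prod (fun p hp => (hsub s hs1 p hp).2.1),
      Nat.primeFactors_prod (fun p hp => (hsub s' hs1' p hp).2.1)] at this
  have hge : 2 ^ (D.primeFactors.card - 1) ≤ (FS a D).ncard := by
    rw [← hcS, ← Set.ncard_coe_finset]
    exact Set.ncard_le_ncard_of_injOn κ (fun s hs => hκF s hs) hκi hfin
  exact ⟨hfin, by rw [le_antisymm hle hge, hpow]⟩

end Rel4

/-- admissible `D` -/
def GoodD (a D : ℕ) : Prop := Squarefree D ∧ ∀ p : ℕ, p.Prime → p ∣ D → p % 4 = 1 ∧ ¬ p ∣ a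

open Classical in
/-- the multiplicative weight -/
noncomputable def hW (a D : ℕ) : ℝ := if GoodD a D then 2 ^ D.primeFactors.card else 0

namespace Rel4

theorem GoodD.odd {a D : ℕ} (h : GoodD a D) : Odd D := by
  rw [← Nat.not_even_iff_odd]
  intro he
  have := (h.2 2 Nat.prime_two (even_iff_two_dvd.1 he)).1
  omega

theorem GoodD.cop {a D : ℕ} (h : GoodD a D) : a.Coprime D := by
  apply Nat.coprime_of_dvd
  intro p hp h1 h2
  exact (h.2 p hp h2).2 h1

theorem count {a : ℕ} (ha : Odd a) (has : Squarefree a) {X : ℝ} {N : ℕ} (hN1 : 1 ≤ N)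
    (hN : ∀ D : ℕ, (64 * (a : ℝ) ^ 2 * D ^ 3 ≤ X) ↔ D ≤ N) :
    2 * (Nat.card {K : IntermediateField ℚ ℂ //
                IsC4Quartic K ∧ IsTotallyRealSubfield K ∧ (quartDisc K : ℝ) ≤ X ∧
                padicValInt 2 (quartDisc K) = 6 ∧
                ∀ p : ℕ, p.Prime → p ≠ 2 →
                  (padicValInt p (quartDisc K) = 2 ↔ (p : ℤ) ∣ (a : ℤ))} : ℝ)
      = ∑ D ∈ Finset.Icc 1 N, hW a D - 1 := by
  classical
  let fin : ℕ → Finset (IntermediateField ℚ ℂ) := fun D =>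
    if h : (FS a D).Finite then h.toFinset else ∅
  let G : Finset ℕ := (Finset.Icc 2 N).filter (GoodD a)
  have hG : ∀ D ∈ G, 1 < D ∧ D ≤ N ∧ GoodD a D := by
    intro D hD
    simp only [G, Finset.mem_filter, Finset.mem_Icc] at hD
    exact ⟨by omega, hD.1.2, hD.2⟩
  have hc : ∀ D ∈ G, (FS a D).Finite ∧ 2 * (FS a D).ncard = 2 ^ D.primeFactors.card := by
    intro D hD
    obtain ⟨h1, h2, h3⟩ := hG D hD
    exact card_FS has.ne_zero h1 h3.1 (GoodD.odd h3) (fun p hp hpD => (h3.2 p hp hpD).1)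
  have hfin : ∀ D ∈ G, ∀ K, K ∈ fin D ↔ K ∈ FS a D := by
    intro D hD K
    simp only [fin, dif_pos (hc D hD).1, Set.Finite.mem_toFinset]
  have hset : ∀ K : IntermediateField ℚ ℂ, (IsC4Quartic K ∧ IsTotallyRealSubfield K ∧ (quartDisc K : ℝ) ≤ X ∧
                padicValInt 2 (quartDisc K) = 6 ∧
                ∀ p : ℕ, p.Prime → p ≠ 2 →
                  (padicValInt p (quartDisc K) = 2 ↔ (p : ℤ) ∣ (a : ℤ))) ↔ K ∈ G.biUnion fin := by
    intro K
    constructor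
    · rintro ⟨h1, h2, h3, h4, h5⟩
      obtain ⟨D, b, c, g1, g2, g3, g4, g5, g6⟩ := char_fwd ha has h1 h2 h4 h5
      have hd := g6.disc g2 g3 has ha g4 g5
      rw [hd] at h3
      have hD : D ∈ G := by
        simp only [G, Finset.mem_filter, Finset.mem_Icc]
        refine ⟨⟨g1, (hN D).1 (by push_cast at h3; exact h3)⟩, g2, ?_⟩
        intro p hp hpD
        exact ⟨prime_mod_of_sum g6.hD_int g2 g3 hp hpD,
          fun h => Nat.not_coprime_of_dvd_of_dvd hp.one_lt h hpD g4⟩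
      rw [Finset.mem_biUnion]
      exact ⟨D, hD, (hfin D hD K).2 ⟨b, c, g5, g6⟩⟩
    · intro h
      rw [Finset.mem_biUnion] at h
      obtain ⟨D, hD, h⟩ := h
      rw [hfin D hD] at h
      obtain ⟨b, c, hb, h⟩ := h
      obtain ⟨h1, h2, h3⟩ := hG D hD
      obtain ⟨e1, e2, e3, e4, e5⟩ := char_bwd ha has h3.1 (GoodD.odd h3) (GoodD.cop h3) hb h
      refine ⟨e1, e2, ?_, e4, e5⟩
      rw [e3]
      have := (hN D).2 h2
      push_cast; exact this
  have hcard : Nat.card {K : IntermediateField ℚ ℂ //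
                IsC4Quartic K ∧ IsTotallyRealSubfield K ∧ (quartDisc K : ℝ) ≤ X ∧
                padicValInt 2 (quartDisc K) = 6 ∧
                ∀ p : ℕ, p.Prime → p ≠ 2 →
                  (padicValInt p (quartDisc K) = 2 ↔ (p : ℤ) ∣ (a : ℤ))} = (G.biUnion fin).card := by
    exact Nat.subtype_card _ (fun K => (hset K).symm)
  have hdisj : ∀ D ∈ G, ∀ D' ∈ G, D ≠ D' → Disjoint (fin D) (fin D') := by
    intro D hD D' hD' hne
    rw [Finset.disjoint_left]
    intro K hK hK'
    rw [hfin D hD] at hK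
    rw [hfin D' hD'] at hK'
    obtain ⟨b, c, hb, h⟩ := hK
    obtain ⟨b', c', hb', h'⟩ := hK'
    have h3 := (hG D hD).2.2
    have h3' := (hG D' hD').2.2
    have d1 := h.disc h3.1 (GoodD.odd h3) has ha (GoodD.cop h3) hb
    have d2 := h'.disc h3'.1 (GoodD.odd h3') has ha (GoodD.cop h3') hb'
    rw [d1] at d2
    have a0 : (a : ℤ) ≠ 0 := by exact_mod_cast has.ne_zero
    have := mul_left_cancel₀ (by positivity : (64 * (a : ℤ) ^ 2) ≠ 0) d2
    have : D ^ 3 = D' ^ 3 := by exact_mod_cast this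
    exact hne (Nat.pow_left_injective (by norm_num : (3 : ℕ) ≠ 0) this)
  rw [hcard, Finset.card_biUnion hdisj]
  have hsum : ∑ D ∈ Finset.Icc 1 N, hW a D = 1 + ∑ D ∈ G, (2 : ℝ) ^ D.primeFactors.card := by
    have : Finset.Icc 1 N = insert 1 (Finset.Icc 2 N) := by
      ext x; simp only [Finset.mem_Icc, Finset.mem_insert]; omega
    rw [this, Finset.sum_insert (by simp), Finset.sum_filter]
    congr 1
    have : GoodD a 1 := ⟨squarefree_one, fun p hp h => absurd (Nat.dvd_one.1 h) hp.one_lt.ne'⟩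
    simp [hW, this]
  rw [hsum]
  push_cast
  rw [Finset.mul_sum]
  have : ∀ D ∈ G, 2 * ((fin D).card : ℝ) = 2 ^ D.primeFactors.card := by
    intro D hD
    have h2 := (hc D hD).2
    have : (fin D).card = (FS a D).ncard := by
      rw [Set.ncard_eq_toFinset_card _ (hc D hD).1]
      simp only [fin, dif_pos (hc D hD).1]
    rw [this]
    exact_mod_cast h2
  rw [Finset.sum_congr rfl this]
  ring

end Rel4

namespace An
open Finset Filter Topology

theorem abel {z w : ℕ → ℝ} {B : ℝ} {a : ℕ}
    (hz : ∀ k, |∑ n ∈ Ico a k, z n| ≤ B) (hw : ∀ n, a ≤ n → w (n + 1) ≤ w n)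
    (hw0 : ∀ n, a ≤ n → 0 ≤ w n) (b : ℕ) : |∑ n ∈ Ico a b, z n * w n| ≤ B * w a := by
  have hB : 0 ≤ B := le_trans (abs_nonneg _) (hz a)
  rcases le_total b a with hab | hab
  · rw [Ico_eq_empty_of_le hab]; simp; exact mul_nonneg hB (hw0 a le_rfl)
  have key : |∑ n ∈ Ico a b, z n * w n - (∑ n ∈ Ico a b, z n) * w b| ≤ B * (w a - w b) := by
    induction b, hab using Nat.le_induction with
    | base => simp
    | succ b hb ih =>
      rw [sum_Ico_succ_top hb]
      have e : (∑ n ∈ Ico a b, z n * w n) + z b * w b - (∑ n ∈ Ico a (b + 1), z n) * w (b + 1)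
          = (∑ n ∈ Ico a b, z n * w n - (∑ n ∈ Ico a b, z n) * w b)
            + (∑ n ∈ Ico a (b + 1), z n) * (w b - w (b + 1)) := by
        rw [sum_Ico_succ_top hb]; ring
      rw [e]
      have h1 : |(∑ n ∈ Ico a (b + 1), z n) * (w b - w (b + 1))| ≤ B * (w b - w (b + 1)) := by
        rw [abs_mul, abs_of_nonneg (sub_nonneg.2 (hw b hb))]
        exact mul_le_mul_of_nonneg_right (hz _) (sub_nonneg.2 (hw b hb))
      calc _ ≤ _ := abs_add_le _ _
        _ ≤ B * (w a - w b) + B * (w b - w (b + 1)) := add_le_add ih h1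
        _ = _ := by ring
  have h2 : |(∑ n ∈ Ico a b, z n) * w b| ≤ B * w b := by
    rw [abs_mul, abs_of_nonneg (hw0 b hab)]
    exact mul_le_mul_of_nonneg_right (hz _) (hw0 b hab)
  have h3 := abs_add_le (∑ n ∈ Ico a b, z n * w n - (∑ n ∈ Ico a b, z n) * w b)
    ((∑ n ∈ Ico a b, z n) * w b)
  rw [sub_add_cancel] at h3
  nlinarith

/-- partial sums converge if tails are uniformly small -/
theorem exists_lim_of_tail {u : ℕ → ℝ}
    (h : ∀ ε > 0, ∃ M, ∀ N, |∑ n ∈ Ico M N, u n| ≤ ε) :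
    ∃ l, Tendsto (fun N => ∑ n ∈ range N, u n) atTop (𝓝 l) := by
  apply cauchySeq_tendsto_of_complete
  rw [Metric.cauchySeq_iff']
  intro ε hε
  obtain ⟨M, hM⟩ := h (ε / 2) (by linarith)
  refine ⟨M, fun N hN => ?_⟩
  rw [Real.dist_eq, ← sum_Ico_eq_sub _ hN]
  exact lt_of_le_of_lt (hM N) (by linarith)

theorem abel_series {b : ℕ → ℝ} {S : ℝ} (hb0 : b 0 = 0)
    (hb : Tendsto (fun N => ∑ n ∈ range N, b n) atTop (𝓝 S)) :
    ∃ T : ℝ → ℝ, T 0 = S ∧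
      (∀ δ : ℝ, 0 ≤ δ → Tendsto (fun N => ∑ n ∈ range N, b n * (n : ℝ) ^ (-δ)) atTop (𝓝 (T δ))) ∧
      Tendsto T (𝓝[>] 0) (𝓝 S) := by
  have tail : ∀ ε : ℝ, ε > 0 → ∃ M : ℕ, 1 ≤ M ∧ ∀ δ : ℝ, 0 ≤ δ → ∀ N, |∑ n ∈ Ico M N, b n * (n : ℝ) ^ (-δ)| ≤ ε := by
    intro ε hε
    obtain ⟨M, hM⟩ := Metric.cauchySeq_iff'.1 hb.cauchySeq (ε / 2) (by linarith)
    refine ⟨M + 1, by omega, fun δ hδ N => ?_⟩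
    have hz : ∀ k, |∑ n ∈ Ico (M + 1) k, b n| ≤ ε := by
      intro k
      rcases le_total k (M + 1) with hk | hk
      · rw [Ico_eq_empty_of_le hk]; simp; linarith
      rw [sum_Ico_eq_sub _ hk]
      have h1 := hM k (by omega)
      have h2 := hM (M + 1) (by omega)
      rw [Real.dist_eq] at h1 h2
      have := abs_sub_le (∑ n ∈ range k, b n) (∑ n ∈ range M, b n) (∑ n ∈ range (M + 1), b n)
      rw [abs_sub_comm (∑ n ∈ range M, b n)] at this
      linarith
    have := abel (w := fun n : ℕ => (n : ℝ) ^ (-δ)) hz (fun n hn => by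
      have h0 : (0 : ℝ) < n := by exact_mod_cast (by omega : 0 < n)
      apply Real.rpow_le_rpow_of_nonpos h0 (by push_cast; linarith) (by linarith))
      (fun n hn => by positivity) N
    refine this.trans ?_
    have : ((M + 1 : ℕ) : ℝ) ^ (-δ) ≤ 1 := by
      apply Real.rpow_le_one_of_one_le_of_nonpos _ (by linarith)
      push_cast; linarith [(Nat.cast_nonneg M : (0 : ℝ) ≤ M)]
    nlinarith
  have hex : ∀ δ : ℝ, ∃ l, 0 ≤ δ → Tendsto (fun N => ∑ n ∈ range N, b n * (n : ℝ) ^ (-δ)) atTop (𝓝 l) := by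
    intro δ
    by_cases hδ : 0 ≤ δ
    · obtain ⟨l, hl⟩ := exists_lim_of_tail (u := fun n => b n * (n : ℝ) ^ (-δ)) (by
        intro ε hε
        obtain ⟨M, _, hM⟩ := tail ε hε
        exact ⟨M, hM δ hδ⟩)
      exact ⟨l, fun _ => hl⟩
    · exact ⟨0, fun h => absurd h hδ⟩
  choose T hT using hex
  have hT0 : T 0 = S := by
    refine tendsto_nhds_unique (hT 0 le_rfl) ?_
    simpa using hb
  refine ⟨T, hT0, hT, ?_⟩
  rw [Metric.tendsto_nhdsWithin_nhds]
  intro ε hε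
  obtain ⟨M, hM1, hM⟩ := tail (ε / 4) (by linarith)
  have close : ∀ δ : ℝ, 0 ≤ δ → |T δ - ∑ n ∈ range M, b n * (n : ℝ) ^ (-δ)| ≤ ε / 4 := by
    intro δ hδ
    have h1 : Tendsto (fun N => |∑ n ∈ range N, b n * (n : ℝ) ^ (-δ)
        - ∑ n ∈ range M, b n * (n : ℝ) ^ (-δ)|) atTop
        (𝓝 |T δ - ∑ n ∈ range M, b n * (n : ℝ) ^ (-δ)|) := ((hT δ hδ).sub_const _).abs
    apply le_of_tendsto h1
    filter_upwards [eventually_ge_atTop M] with N hN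
    rw [← sum_Ico_eq_sub _ hN]
    exact hM δ hδ N
  have hc : Tendsto (fun δ : ℝ => ∑ n ∈ range M, b n * (n : ℝ) ^ (-δ)) (𝓝[>] 0)
      (𝓝 (∑ n ∈ range M, b n * (n : ℝ) ^ (-(0 : ℝ)))) := by
    apply tendsto_finsetSum
    intro n _
    rcases Nat.eq_zero_or_pos n with rfl | hn
    · simp [hb0]
    · have h0 : (n : ℝ) ≠ 0 := by positivity
      have : Continuous fun δ : ℝ => b n * (n : ℝ) ^ (-δ) := by
        refine continuous_const.mul ?_
        exact (Real.continuous_const_rpow h0).comp continuous_neg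
      exact (this.tendsto 0).mono_left nhdsWithin_le_nhds
  obtain ⟨d, hd, h⟩ := Metric.tendsto_nhdsWithin_nhds.1 hc (ε / 4) (by linarith)
  refine ⟨d, hd, fun {x} hx hxd => ?_⟩
  have h1 := h hx hxd
  have h2 := close x (le_of_lt hx)
  have h3 := close 0 le_rfl
  rw [hT0] at h3
  rw [Real.dist_eq] at h1 ⊢
  rw [abs_le] at h2 h3
  rw [abs_lt] at h1 ⊢
  constructor <;> linarith

end An

namespace An
open Finset Filter Topology

/-- the quadratic character mod 4 as an arithmetic function -/
noncomputable def chi : ArithmeticFunction ℝ := ⟨fun n => ((ZMod.χ₄ (n : ZMod 4) : ℤ) : ℝ), by simp⟩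

theorem chi_eq (n : ℕ) : chi n = if n % 4 = 1 then 1 else if n % 4 = 3 then -1 else 0 := by
  change ((ZMod.χ₄ (n : ZMod 4) : ℤ) : ℝ) = _
  rw [ZMod.χ₄_nat_eq_if_mod_four]
  have : n % 4 < 4 := Nat.mod_lt _ (by norm_num)
  split_ifs <;> first | omega | simp

theorem chi_mul (m n : ℕ) : chi (m * n) = chi m * chi n := by
  change ((ZMod.χ₄ ((m * n : ℕ) : ZMod 4) : ℤ) : ℝ) =
    ((ZMod.χ₄ (m : ZMod 4) : ℤ) : ℝ) * ((ZMod.χ₄ (n : ZMod 4) : ℤ) : ℝ)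
  push_cast
  rw [map_mul]; push_cast; rfl

theorem chi_one : chi 1 = 1 := by rw [chi_eq]; norm_num

theorem chi_abs_le (n : ℕ) : |chi n| ≤ 1 := by
  rw [chi_eq]; split_ifs <;> simp

theorem chi_range (k : ℕ) : ∑ n ∈ range k, chi n = if k % 4 = 2 ∨ k % 4 = 3 then 1 else 0 := by
  induction k with
  | zero => simp
  | succ k ih =>
    rw [sum_range_succ, ih, chi_eq]
    have : k % 4 < 4 := Nat.mod_lt _ (by norm_num)
    split_ifs <;> first | omega | norm_num

theorem chi_Ico (a k : ℕ) : |∑ n ∈ Ico a k, chi n| ≤ 1 := by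
  rcases le_total k a with h | h
  · rw [Ico_eq_empty_of_le h]; simp
  rw [sum_Ico_eq_sub _ h, chi_range, chi_range]
  split_ifs <;> norm_num

theorem chi_tail {M : ℕ} (hM : 1 ≤ M) (N : ℕ) : |∑ n ∈ Ico M N, chi n / n| ≤ 1 / M := by
  have := abel (w := fun n : ℕ => (1 : ℝ) / n) (chi_Ico M) (fun n hn => by
      have h0 : (0 : ℝ) < n := by exact_mod_cast (by omega : 0 < n)
      apply one_div_le_one_div_of_le h0; push_cast; linarith)
      (fun n hn => by positivity) N
  simpa [div_eq_mul_inv] using this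

theorem exists_L : ∃ L : ℝ, Tendsto (fun N => ∑ n ∈ range N, chi n / n) atTop (𝓝 L) := by
  apply exists_lim_of_tail
  intro ε hε
  obtain ⟨M, hM⟩ := exists_nat_gt (1 / ε)
  have hM0 : (0 : ℝ) < M := lt_trans (by positivity) hM
  refine ⟨M, fun N => (chi_tail (by exact_mod_cast hM0) N).trans ?_⟩
  rw [div_le_iff₀ hM0]
  rw [div_lt_iff₀ hε] at hM
  linarith

/-- `L(1,χ)` -/
noncomputable def L1 : ℝ := exists_L.choose
theorem L1_spec : Tendsto (fun N => ∑ n ∈ range N, chi n / n) atTop (𝓝 L1) := exists_L.choose_spec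

theorem L1_close {M : ℕ} (hM : 1 ≤ M) : |L1 - ∑ n ∈ range M, chi n / n| ≤ 1 / M := by
  apply le_of_tendsto ((L1_spec.sub_const _).abs)
  filter_upwards [eventually_ge_atTop M] with N hN
  rw [← sum_Ico_eq_sub _ hN]
  exact chi_tail hM N

theorem L1_pos : 0 < L1 := by
  have := L1_close (M := 5) (by norm_num)
  simp only [sum_range_succ, chi_eq] at this
  norm_num at this
  rw [abs_le] at this
  linarith [this.1]

theorem Ioc_eq (N : ℕ) : Ioc 0 N = Ico 1 (N + 1) := by ext; simp; omega

theorem sum_Ico_one (u : ℕ → ℝ) (h : u 0 = 0) (N : ℕ) : ∑ n ∈ Ico 1 (N + 1), u n = ∑ n ∈ range (N + 1), u n := by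
  rw [range_eq_Ico, sum_eq_sum_Ico_succ_bot (show 0 < N + 1 by omega), h, zero_add]

open ArithmeticFunction in
theorem R_bound (M : ℕ) : |∑ n ∈ Ioc 0 M, (chi * (zeta : ArithmeticFunction ℝ)) n - L1 * M| ≤ 5 * Real.sqrt M := by
  rcases Nat.eq_zero_or_pos M with rfl | hM
  · simp
  rw [sum_Ioc_mul_zeta_eq_sum, Ioc_eq]
  set q := Nat.sqrt M with hq
  have hq1 : 1 ≤ q := Nat.sqrt_pos.2 hM
  have hqM : q ≤ M := Nat.sqrt_le_self M
  have hlt : (M : ℝ) ≤ (q + 1) ^ 2 := by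
    have := Nat.lt_succ_sqrt M
    have h2 : M ≤ (q + 1) ^ 2 := by rw [pow_two]; exact le_of_lt this
    exact_mod_cast h2
  have hsq : (q : ℝ) ≤ Real.sqrt M := by
    apply Real.le_sqrt_of_sq_le
    exact_mod_cast (by rw [pow_two]; exact Nat.sqrt_le M : q ^ 2 ≤ M)
  have hs1 : (1 : ℝ) ≤ Real.sqrt M := le_trans (by exact_mod_cast hq1) hsq
  rw [← sum_Ico_consecutive _ (by omega : 1 ≤ q + 1) (by omega : q + 1 ≤ M + 1)]
  have h2 : |∑ n ∈ Ico (q + 1) (M + 1), chi n * ((M / n : ℕ) : ℝ)| ≤ q + 1 := by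
    have := abel (w := fun n : ℕ => ((M / n : ℕ) : ℝ)) (chi_Ico (q + 1)) (fun n hn => by
      exact_mod_cast Nat.div_le_div_left (by omega) (by omega)) (fun n hn => by positivity) (M + 1)
    refine this.trans ?_
    rw [one_mul]
    refine (Nat.cast_div_le).trans ?_
    rw [div_le_iff₀ (by positivity)]
    push_cast; nlinarith
  have h1 : |∑ n ∈ Ico 1 (q + 1), chi n * ((M / n : ℕ) : ℝ) - M * ∑ n ∈ Ico 1 (q + 1), chi n / n| ≤ q := by
    rw [mul_sum, ← sum_sub_distrib]
    refine (abs_sum_le_sum_abs _ _).trans ?_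
    calc _ ≤ ∑ n ∈ Ico 1 (q + 1), (1 : ℝ) := by
          apply sum_le_sum
          intro n hn
          have hn0 : 0 < n := by have := (mem_Ico.1 hn).1; omega
          have hn0' : (0 : ℝ) < n := by exact_mod_cast hn0
          have e : chi n * ((M / n : ℕ) : ℝ) - M * (chi n / n) = chi n * (((M / n : ℕ) : ℝ) - M / n) := by ring
          rw [e, abs_mul]
          have f1 : ((M / n : ℕ) : ℝ) ≤ M / n := Nat.cast_div_le
          have f2 : (M : ℝ) / n ≤ (M / n : ℕ) + 1 := by
            rw [div_le_iff₀ hn0']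
            have : M ≤ (M / n + 1) * n := by
              have := Nat.lt_div_mul_add (a := M) hn0
              nlinarith
            exact_mod_cast this
          have f3 : |((M / n : ℕ) : ℝ) - M / n| ≤ 1 := by rw [abs_le]; constructor <;> linarith
          exact mul_le_one₀ (chi_abs_le n) (abs_nonneg _) f3
      _ = q := by simp
  have h3 := L1_close (M := q + 1) (by omega)
  rw [sum_Ico_one (fun n => chi n / n) (by simp)] at h1
  have h4 : |(M : ℝ) * (L1 - ∑ n ∈ range (q + 1), chi n / n)| ≤ q + 1 := by
    rw [abs_mul, abs_of_nonneg (Nat.cast_nonneg M)]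
    refine (mul_le_mul_of_nonneg_left h3 (Nat.cast_nonneg M)).trans ?_
    rw [mul_one_div, div_le_iff₀ (by positivity)]
    push_cast; nlinarith
  rw [abs_le] at h1 h2 h4 ⊢
  constructor <;> nlinarith

end An

namespace An
open Finset Filter Topology

theorem log_sum_bdd (N : ℕ) : |∑ n ∈ Ioc 0 N, chi n * (Real.log n / n)| ≤ 1 := by
  rw [Ioc_eq]
  have h3 : ∀ b, |∑ n ∈ Ico 3 b, chi n * (Real.log n / n)| ≤ 1 := by
    intro b
    have := abel (w := fun n : ℕ => Real.log n / n) (chi_Ico 3) (fun n hn => by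
      have he : Real.exp 1 ≤ 3 := Real.exp_one_lt_three.le
      have h0 : (3 : ℝ) ≤ n := by exact_mod_cast hn
      exact Real.log_div_self_antitoneOn (by simp; linarith) (by simp; linarith) (by push_cast; linarith))
      (fun n hn => div_nonneg (Real.log_natCast_nonneg n) (Nat.cast_nonneg n)) b
    refine this.trans ?_
    rw [one_mul, div_le_one (by norm_num)]
    have := Real.log_le_sub_one_of_pos (show (0 : ℝ) < (3 : ℕ) by norm_num)
    push_cast at *; linarith
  rcases le_total N 2 with h | h
  · interval_cases N <;> simp [sum_Ico_succ_top, chi_eq]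
  · rw [← sum_Ico_consecutive _ (by omega : 1 ≤ 3) (by omega : 3 ≤ N + 1)]
    have e : ∑ n ∈ Ico 1 3, chi n * (Real.log n / n) = 0 := by
      simp [sum_Ico_succ_top, chi_eq]
    rw [e, zero_add]
    exact h3 _

/-- `χ(n)Λ(n)/n` -/
noncomputable def PA : ArithmeticFunction ℝ :=
  ⟨fun n => chi n * ArithmeticFunction.vonMangoldt n / n, by simp⟩
/-- `χ(n)/n` -/
noncomputable def QA : ArithmeticFunction ℝ := ⟨fun n => chi n / n, by simp⟩

theorem PQ (n : ℕ) : (PA * QA) n = chi n * (Real.log n / n) := by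
  rw [ArithmeticFunction.mul_apply, ← ArithmeticFunction.vonMangoldt_sum,
    ← Nat.sum_divisorsAntidiagonal (fun x _ => ArithmeticFunction.vonMangoldt x), sum_div, mul_sum]
  apply sum_congr rfl
  rintro ⟨x, y⟩ hx
  obtain ⟨hxy, hn⟩ := Nat.mem_divisorsAntidiagonal.1 hx
  change chi x * ArithmeticFunction.vonMangoldt x / x * (chi y / y) = _
  simp only at hxy ⊢
  rw [← hxy, chi_mul]
  push_cast
  have hx0 : (x : ℝ) ≠ 0 := by rintro h; simp at h; simp [h] at hxy; omega
  have hy0 : (y : ℝ) ≠ 0 := by rintro h; simp at h; simp [h] at hxy; omega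
  field_simp

theorem PA_bdd : ∃ B : ℝ, ∀ N : ℕ, |∑ n ∈ Ioc 0 N, PA n| ≤ B := by
  refine ⟨(1 + (Real.log 4 + 4)) / L1, fun N => ?_⟩
  have hlog4 : 0 ≤ Real.log 4 := Real.log_nonneg (by norm_num)
  rcases Nat.eq_zero_or_pos N with rfl | hN
  · simp; exact div_nonneg (by linarith) L1_pos.le
  have hN' : (0 : ℝ) < N := by exact_mod_cast hN
  rw [le_div_iff₀ L1_pos]
  have h1 := ArithmeticFunction.sum_Ioc_mul_eq_sum_sum PA QA N
  simp only [PQ] at h1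
  have h2 := log_sum_bdd N
  have h3 : |∑ n ∈ Ioc 0 N, PA n * ∑ m ∈ Ioc 0 (N / n), QA m - (∑ n ∈ Ioc 0 N, PA n) * L1| ≤ Real.log 4 + 4 := by
    rw [sum_mul, ← sum_sub_distrib]
    refine (abs_sum_le_sum_abs _ _).trans ?_
    have hψ : ∑ n ∈ Ioc 0 N, ArithmeticFunction.vonMangoldt n ≤ (Real.log 4 + 4) * N := by
      have := Chebyshev.psi_le_const_mul_self (x := (N : ℝ)) hN'.le
      simpa [Chebyshev.psi] using this
    calc _ ≤ ∑ n ∈ Ioc 0 N, ArithmeticFunction.vonMangoldt n / N := by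
          apply sum_le_sum
          intro n hn
          have hn0 : 0 < n := (mem_Ioc.1 hn).1
          have hn0' : (0 : ℝ) < n := by exact_mod_cast hn0
          rw [← mul_sub, abs_mul]
          have c := L1_close (M := N / n + 1) (Nat.succ_pos _)
          have e : ∑ m ∈ Ioc 0 (N / n), QA m = ∑ m ∈ range (N / n + 1), chi m / m := by
            rw [Ioc_eq]; exact sum_Ico_one (fun n => chi n / n) (by simp) _
          rw [abs_sub_comm, ← e] at c
          have c2 : (1 : ℝ) / ((N / n + 1 : ℕ) : ℝ) ≤ n / N := by
            rw [div_le_div_iff₀ (by positivity) hN']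
            have : N ≤ n * (N / n + 1) := by
              have := Nat.lt_div_mul_add (a := N) hn0
              nlinarith
            rw [one_mul]
            exact_mod_cast this
          have c3 : |PA n| ≤ ArithmeticFunction.vonMangoldt n / n := by
            change |chi n * ArithmeticFunction.vonMangoldt n / n| ≤ _
            rw [abs_div, abs_mul, abs_of_pos hn0', abs_of_nonneg ArithmeticFunction.vonMangoldt_nonneg]
            gcongr
            exact mul_le_of_le_one_left ArithmeticFunction.vonMangoldt_nonneg (chi_abs_le n)
          calc _ ≤ ArithmeticFunction.vonMangoldt n / n * (n / N) :=
                mul_le_mul c3 (c.trans c2) (abs_nonneg _) (div_nonneg ArithmeticFunction.vonMangoldt_nonneg hn0'.le)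
            _ = _ := by field_simp
      _ ≤ _ := by
          rw [← sum_div, div_le_iff₀ hN']; exact hψ
  rw [← h1] at h3
  have : |∑ n ∈ Ioc 0 N, PA n| * L1 = |(∑ n ∈ Ioc 0 N, PA n) * L1| := by
    rw [abs_mul, abs_of_pos L1_pos]
  rw [this]
  rw [abs_le] at h2 h3 ⊢
  constructor <;> linarith

theorem prime_log_bdd : ∃ B : ℝ, ∀ N : ℕ,
    |∑ n ∈ range N, (if n.Prime then chi n * Real.log n / n else 0)| ≤ B := by
  obtain ⟨B, hB⟩ := PA_bdd
  have hs := ArithmeticFunction.vonMangoldt.summable_residueClass_non_primes_div (q := 1) (0 : ZMod 1)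
  set u : ℕ → ℝ := fun n : ℕ ↦ (if n.Prime then 0 else ArithmeticFunction.vonMangoldt.residueClass (0 : ZMod 1) n) / n with hu
  have hu' : ∀ n, u n = (if n.Prime then 0 else ArithmeticFunction.vonMangoldt n) / n := by
    intro n
    simp only [hu, ArithmeticFunction.vonMangoldt.residueClass]
    congr
    simp [Set.indicator, Subsingleton.elim _ (0 : ZMod 1)]
  have hu0 : ∀ n, 0 ≤ u n := by
    intro n; rw [hu']; split_ifs
    · simp
    · exact div_nonneg ArithmeticFunction.vonMangoldt_nonneg (Nat.cast_nonneg n)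
  refine ⟨B + ∑' n, u n, fun N => ?_⟩
  have h1 : |∑ n ∈ range N, PA n| ≤ B := by
    cases N with
    | zero => simpa using hB 0
    | succ N => rw [← sum_Ico_one (fun n => PA n) (by simp), ← Ioc_eq]; exact hB N
  have h2 : |∑ n ∈ range N, PA n - ∑ n ∈ range N, (if n.Prime then chi n * Real.log n / n else 0)| ≤ ∑' n, u n := by
    rw [← sum_sub_distrib]
    refine (abs_sum_le_sum_abs _ _).trans ?_
    refine le_trans (sum_le_sum fun n _ => ?_) (hs.sum_le_tsum (range N) (fun n _ => hu0 n))
    rw [hu']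
    change |chi n * ArithmeticFunction.vonMangoldt n / n - _| ≤ _
    split_ifs with hp
    · rw [ArithmeticFunction.vonMangoldt_apply_prime hp]; simp
    · rw [sub_zero, abs_div, abs_mul, abs_of_nonneg (ArithmeticFunction.vonMangoldt_nonneg), Nat.abs_cast]
      gcongr
      exact mul_le_of_le_one_left ArithmeticFunction.vonMangoldt_nonneg (chi_abs_le n)
  rw [abs_le] at *
  constructor <;> linarith

theorem prime_chi_conv : ∃ S : ℝ, Tendsto (fun N => ∑ n ∈ range N, (if n.Prime then chi n / n else 0)) atTop (𝓝 S) := by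
  obtain ⟨B, hB⟩ := prime_log_bdd
  have hB0 : 0 ≤ B := le_trans (abs_nonneg _) (hB 0)
  apply exists_lim_of_tail
  intro ε hε
  obtain ⟨M, hM⟩ := exists_nat_gt (Real.exp (2 * B / ε))
  refine ⟨M + 2, fun N => ?_⟩
  have hz : ∀ k, |∑ n ∈ Ico (M + 2) k, (if n.Prime then chi n * Real.log n / n else 0)| ≤ 2 * B := by
    intro k
    rcases le_total k (M + 2) with h | h
    · rw [Ico_eq_empty_of_le h]; simp; linarith
    rw [sum_Ico_eq_sub _ h]
    have a1 := hB k
    have a2 := hB (M + 2)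
    rw [abs_le] at *
    constructor <;> linarith
  have := abel (w := fun n : ℕ => 1 / Real.log n) hz (fun n hn => by
      have h0 : (2 : ℝ) ≤ n := by exact_mod_cast (by omega : 2 ≤ n)
      apply one_div_le_one_div_of_le (Real.log_pos (by linarith))
      apply Real.log_le_log (by linarith); push_cast; linarith)
      (fun n hn => by have := Real.log_natCast_nonneg n; positivity) N
  have e : ∀ n ∈ Ico (M + 2) N, (if n.Prime then chi n / n else 0 : ℝ) = (if n.Prime then chi n * Real.log n / n else 0) * (1 / Real.log n) := by
    intro n hn
    have h0 : (2 : ℝ) ≤ n := by exact_mod_cast (by have := (mem_Ico.1 hn).1; omega : 2 ≤ n)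
    have := (Real.log_pos (show (1 : ℝ) < n by linarith)).ne'
    split_ifs
    · field_simp
    · simp
  rw [sum_congr rfl e]
  refine this.trans ?_
  have h0 : (0 : ℝ) ≤ M := Nat.cast_nonneg M
  have hlog : 2 * B / ε ≤ Real.log ((M + 2 : ℕ) : ℝ) := by
    rw [Real.le_log_iff_exp_le (by positivity)]
    push_cast; linarith
  have hpos : 0 < Real.log ((M + 2 : ℕ) : ℝ) := Real.log_pos (by push_cast; linarith)
  rw [mul_one_div, div_le_iff₀ hpos]
  rw [div_le_iff₀ hε] at hlog
  linarith

end An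

namespace An
open Finset Filter Topology

theorem hW_zero (a : ℕ) : hW a 0 = 0 := by
  unfold hW
  rw [if_neg]
  rintro ⟨h, -⟩
  exact not_squarefree_zero h

theorem hW_nonneg (a n : ℕ) : 0 ≤ hW a n := by
  unfold hW; split_ifs <;> positivity

/-- the weight as an arithmetic function -/
noncomputable def hA (a : ℕ) : ArithmeticFunction ℝ := ⟨hW a, hW_zero a⟩

theorem hA_apply (a n : ℕ) : hA a n = hW a n := rfl

theorem GoodD_mul {a m n : ℕ} (h : m.Coprime n) : GoodD a (m * n) ↔ GoodD a m ∧ GoodD a n := by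
  unfold GoodD
  rw [Nat.squarefree_mul h]
  constructor
  · rintro ⟨⟨h1, h2⟩, h3⟩
    exact ⟨⟨h1, fun p hp hd => h3 p hp (hd.mul_right n)⟩, h2, fun p hp hd => h3 p hp (hd.mul_left m)⟩
  · rintro ⟨⟨h1, h2⟩, h3, h4⟩
    refine ⟨⟨h1, h3⟩, fun p hp hd => ?_⟩
    rcases hp.dvd_mul.1 hd with h | h
    · exact h2 p hp h
    · exact h4 p hp h

theorem hA_mult (a : ℕ) : (hA a).IsMultiplicative := by
  constructor
  · rw [hA_apply]; unfold hW; rw [if_pos]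
    · simp
    · refine ⟨squarefree_one, fun p hp hd => ?_⟩
      exact absurd (Nat.dvd_one.1 hd) hp.ne_one
  · intro m n h
    simp only [hA_apply]; unfold hW
    have e := GoodD_mul (a := a) h
    rw [h.primeFactors_mul, card_union_of_disjoint h.disjoint_primeFactors, pow_add]
    by_cases h1 : GoodD a m <;> by_cases h2 : GoodD a n <;> simp [e, h1, h2]

open Classical in
theorem hW_prime {a p : ℕ} (hp : p.Prime) : hW a p = if p % 4 = 1 ∧ ¬ p ∣ a then 2 else 0 := by
  unfold hW
  have : GoodD a p ↔ p % 4 = 1 ∧ ¬ p ∣ a := by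
    constructor
    · intro h; exact h.2 p hp dvd_rfl
    · intro h; refine ⟨hp.squarefree, fun q hq hd => ?_⟩
      rw [(Nat.prime_dvd_prime_iff_eq hq hp).1 hd]; exact h
  simp [this, hp.primeFactors]

theorem hW_prime_pow {a p k : ℕ} (hp : p.Prime) (hk : 2 ≤ k) : hW a (p ^ k) = 0 := by
  unfold hW
  rw [if_neg]
  rintro ⟨h, -⟩
  have := (Nat.squarefree_pow_iff hp.ne_one (by omega)).1 h
  omega

/-- `μ` over the reals -/
noncomputable def muR : ArithmeticFunction ℝ := ((ArithmeticFunction.moebius : ArithmeticFunction ℤ) : ArithmeticFunction ℝ)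

/-- `μ χ` -/
noncomputable def muchi : ArithmeticFunction ℝ := chi.pmul muR

/-- the correction `g` -/
noncomputable def gA (a : ℕ) : ArithmeticFunction ℝ := muchi * (muR * hA a)

open ArithmeticFunction in
theorem muR_zeta : muR * (zeta : ArithmeticFunction ℝ) = 1 := by
  unfold muR
  exact coe_moebius_mul_coe_zeta

theorem muchi_chi : muchi * chi = 1 := by
  ext n
  have h := congrArg (fun f => f n) muR_zeta
  simp only [ArithmeticFunction.mul_apply] at h ⊢
  have : ∀ x ∈ n.divisorsAntidiagonal, muchi x.1 * chi x.2 =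
      chi n * (muR x.1 * ((ArithmeticFunction.zeta : ArithmeticFunction ℕ) : ArithmeticFunction ℝ) x.2) := by
    intro x hx
    obtain ⟨hxy, hn⟩ := Nat.mem_divisorsAntidiagonal.1 hx
    have h2 : x.2 ≠ 0 := by rintro h; simp [h] at hxy; omega
    rw [← hxy, chi_mul]
    simp [muchi, h2]; ring
  rw [sum_congr rfl this, ← mul_sum, h]
  by_cases hn : n = 1
  · subst hn; simp [chi_one]
  · simp [ArithmeticFunction.one_apply_ne hn]

open ArithmeticFunction in
theorem gA_conv (a : ℕ) : gA a * (chi * (zeta : ArithmeticFunction ℝ)) = hA a := by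
  unfold gA
  calc _ = (muchi * chi) * ((muR * (zeta : ArithmeticFunction ℝ)) * hA a) := by ring
    _ = hA a := by rw [muchi_chi, muR_zeta, one_mul, one_mul]

theorem muR_mult : muR.IsMultiplicative := ArithmeticFunction.isMultiplicative_moebius.intCast

theorem chi_mult : chi.IsMultiplicative := ⟨chi_one, fun {m n} _ => chi_mul m n⟩

theorem gA_mult (a : ℕ) : (gA a).IsMultiplicative :=
  (chi_mult.pmul muR_mult).mul (muR_mult.mul (hA_mult a))

theorem conv_pow {f g : ArithmeticFunction ℝ} {p : ℕ} (hp : p.Prime) (h1 : f 1 = 1)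
    (h2 : ∀ k, 2 ≤ k → f (p ^ k) = 0) (k : ℕ) :
    (f * g) (p ^ (k + 1)) = g (p ^ (k + 1)) + f p * g (p ^ k) := by
  rw [ArithmeticFunction.mul_apply, Nat.sum_divisorsAntidiagonal (fun x y => f x * g y),
    Nat.divisors_prime_pow hp, sum_map, sum_range_succ', sum_range_succ']
  have : ∑ i ∈ range k, f (p ^ (i + 1 + 1)) * g (p ^ (k + 1) / p ^ (i + 1 + 1)) = 0 :=
    sum_eq_zero fun i _ => by rw [h2 _ (by omega), zero_mul]
  simp only [Function.Embedding.coeFn_mk]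
  rw [this]
  have e : p ^ (k + 1) / p = p ^ k := by rw [pow_succ, Nat.mul_div_cancel _ hp.pos]
  simp [h1, e]
  ring

theorem muR_prime {p : ℕ} (hp : p.Prime) : muR p = -1 := by
  simp [muR, ArithmeticFunction.moebius_apply_prime hp]

theorem muR_pow {p : ℕ} (hp : p.Prime) (k : ℕ) (hk : 2 ≤ k) : muR (p ^ k) = 0 := by
  have := ArithmeticFunction.moebius_apply_prime_pow hp (k := k) (by omega)
  simp [muR, this]; omega

theorem u_pow {a p : ℕ} (hp : p.Prime) (k : ℕ) :
    (muR * hA a) (p ^ (k + 1)) = hW a (p ^ (k + 1)) - hW a (p ^ k) := by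
  rw [conv_pow hp muR_mult.1 (muR_pow hp), muR_prime hp]
  simp only [hA_apply]; ring

theorem g_pow {a p : ℕ} (hp : p.Prime) (k : ℕ) :
    gA a (p ^ (k + 1)) = (muR * hA a) (p ^ (k + 1)) - chi p * (muR * hA a) (p ^ k) := by
  unfold gA
  rw [conv_pow hp (show muchi 1 = 1 from (chi_mult.pmul muR_mult).1) (fun k hk => by simp [muchi, muR_pow hp k hk])]
  simp [muchi, muR_prime hp]; ring

theorem g_one (a : ℕ) : gA a 1 = 1 := (gA_mult a).1

theorem u_one (a : ℕ) : (muR * hA a) 1 = 1 := (muR_mult.mul (hA_mult a)).1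
theorem hW_one (a : ℕ) : hW a 1 = 1 := (hA_mult a).1

theorem g_p {a p : ℕ} (hp : p.Prime) : gA a p = hW a p - 1 - chi p := by
  have := g_pow (a := a) hp 0
  have h2 := u_pow (a := a) hp 0
  simp only [zero_add, pow_one, pow_zero, u_one, hW_one] at this h2
  rw [this, h2]; ring

theorem g_p2 {a p : ℕ} (hp : p.Prime) : gA a (p ^ 2) = - hW a p - chi p * (hW a p - 1) := by
  have := g_pow (a := a) hp 1
  have h2 := u_pow (a := a) hp 0
  have h3 := u_pow (a := a) hp 1
  have h4 := hW_prime_pow (a := a) hp (le_refl 2)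
  simp only [zero_add, pow_one, pow_zero, hW_one, Nat.reduceAdd] at this h2 h3
  rw [this, h3, h2, h4]; ring

theorem g_p3 {a p : ℕ} (hp : p.Prime) : gA a (p ^ 3) = chi p * hW a p := by
  have := g_pow (a := a) hp 2
  have h2 := u_pow (a := a) hp 1
  have h3 := u_pow (a := a) hp 2
  have h4 := hW_prime_pow (a := a) hp (le_refl 2)
  have h5 := hW_prime_pow (a := a) hp (show 2 ≤ 3 by norm_num)
  simp only [pow_one, Nat.reduceAdd] at this h2 h3
  rw [this, h3, h2, h4, h5]; ring

theorem g_p4 {a p : ℕ} (hp : p.Prime) (k : ℕ) : gA a (p ^ (k + 4)) = 0 := by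
  rw [show k + 4 = (k + 3) + 1 by ring, g_pow hp, u_pow hp, show k + 3 = (k + 2) + 1 by ring, u_pow hp,
    hW_prime_pow hp (by omega), hW_prime_pow hp (by omega), hW_prime_pow hp (by omega)]
  ring

theorem hW_sub_one {a p : ℕ} (hp : p.Prime) (h2 : p ≠ 2) (ha : ¬ p ∣ a) : hW a p - 1 = chi p := by
  rw [hW_prime hp, chi_eq]
  have := hp.eq_two_or_odd
  split_ifs <;> first | omega | norm_num

theorem hW_prime_le {a p : ℕ} (hp : p.Prime) : hW a p ≤ 2 := by
  rw [hW_prime hp]; split_ifs <;> norm_num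

end An

namespace An
open Finset Filter Topology

/-- `|g(n)| n^{-3/4}` -/
noncomputable def vA (a n : ℕ) : ℝ := |gA a n| * (n : ℝ) ^ (-(3 / 4) : ℝ)

theorem vA_nonneg (a n : ℕ) : 0 ≤ vA a n := by unfold vA; positivity

theorem vA_mul (a : ℕ) {m n : ℕ} (h : m.Coprime n) : vA a (m * n) = vA a m * vA a n := by
  unfold vA
  rw [(gA_mult a).2 h, abs_mul]; push_cast
  rw [Real.mul_rpow (by positivity) (by positivity)]; ring

theorem vA_one (a : ℕ) : vA a 1 = 1 := by simp [vA, g_one]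

theorem vA_p {a p : ℕ} (hp : p.Prime) : vA a p ≤ if p ∣ 2 * a then 2 else 0 := by
  unfold vA
  have h1 : (p : ℝ) ^ (-(3 / 4) : ℝ) ≤ 1 :=
    Real.rpow_le_one_of_one_le_of_nonpos (by exact_mod_cast hp.one_le) (by norm_num)
  have h0 : 0 ≤ (p : ℝ) ^ (-(3 / 4) : ℝ) := by positivity
  rw [g_p hp]
  split_ifs with h
  · have : |hW a p - 1 - chi p| ≤ 2 := by
      have := hW_nonneg a p
      have := hW_prime_le (a := a) hp
      have h3 := chi_abs_le p
      rw [hW_prime hp, chi_eq]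
      split_ifs <;> first | omega | norm_num
    nlinarith
  · have h2 : p ≠ 2 := by rintro rfl; exact h (dvd_mul_right 2 a)
    have h3 : ¬ p ∣ a := fun h' => h (h'.mul_left 2)
    rw [hW_sub_one hp h2 h3]; simp

theorem vA_p2 {a p : ℕ} (hp : p.Prime) : vA a (p ^ 2) ≤ 4 * (p : ℝ) ^ (-(3 / 2) : ℝ) := by
  unfold vA
  have e : ((p ^ 2 : ℕ) : ℝ) ^ (-(3 / 4) : ℝ) = (p : ℝ) ^ (-(3 / 2) : ℝ) := by
    push_cast
    rw [← Real.rpow_natCast, ← Real.rpow_mul (by positivity)]; norm_num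
  rw [e, g_p2 hp]
  gcongr
  have h1 := hW_nonneg a p
  have h2 := hW_prime_le (a := a) hp
  have h3 := chi_abs_le p
  rw [abs_le] at *
  constructor <;> nlinarith

theorem vA_p3 {a p : ℕ} (hp : p.Prime) : vA a (p ^ 3) ≤ 2 * (p : ℝ) ^ (-(3 / 2) : ℝ) := by
  unfold vA
  have e : ((p ^ 3 : ℕ) : ℝ) ^ (-(3 / 4) : ℝ) ≤ (p : ℝ) ^ (-(3 / 2) : ℝ) := by
    push_cast
    rw [← Real.rpow_natCast, ← Real.rpow_mul (by positivity)]
    apply Real.rpow_le_rpow_of_exponent_le (by exact_mod_cast hp.one_le)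
    norm_num
  have h1 := hW_nonneg a p
  have h2 := hW_prime_le (a := a) hp
  have h3 := chi_abs_le p
  have : |gA a (p ^ 3)| ≤ 2 := by
    rw [g_p3 hp, abs_mul, abs_of_nonneg h1]
    nlinarith [abs_nonneg (chi p)]
  exact mul_le_mul this e (by positivity) (by norm_num)

theorem vA_hasSum (a : ℕ) {p : ℕ} (hp : p.Prime) :
    HasSum (fun k => vA a (p ^ k)) (∑ k ∈ range 4, vA a (p ^ k)) := by
  apply hasSum_sum_of_ne_finset_zero
  intro k hk
  simp at hk
  obtain ⟨j, rfl⟩ := Nat.exists_eq_add_of_le' hk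
  simp [vA, g_p4 hp]

theorem vA_summable {a : ℕ} (ha : a ≠ 0) : Summable (vA a) := by
  set x : ℕ → ℝ := fun n => (if n ∣ 2 * a then 2 else 0) + 6 * (n : ℝ) ^ (-(3 / 2) : ℝ) with hx
  have hx0 : ∀ n, 0 ≤ x n := by
    intro n; simp only [hx]; split_ifs <;> positivity
  have hxs : Summable x := by
    apply Summable.add
    · apply summable_of_ne_finset_zero (s := (2 * a).divisors)
      intro n hn
      rw [if_neg]
      intro h
      exact hn (Nat.mem_divisors.2 ⟨h, by omega⟩)
    · exact (Real.summable_nat_rpow.2 (by norm_num)).mul_left 6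
  have hsum : ∀ {p : ℕ}, p.Prime → Summable (fun n : ℕ ↦ ‖vA a (p ^ n)‖) := by
    intro p hp
    simp only [Real.norm_eq_abs, abs_of_nonneg (vA_nonneg _ _)]
    exact (vA_hasSum a hp).summable
  apply summable_of_sum_range_le (c := Real.exp (∑' n, x n)) (vA_nonneg a)
  intro N
  have H := (EulerProduct.summable_and_hasSum_smoothNumbers_prod_primesBelow_tsum (f := vA a)
    (vA_one a) (fun {m n} h => vA_mul a h) hsum N).2
  have H' := (hasSum_subtype_iff_indicator (f := vA a) (s := N.smoothNumbers)).1 H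
  have h1 : ∑ n ∈ range N, vA a n ≤ ∏ p ∈ N.primesBelow, ∑' n : ℕ, vA a (p ^ n) := by
    have := sum_le_hasSum (range N) (fun n _ => by
      simp only [Set.indicator]; split_ifs
      · exact vA_nonneg a n
      · exact le_rfl) H'
    refine le_trans (le_of_eq (sum_congr rfl fun n hn => ?_)) this
    rcases Nat.eq_zero_or_pos n with rfl | h0
    · simp [Set.indicator, vA]
    · rw [Set.indicator_of_mem]
      exact Nat.mem_smoothNumbers_of_lt h0 (mem_range.1 hn)
  refine h1.trans ?_
  calc _ ≤ ∏ p ∈ N.primesBelow, Real.exp (x p) := by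
        apply Finset.prod_le_prod
        · intro p hp; exact tsum_nonneg fun n => vA_nonneg _ _
        · intro p hp
          have hp' := Nat.prime_of_mem_primesBelow hp
          rw [(vA_hasSum a hp').tsum_eq]
          simp only [sum_range_succ, range_zero, sum_empty, zero_add, pow_zero, pow_one, vA_one]
          have e1 := vA_p (a := a) hp'
          have e2 := vA_p2 (a := a) hp'
          have e3 := vA_p3 (a := a) hp'
          have e4 := Real.add_one_le_exp (x p)
          have : x p = (if p ∣ 2 * a then 2 else 0) + 6 * (p : ℝ) ^ (-(3 / 2) : ℝ) := rfl
          linarith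
    _ = Real.exp (∑ p ∈ N.primesBelow, x p) := (Real.exp_sum _ _).symm
    _ ≤ _ := Real.exp_le_exp.2 (hxs.sum_le_tsum _ fun n _ => hx0 n)

theorem sum_h {a : ℕ} (ha : a ≠ 0) : ∃ c K : ℝ, ∀ N : ℕ,
    |∑ n ∈ Ioc 0 N, hW a n - c * N| ≤ K * (N : ℝ) ^ (3 / 4 : ℝ) := by
  have hv := vA_summable ha
  have hgd : ∀ d : ℕ, 1 ≤ d → |gA a d / d| ≤ vA a d := by
    intro d hd
    have hd' : (1 : ℝ) ≤ d := by exact_mod_cast hd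
    unfold vA
    rw [abs_div, Nat.abs_cast, div_eq_mul_inv, ← Real.rpow_neg_one]
    gcongr
    norm_num
  have hgs : Summable (fun d : ℕ => gA a d / d) := by
    apply Summable.of_norm_bounded hv
    intro d
    rcases Nat.eq_zero_or_pos d with rfl | h
    · simp [vA]
    · exact hgd d h
  refine ⟨L1 * ∑' d : ℕ, gA a d / d, (5 + L1 + L1) * ∑' d, vA a d, fun N => ?_⟩
  rcases Nat.eq_zero_or_pos N with rfl | hN
  · simp
  have hN' : (0 : ℝ) < N := by exact_mod_cast hN
  have hL := L1_pos
  set G := ∑' d, vA a d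
  have h1 : ∑ n ∈ Ioc 0 N, hW a n = ∑ d ∈ Ioc 0 N, gA a d *
      ∑ m ∈ Ioc 0 (N / d), (chi * ((ArithmeticFunction.zeta : ArithmeticFunction ℕ) : ArithmeticFunction ℝ)) m := by
    rw [← ArithmeticFunction.sum_Ioc_mul_eq_sum_sum, gA_conv]; rfl
  have h2 : |∑ n ∈ Ioc 0 N, hW a n - L1 * N * ∑ d ∈ Ioc 0 N, gA a d / d| ≤ (5 + L1) * (G * (N : ℝ) ^ (3 / 4 : ℝ)) := by
    rw [h1, mul_sum, ← sum_sub_distrib]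
    refine (abs_sum_le_sum_abs _ _).trans ?_
    calc _ ≤ ∑ d ∈ Ioc 0 N, (5 + L1) * (vA a d * (N : ℝ) ^ (3 / 4 : ℝ)) := by
          apply sum_le_sum
          intro d hd
          obtain ⟨hd0, hdN⟩ := mem_Ioc.1 hd
          have hd0' : (0 : ℝ) < d := by exact_mod_cast hd0
          have hdN' : (d : ℝ) ≤ N := by exact_mod_cast hdN
          have hr := R_bound (N / d)
          have f1 : ((N / d : ℕ) : ℝ) ≤ N / d := Nat.cast_div_le
          have f2 : (N : ℝ) / d ≤ (N / d : ℕ) + 1 := by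
            rw [div_le_iff₀ hd0']
            have : N ≤ (N / d + 1) * d := by
              have := Nat.lt_div_mul_add (a := N) hd0
              nlinarith
            exact_mod_cast this
          have hq : (1 : ℝ) ≤ N / d := by rw [le_div_iff₀ hd0']; linarith
          have hpw : Real.sqrt ((N / d : ℕ) : ℝ) ≤ (N / d : ℝ) ^ (3 / 4 : ℝ) := by
            refine (Real.sqrt_le_sqrt f1).trans ?_
            rw [Real.sqrt_eq_rpow]
            exact Real.rpow_le_rpow_of_exponent_le hq (by norm_num)
          have hpw1 : 1 ≤ (N / d : ℝ) ^ (3 / 4 : ℝ) := Real.one_le_rpow hq (by norm_num)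
          have e : ∀ R : ℝ, gA a d * R - L1 * N * (gA a d / d) = gA a d * (R - L1 * (N / d)) := by
            intro R; ring
          rw [e, abs_mul]
          have e2 : vA a d * (N : ℝ) ^ (3 / 4 : ℝ) = |gA a d| * (N / d : ℝ) ^ (3 / 4 : ℝ) := by
            unfold vA
            rw [Real.div_rpow hN'.le hd0'.le, Real.rpow_neg hd0'.le]; ring
          rw [e2]
          have : ∀ R : ℝ, |R - L1 * ((N / d : ℕ) : ℝ)| ≤ 5 * Real.sqrt ((N / d : ℕ) : ℝ) →
              |R - L1 * (N / d)| ≤ (5 + L1) * (N / d : ℝ) ^ (3 / 4 : ℝ) := by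
            intro R hR
            rw [abs_le] at *
            constructor <;> nlinarith
          calc _ ≤ |gA a d| * ((5 + L1) * (N / d : ℝ) ^ (3 / 4 : ℝ)) :=
                mul_le_mul_of_nonneg_left (this _ hr) (abs_nonneg _)
            _ = _ := by ring
      _ ≤ _ := by
          rw [← mul_sum, ← sum_mul]
          gcongr
          exact hv.sum_le_tsum _ fun n _ => vA_nonneg a n
  have h3 : |∑' d : ℕ, gA a d / d - ∑ d ∈ Ioc 0 N, gA a d / d| * N ≤ G * (N : ℝ) ^ (3 / 4 : ℝ) := by
    have e : ∑ d ∈ Ioc 0 N, gA a d / d = ∑ d ∈ range (N + 1), gA a d / d := by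
      rw [Ioc_eq]; exact sum_Ico_one (fun d => gA a d / d) (by simp) N
    rw [e, ← hgs.sum_add_tsum_nat_add (N + 1), add_sub_cancel_left]
    have hs1 : Summable (fun i => vA a (i + (N + 1))) := (summable_nat_add_iff (N + 1)).2 hv
    have hN4 : (N : ℝ) = (N : ℝ) ^ (3 / 4 : ℝ) * (N : ℝ) ^ (1 / 4 : ℝ) := by
      rw [← Real.rpow_add hN']; norm_num
    have hb : ∀ i : ℕ, ‖gA a (i + (N + 1)) / ((i + (N + 1) : ℕ) : ℝ)‖ ≤ vA a (i + (N + 1)) * ((N : ℝ) ^ (1 / 4 : ℝ))⁻¹ := by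
      intro i
      set m := i + (N + 1) with hm
      have hm0 : (0 : ℝ) < m := by exact_mod_cast (by omega : 0 < m)
      have hmN : (N : ℝ) ≤ m := by exact_mod_cast (by omega : N ≤ m)
      rw [Real.norm_eq_abs, abs_div, Nat.abs_cast]
      unfold vA
      have e1 : (m : ℝ)⁻¹ = (m : ℝ) ^ (-(3 / 4) : ℝ) * ((m : ℝ) ^ (1 / 4 : ℝ))⁻¹ := by
        rw [← Real.rpow_neg hm0.le, ← Real.rpow_add hm0, ← Real.rpow_neg_one]; norm_num
      rw [div_eq_mul_inv, e1, ← mul_assoc]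
      gcongr
    have hle := tsum_of_norm_bounded ((hs1.mul_right _).hasSum) hb
    rw [Real.norm_eq_abs, tsum_mul_right] at hle
    have hle2 : ∑' i, vA a (i + (N + 1)) ≤ G := by
      have := hv.sum_add_tsum_nat_add (N + 1)
      have h0 : 0 ≤ ∑ i ∈ range (N + 1), vA a i := sum_nonneg fun i _ => vA_nonneg a i
      linarith
    calc _ ≤ (G * ((N : ℝ) ^ (1 / 4 : ℝ))⁻¹) * N := by
          apply mul_le_mul_of_nonneg_right _ hN'.le
          exact hle.trans (mul_le_mul_of_nonneg_right hle2 (by positivity))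
      _ = G * (N : ℝ) ^ (3 / 4 : ℝ) := by
          have : (N : ℝ) ^ (1 / 4 : ℝ) ≠ 0 := by positivity
          nth_rewrite 2 [hN4]
          field_simp
  have h4 : |L1 * N * ∑ d ∈ Ioc 0 N, gA a d / d - L1 * (∑' d : ℕ, gA a d / d) * N| ≤ L1 * (G * (N : ℝ) ^ (3 / 4 : ℝ)) := by
    have : L1 * N * ∑ d ∈ Ioc 0 N, gA a d / d - L1 * (∑' d : ℕ, gA a d / d) * N
        = -(L1 * ((∑' d : ℕ, gA a d / d - ∑ d ∈ Ioc 0 N, gA a d / d) * N)) := by ring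
    rw [this, abs_neg, abs_mul, abs_mul, abs_of_pos hL, abs_of_pos hN']
    exact mul_le_mul_of_nonneg_left h3 hL.le
  have := abs_sub_le (∑ n ∈ Ioc 0 N, hW a n) (L1 * N * ∑ d ∈ Ioc 0 N, gA a d / d) (L1 * (∑' d : ℕ, gA a d / d) * N)
  calc _ ≤ _ := this
    _ ≤ _ := add_le_add h2 h4
    _ = _ := by ring

end An

namespace An
open Finset Filter Topology

/-- `Σ h(n) n^{-s}` -/
noncomputable def FS1 (a : ℕ) (s : ℝ) : ℝ := ∑' n : ℕ, hW a n * (n : ℝ) ^ (-s)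

theorem mean {a : ℕ} {c K : ℝ} (h : ∀ N : ℕ,
    |∑ n ∈ Ioc 0 N, hW a n - c * N| ≤ K * (N : ℝ) ^ (3 / 4 : ℝ)) :
    Tendsto (fun N : ℕ => (∑ n ∈ Icc 1 N, hW a n) / (N : ℝ)) atTop (𝓝 c) := by
  rw [tendsto_iff_norm_sub_tendsto_zero]
  have hz : Tendsto (fun N : ℕ => K * (N : ℝ) ^ (-(1 / 4) : ℝ)) atTop (𝓝 0) := by
    have := ((tendsto_rpow_neg_atTop (show (0 : ℝ) < 1 / 4 by norm_num)).comp tendsto_natCast_atTop_atTop).const_mul K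
    simpa using this
  refine squeeze_zero' (Eventually.of_forall fun N => norm_nonneg _) ?_ hz
  filter_upwards [eventually_gt_atTop 0] with N hN
  have hN' : (0 : ℝ) < N := by exact_mod_cast hN
  have e : Icc 1 N = Ioc 0 N := by ext; simp; omega
  have e2 : (∑ n ∈ Ioc 0 N, hW a n) / (N : ℝ) - c = (∑ n ∈ Ioc 0 N, hW a n - c * N) / N := by
    field_simp
  rw [e, e2, Real.norm_eq_abs, abs_div, Nat.abs_cast, div_le_iff₀ hN']
  refine (h N).trans (le_of_eq ?_)
  have : (N : ℝ) ^ (3 / 4 : ℝ) = (N : ℝ) ^ (-(1 / 4) : ℝ) * N := by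
    nth_rewrite 3 [← Real.rpow_one (N : ℝ)]
    rw [← Real.rpow_add hN']; norm_num
  rw [this]; ring

theorem term_eq (a : ℕ) (s : ℝ) (n : ℕ) :
    LSeries.term (fun n => (hW a n : ℂ)) (s : ℂ) n = ((hW a n * (n : ℝ) ^ (-s) : ℝ) : ℂ) := by
  rcases Nat.eq_zero_or_pos n with rfl | hn
  · simp [hW_zero]
  · rw [LSeries.term_of_ne_zero (by omega), Real.rpow_neg (by positivity)]
    push_cast [Complex.ofReal_cpow (Nat.cast_nonneg n)]
    rw [div_eq_mul_inv]

theorem h_summable {a : ℕ} {c K : ℝ} (h : ∀ N : ℕ,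
    |∑ n ∈ Ioc 0 N, hW a n - c * N| ≤ K * (N : ℝ) ^ (3 / 4 : ℝ)) {s : ℝ} (hs : 1 < s) :
    Summable (fun n : ℕ => hW a n * (n : ℝ) ^ (-s)) := by
  have h1 : LSeriesSummable (fun n => (hW a n : ℂ)) (s : ℂ) := by
    refine LSeriesSummable_of_sum_norm_bigO_and_nonneg ?_ (hW_nonneg a) zero_le_one (by simpa using hs)
    exact Asymptotics.isBigO_atTop_natCast_rpow_of_tendsto_div_rpow (a := c) (by simpa using mean h)
  unfold LSeriesSummable at h1
  rw [funext (term_eq a s)] at h1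
  exact_mod_cast h1

theorem F_res {a : ℕ} {c K : ℝ} (h : ∀ N : ℕ,
    |∑ n ∈ Ioc 0 N, hW a n - c * N| ≤ K * (N : ℝ) ^ (3 / 4 : ℝ)) :
    Tendsto (fun s : ℝ => (s - 1) * FS1 a s) (𝓝[>] 1) (𝓝 c) := by
  have := LSeries_tendsto_sub_mul_nhds_one_of_tendsto_sum_div_and_nonneg (hW a) (mean h) (hW_nonneg a)
  have e : ∀ s : ℝ, ((s : ℂ) - 1) * LSeries (fun n => (hW a n : ℂ)) s = (((s - 1) * FS1 a s : ℝ) : ℂ) := by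
    intro s
    unfold LSeries FS1
    rw [funext (term_eq a s), ← Complex.ofReal_tsum]
    push_cast; rfl
  simp only [e] at this
  have h2 := (Complex.continuous_re.tendsto _).comp this
  simpa [Function.comp_def] using h2

/-- partial Euler product -/
noncomputable def PN (a : ℕ) (s : ℝ) (N : ℕ) : ℝ :=
  ∏ p ∈ N.primesBelow, (1 + hW a p * (p : ℝ) ^ (-s)) * (1 - (p : ℝ) ^ (-s))

theorem rpow_lt_one {p : ℕ} (hp : p.Prime) {s : ℝ} (hs : 1 ≤ s) : (p : ℝ) ^ (-s) ≤ 1 / p := by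
  have h1 : (1 : ℝ) ≤ p := by exact_mod_cast hp.one_le
  rw [one_div, ← Real.rpow_neg_one]
  exact Real.rpow_le_rpow_of_exponent_le h1 (by linarith)

theorem PN_lim {a : ℕ} {c K : ℝ} (h : ∀ N : ℕ,
    |∑ n ∈ Ioc 0 N, hW a n - c * N| ≤ K * (N : ℝ) ^ (3 / 4 : ℝ)) {s Φ : ℝ} (hs : 1 < s)
    (hΦ : Tendsto (PN a s) atTop (𝓝 Φ)) : Φ * (∑' n : ℕ, 1 / (n : ℝ) ^ s) = FS1 a s := by
  have hsum := h_summable h hs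
  have h1 := EulerProduct.eulerProduct (f := fun n : ℕ => hW a n * (n : ℝ) ^ (-s))
    (by simp [hW_one]) (fun {m n} hmn => by
      have e : hW a (m * n) = hW a m * hW a n := (hA_mult a).2 hmn
      simp only [e]; push_cast
      rw [Real.mul_rpow (by positivity) (by positivity)]; ring) hsum.norm (by simp [hW_zero])
  let f : ℕ →*₀ ℝ :=
    { toFun := fun n => (n : ℝ) ^ (-s)
      map_zero' := by simp; rw [Real.zero_rpow (by linarith)]
      map_one' := by simp
      map_mul' := fun m n => by
        push_cast
        rw [Real.mul_rpow (by positivity) (by positivity)] }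
  have hf : ∀ n : ℕ, f n = (n : ℝ) ^ (-s) := fun n => rfl
  have hfs : Summable (fun n => f n) := by
    simp only [hf]
    exact Real.summable_nat_rpow.2 (by linarith)
  have h2 := EulerProduct.eulerProduct_completely_multiplicative (f := f) hfs.norm
  have h3 := hΦ.mul h2
  have e : ∑' n : ℕ, f n = ∑' n : ℕ, 1 / (n : ℝ) ^ s := by
    apply tsum_congr; intro n
    rw [hf, Real.rpow_neg (by positivity), one_div]
  rw [e] at h3
  refine tendsto_nhds_unique h3 (h1.congr fun N => ?_)
  unfold PN
  rw [← prod_mul_distrib]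
  apply prod_congr rfl
  intro p hp
  have hp' := Nat.prime_of_mem_primesBelow hp
  have h5 : (1 : ℝ) - (p : ℝ) ^ (-s) ≠ 0 := by
    have := rpow_lt_one hp' hs.le
    have h2 : (1 : ℝ) / p < 1 := by
      rw [div_lt_one (by exact_mod_cast hp'.pos)]; exact_mod_cast hp'.one_lt
    linarith
  rw [hf, mul_assoc, mul_inv_cancel₀ h5, mul_one]
  have h6 : HasSum (fun k : ℕ => hW a (p ^ k) * ((p ^ k : ℕ) : ℝ) ^ (-s))
      (∑ k ∈ range 2, hW a (p ^ k) * ((p ^ k : ℕ) : ℝ) ^ (-s)) := by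
    apply hasSum_sum_of_ne_finset_zero
    intro k hk
    simp at hk
    rw [hW_prime_pow hp' hk, zero_mul]
  rw [h6.tsum_eq]
  simp [sum_range_succ, hW_one]

/-- the error terms in the logarithm -/
noncomputable def eA (a n : ℕ) (s : ℝ) : ℝ :=
  if n.Prime then Real.log ((1 + hW a n * (n : ℝ) ^ (-s)) * (1 - (n : ℝ) ^ (-s))) - chi n * (n : ℝ) ^ (-s)
  else 0

theorem log_one_add {x : ℝ} (hx : -(1 / 2) ≤ x) : |Real.log (1 + x) - x| ≤ 2 * x ^ 2 := by
  have h1 : 0 < 1 + x := by linarith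
  have h2 := Real.log_le_sub_one_of_pos h1
  have h3 := Real.one_sub_inv_le_log_of_pos h1
  have h4 : x - 2 * x ^ 2 ≤ 1 - (1 + x)⁻¹ := by
    have : 1 - (1 + x)⁻¹ = x / (1 + x) := by field_simp; ring
    rw [this, le_div_iff₀ h1]
    nlinarith [mul_nonneg (sq_nonneg x) (by linarith : 0 ≤ 1 + 2 * x)]
  rw [abs_le]
  constructor <;> nlinarith [sq_nonneg x]

/-- majorant -/
noncomputable def uA (a n : ℕ) : ℝ := 10 * (1 / (n : ℝ) ^ 2) + if n ∣ 2 * a then 2 else 0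

theorem uA_summable {a : ℕ} (ha : a ≠ 0) : Summable (uA a) := by
  apply Summable.add
  · exact (Real.summable_one_div_nat_pow.2 (by norm_num)).mul_left 10
  · apply summable_of_ne_finset_zero (s := (2 * a).divisors)
    intro n hn
    rw [if_neg]
    intro h
    exact hn (Nat.mem_divisors.2 ⟨h, by omega⟩)

theorem t_half {p : ℕ} (hp : p.Prime) {s : ℝ} (hs : 1 ≤ s) : (p : ℝ) ^ (-s) ≤ 1 / 2 := by
  refine (rpow_lt_one hp hs).trans ?_
  exact one_div_le_one_div_of_le (by norm_num) (by exact_mod_cast hp.two_le)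

theorem eA_bound (a n : ℕ) {s : ℝ} (hs : 1 ≤ s) : |eA a n s| ≤ uA a n := by
  unfold eA
  by_cases hp : n.Prime
  swap
  · rw [if_neg hp, abs_zero]; unfold uA; split_ifs <;> positivity
  rw [if_pos hp]
  have hn0 : (0 : ℝ) < n := by exact_mod_cast hp.pos
  set t := (n : ℝ) ^ (-s) with ht
  have ht0 : 0 ≤ t := by positivity
  have hth := t_half hp hs
  have htn : t ≤ 1 / n := rpow_lt_one hp hs
  have hf0 := hW_nonneg a n
  have hf2 := hW_prime_le (a := a) hp
  have hx0 : 0 ≤ hW a n * t := mul_nonneg hf0 ht0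
  have l1 := log_one_add (x := hW a n * t) (by linarith)
  have l2 := log_one_add (x := -t) (by linarith)
  rw [Real.log_mul (by linarith) (by linarith)]
  have ht2 : t ^ 2 ≤ 1 / (n : ℝ) ^ 2 := by
    rw [← one_div_pow]; exact pow_le_pow_left₀ ht0 htn 2
  have hx2 : (hW a n * t) ^ 2 ≤ 4 * t ^ 2 := by
    rw [mul_pow]; apply mul_le_mul_of_nonneg_right _ (sq_nonneg t); nlinarith
  have hd : |(hW a n - 1 - chi n) * t| ≤ if n ∣ 2 * a then 2 else 0 := by
    have hh := vA_p (a := a) hp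
    unfold vA at hh
    by_cases hdv : n ∣ 2 * a
    · rw [if_pos hdv, abs_mul, abs_of_nonneg ht0]
      have := chi_abs_le n
      rw [abs_le] at this
      have : |hW a n - 1 - chi n| ≤ 3 := by rw [abs_le]; constructor <;> linarith
      nlinarith [abs_nonneg (hW a n - 1 - chi n)]
    · have h2 : n ≠ 2 := by rintro rfl; exact hdv (dvd_mul_right 2 a)
      have h3 : ¬ n ∣ a := fun h' => hdv (h'.mul_left 2)
      rw [if_neg hdv, hW_sub_one hp h2 h3]; simp
  unfold uA
  have e : Real.log (1 + hW a n * t) + Real.log (1 - t) - chi n * t =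
    (Real.log (1 + hW a n * t) - hW a n * t) + (Real.log (1 + -t) - -t) + (hW a n - 1 - chi n) * t := by
    rw [← sub_eq_add_neg]; ring
  rw [e]
  have a1 := abs_add_three (Real.log (1 + hW a n * t) - hW a n * t) (Real.log (1 + -t) - -t) ((hW a n - 1 - chi n) * t)
  rw [neg_sq] at l2
  linarith

theorem eA_cont (a n : ℕ) : Tendsto (fun s : ℝ => eA a n s) (𝓝[>] 1) (𝓝 (eA a n 1)) := by
  unfold eA
  by_cases hp : n.Prime
  swap
  · simp [hp]
  simp only [if_pos hp]
  have hn0 : (n : ℝ) ≠ 0 := by exact_mod_cast hp.ne_zero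
  have hc : Tendsto (fun s : ℝ => (n : ℝ) ^ (-s)) (𝓝[>] 1) (𝓝 ((n : ℝ) ^ (-(1 : ℝ)))) :=
    (((Real.continuous_const_rpow hn0).comp continuous_neg).tendsto 1).mono_left nhdsWithin_le_nhds
  have hth := t_half hp (le_refl (1 : ℝ))
  have hx0 : 0 ≤ hW a n * (n : ℝ) ^ (-(1 : ℝ)) := mul_nonneg (hW_nonneg a n) (by positivity)
  refine Tendsto.sub (Tendsto.log (((hc.const_mul _).const_add 1).mul (hc.const_sub 1)) ?_) (hc.const_mul _)
  exact mul_ne_zero (by linarith) (by linarith)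

theorem PN_exp (a N : ℕ) {s : ℝ} (hs : 1 ≤ s) : PN a s N =
    Real.exp (∑ n ∈ range N, (if n.Prime then chi n / n else 0) * (n : ℝ) ^ (-(s - 1)) + ∑ n ∈ range N, eA a n s) := by
  rw [← sum_add_distrib, Real.exp_sum]
  unfold PN Nat.primesBelow
  rw [prod_filter]
  apply prod_congr rfl
  intro n _
  unfold eA
  split_ifs with hp
  · have hn0 : (0 : ℝ) < n := by exact_mod_cast hp.pos
    have e : chi n / n * (n : ℝ) ^ (-(s - 1)) = chi n * (n : ℝ) ^ (-s) := by
      rw [show -s = -(s - 1) + (-1) by ring, Real.rpow_add hn0, Real.rpow_neg_one]; field_simp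
    rw [e, add_sub_cancel, Real.exp_log]
    have hth := t_half hp hs
    have hx0 : 0 ≤ hW a n * (n : ℝ) ^ (-s) := mul_nonneg (hW_nonneg a n) (by positivity)
    exact mul_pos (by linarith) (by linarith)
  · simp

theorem main {a : ℕ} (ha : a ≠ 0) : ∃ c K : ℝ, Tendsto (PN a 1) atTop (𝓝 c) ∧ ∀ N : ℕ,
    |∑ n ∈ Ioc 0 N, hW a n - c * N| ≤ K * (N : ℝ) ^ (3 / 4 : ℝ) := by
  obtain ⟨c, K, hc⟩ := sum_h ha
  refine ⟨c, K, ?_, hc⟩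
  obtain ⟨S, hS⟩ := prime_chi_conv
  obtain ⟨T, hT0, hT, hTc⟩ := abel_series (by simp [Nat.not_prime_zero]) hS
  have hus := uA_summable ha
  have hes : ∀ s : ℝ, 1 ≤ s → Summable (fun n => eA a n s) := fun s hs =>
    Summable.of_norm_bounded hus (fun n => eA_bound a n hs)
  have hlim : ∀ s : ℝ, 1 ≤ s → Tendsto (PN a s) atTop (𝓝 (Real.exp (T (s - 1) + ∑' n, eA a n s))) := by
    intro s hs
    refine ((Real.continuous_exp.tendsto _).comp
      ((hT (s - 1) (by linarith)).add (hes s hs).hasSum.tendsto_sum_nat)).congr fun N => ?_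
    exact (PN_exp a N hs).symm
  have hE : Tendsto (fun s : ℝ => ∑' n, eA a n s) (𝓝[>] 1) (𝓝 (∑' n, eA a n 1)) := by
    apply tendsto_tsum_of_dominated_convergence hus (fun n => eA_cont a n)
    filter_upwards [self_mem_nhdsWithin] with s hs n
    exact eA_bound a n (le_of_lt hs)
  have hT1 : Tendsto (fun s : ℝ => T (s - 1)) (𝓝[>] 1) (𝓝 S) := by
    refine hTc.comp ?_
    apply tendsto_nhdsWithin_of_tendsto_nhds_of_eventually_within
    · have : Tendsto (fun s : ℝ => s - 1) (𝓝 1) (𝓝 (1 - 1)) := (continuous_id.sub continuous_const).tendsto 1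
      rw [sub_self] at this
      exact this.mono_left nhdsWithin_le_nhds
    · filter_upwards [self_mem_nhdsWithin] with s hs
      simpa using hs
  have hΦ : Tendsto (fun s : ℝ => Real.exp (T (s - 1) + ∑' n, eA a n s)) (𝓝[>] 1)
      (𝓝 (Real.exp (S + ∑' n, eA a n 1))) := (Real.continuous_exp.tendsto _).comp (hT1.add hE)
  have h1 := hΦ.mul tendsto_sub_mul_tsum_nat_rpow
  rw [mul_one] at h1
  have h2 := F_res hc
  have h3 : Real.exp (S + ∑' n, eA a n 1) = c := by
    refine tendsto_nhds_unique h1 (h2.congr' ?_)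
    filter_upwards [self_mem_nhdsWithin] with s hs
    rw [← PN_lim hc hs (hlim s (le_of_lt hs))]; ring
  have h4 := hlim 1 le_rfl
  rw [sub_self, hT0, h3] at h4
  exact h4

end An

open Filter Asymptotics

theorem An.err_bound {ε : ℝ} : (fun X : ℝ => X ^ ((1 : ℝ) / 4)) =O[atTop]
    fun X : ℝ => X ^ ((1 : ℝ) / 3) / Real.log X ^ (1 - ε) := by
  have h := (isLittleO_log_rpow_rpow_atTop (1 - ε) (show (0 : ℝ) < 1 / 12 by norm_num)).bound
    (show (0 : ℝ) < 1 by norm_num)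
  apply IsBigO.of_bound 1
  filter_upwards [h, eventually_gt_atTop 1] with X hX hX1
  have hX0 : 0 < X := by linarith
  have hl : 0 < Real.log X := Real.log_pos hX1
  have hlp : 0 < Real.log X ^ (1 - ε) := Real.rpow_pos_of_pos hl _
  rw [Real.norm_of_nonneg hlp.le, Real.norm_of_nonneg (by positivity), one_mul] at hX
  rw [Real.norm_of_nonneg (by positivity), Real.norm_of_nonneg (by positivity), one_mul, le_div_iff₀ hlp]
  calc _ ≤ X ^ ((1 : ℝ) / 4) * X ^ ((1 : ℝ) / 12) := by gcongr
    _ = _ := by rw [← Real.rpow_add hX0]; norm_num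

/-- For `A` a positive odd squarefree integer, the Euler-product limit
`C_{Σ_A}` exists and, for every `0 < ε < 1`, the number of totally real `C₄`-quartic
subfields `K` of `ℂ` with `Δ_K ≤ X`, `v₂(Δ_K) = 6`, and `v_p(Δ_K) = 2 ↔ p ∣ A` for all
odd primes `p`, equals `(C_{Σ_A}/(2⁹A²)^{1/3})·X^{1/3} + O(X^{1/3}/(log X)^{1−ε})`. -/
theorem stmt11 (A : ℤ) (hA : 0 < A) (hodd : Odd A) (hsf : Squarefree A) :
    ∃ C : ℝ,
      Tendsto (fun T : ℕ =>
          ∏ p ∈ (Finset.range (T + 1)).filter Nat.Prime,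
            (1 + fA A p / p) * (1 - 1 / (p : ℝ)))
        atTop (nhds C) ∧
      ∀ ε : ℝ, 0 < ε → ε < 1 →
        (fun X : ℝ =>
            (Nat.card {K : IntermediateField ℚ ℂ //
                IsC4Quartic K ∧ IsTotallyRealSubfield K ∧ (quartDisc K : ℝ) ≤ X ∧
                padicValInt 2 (quartDisc K) = 6 ∧
                ∀ p : ℕ, p.Prime → p ≠ 2 →
                  (padicValInt p (quartDisc K) = 2 ↔ (p : ℤ) ∣ A)} : ℝ) -
              C / (2 ^ 9 * (A : ℝ) ^ 2) ^ ((1 : ℝ) / 3) * X ^ ((1 : ℝ) / 3))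
          =O[atTop] fun X : ℝ => X ^ ((1 : ℝ) / 3) / Real.log X ^ (1 - ε) := by
  lift A to ℕ using hA.le with a
  have hodd' : Odd a := by exact_mod_cast hodd
  have hsf' : Squarefree a := Int.squarefree_natCast.1 hsf
  have ha0 : a ≠ 0 := hsf'.ne_zero
  obtain ⟨c, K, hlim, hsum⟩ := An.main ha0
  refine ⟨c, ?_, ?_⟩
  · refine ((tendsto_add_atTop_iff_nat 1).2 hlim).congr fun T => ?_
    unfold An.PN Nat.primesBelow
    apply Finset.prod_congr rfl
    intro p hp
    have hp' := (Finset.mem_filter.1 hp).2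
    have e : fA (a : ℤ) p = hW a p := by
      rw [An.hW_prime hp']; unfold fA
      simp only [Int.natCast_dvd_natCast]
    rw [e, Real.rpow_neg_one, one_div, div_eq_mul_inv]
  · intro ε _ _
    refine IsBigO.trans (IsBigO.of_bound (|K| + |c| + 1) ?_) (An.err_bound (ε := ε))
    set q : ℝ := 64 * (a : ℝ) ^ 2 with hq
    have ha1 : (1 : ℝ) ≤ a := by exact_mod_cast Nat.one_le_iff_ne_zero.2 ha0
    have hq1 : 1 ≤ q := by rw [hq]; nlinarith
    have hq0 : 0 < q := by linarith
    filter_upwards [eventually_ge_atTop q] with X hX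
    have hX0 : 0 < X := by linarith
    have hXq1 : 1 ≤ X / q := by rw [le_div_iff₀ hq0]; linarith
    set Y : ℝ := (X / q) ^ ((1 : ℝ) / 3) with hY
    have hY1 : 1 ≤ Y := Real.one_le_rpow hXq1 (by norm_num)
    have hY3 : Y ^ (3 : ℕ) = X / q := by
      rw [hY, ← Real.rpow_natCast, ← Real.rpow_mul (by linarith)]; norm_num
    set N := ⌊Y⌋₊ with hNdef
    have hN1 : 1 ≤ N := Nat.le_floor (by simpa using hY1)
    have hN : ∀ D : ℕ, (64 * (a : ℝ) ^ 2 * D ^ 3 ≤ X) ↔ D ≤ N := by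
      intro D
      rw [hNdef, Nat.le_floor_iff (by linarith), ← hq, mul_comm, ← le_div_iff₀ hq0, ← hY3]
      exact pow_le_pow_iff_left₀ (by positivity) (by linarith) (by norm_num)
    have hcount := Rel4.count hodd' hsf' hN1 hN
    have hs := hsum N
    have e0 : Finset.Icc 1 N = Finset.Ioc 0 N := by ext; simp; omega
    rw [e0] at hcount
    have hNY : (N : ℝ) ≤ Y := Nat.floor_le (by linarith)
    have hYN : Y < N + 1 := Nat.lt_floor_add_one Y
    have hmain : c / (2 ^ 9 * (((a : ℕ) : ℤ) : ℝ) ^ 2) ^ ((1 : ℝ) / 3) * X ^ ((1 : ℝ) / 3) = c * Y / 2 := by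
      have e1 : (2 ^ 9 * (((a : ℕ) : ℤ) : ℝ) ^ 2) = 2 ^ (3 : ℕ) * q := by
        rw [hq]; push_cast; ring
      have e2 : ((2 : ℝ) ^ (3 : ℕ)) ^ ((1 : ℝ) / 3) = 2 := by
        rw [← Real.rpow_natCast, ← Real.rpow_mul (by norm_num)]; norm_num
      have hqp : 0 < q ^ ((1 : ℝ) / 3) := by positivity
      rw [e1, Real.mul_rpow (by norm_num) hq0.le, e2, hY, Real.div_rpow hX0.le hq0.le]
      field_simp
    rw [hmain]
    have hP1 : 1 ≤ X ^ ((1 : ℝ) / 4) := Real.one_le_rpow (by linarith) (by norm_num)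
    have hP : (N : ℝ) ^ (3 / 4 : ℝ) ≤ X ^ ((1 : ℝ) / 4) := by
      calc (N : ℝ) ^ (3 / 4 : ℝ) ≤ Y ^ (3 / 4 : ℝ) := by gcongr
        _ = (X / q) ^ ((1 : ℝ) / 4) := by rw [hY, ← Real.rpow_mul (by linarith)]; norm_num
        _ ≤ _ := by
          apply Real.rpow_le_rpow (by linarith) _ (by norm_num)
          exact div_le_self hX0.le hq1
    have hs2 : |∑ n ∈ Finset.Ioc 0 N, hW a n - c * N| ≤ |K| * X ^ ((1 : ℝ) / 4) :=
      hs.trans (mul_le_mul (le_abs_self K) hP (by positivity) (abs_nonneg K))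
    have hc2 : |c * (N - Y)| ≤ |c| := by
      rw [abs_mul]
      apply mul_le_of_le_one_right (abs_nonneg c)
      rw [abs_le]; constructor <;> linarith
    rw [Real.norm_eq_abs, Real.norm_of_nonneg (by linarith : 0 ≤ X ^ ((1 : ℝ) / 4))]
    have hcP : |c| ≤ |c| * X ^ ((1 : ℝ) / 4) := le_mul_of_one_le_right (abs_nonneg c) hP1
    have hKP : 0 ≤ |K| * X ^ ((1 : ℝ) / 4) := by positivity
    have hc0 := abs_nonneg c
    rw [abs_le] at hs2 hc2 ⊢
    constructor <;> linarith
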